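/- Let P = B ∪ R be a bichromatic set of 2n points in the plane in general position with |B| = |R| = n. Then there exists a BR-matching H on P (a ham-sandwich matching) such that every BR-matching M on P is n-compatible with H. -/

import Mathlib

open Finset
open scoped Classical

/-- Points in the plane. -/
abbrev Pt : Type := ℝ × ℝ

/-- A finite point set is in general position if no three distinct points are collinear. -/
def GenPos (S : Finset Pt) : Prop :=
  ∀ p ∈ S, ∀ q ∈ S, ∀ r ∈ S, p ≠ q → p ≠ r → q ≠ r →
    ¬ Collinear ℝ ({p, q, r} : Set Pt)

/-- `M` is a plane perfect bichromatic (BR-) matching on the bichromatic point set `B ∪ R`: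
each edge `e ∈ M` is a pair (blue endpoint, red endpoint); every blue point is the blue
endpoint of exactly one edge, every red point is the red endpoint of exactly one edge, and
the (closed) segments of distinct edges are disjoint. -/
def IsBRMatching (B R : Finset Pt) (M : Finset (Pt × Pt)) : Prop :=
  (∀ e ∈ M, e.1 ∈ B ∧ e.2 ∈ R) ∧
  (∀ b ∈ B, ∃! e, e ∈ M ∧ e.1 = b) ∧
  (∀ r ∈ R, ∃! e, e ∈ M ∧ e.2 = r) ∧
  (∀ e ∈ M, ∀ e' ∈ M, e ≠ e' →
    segment ℝ e.1 e.2 ∩ segment ℝ e'.1 e'.2 = ∅)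

/-- Two matchings are compatible if any two of their segments intersect in at most a
common endpoint (shared edges are allowed). -/
def Compatible (M M' : Finset (Pt × Pt)) : Prop :=
  ∀ e ∈ M, ∀ e' ∈ M', e = e' ∨
    segment ℝ e.1 e.2 ∩ segment ℝ e'.1 e'.2 ⊆
      {x : Pt | (x = e.1 ∨ x = e.2) ∧ (x = e'.1 ∨ x = e'.2)}

/-- `M` and `M'` are `t`-compatible: there is a transformation (sequence of BR-matchings
on `B ∪ R` in which consecutive matchings are compatible) of length `k ≤ t` between them. -/
def TCompatible (B R : Finset Pt) (t : ℕ) (M M' : Finset (Pt × Pt)) : Prop :=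
  ∃ k ≤ t, ∃ f : ℕ → Finset (Pt × Pt),
    f 0 = M ∧ f k = M' ∧ (∀ i ≤ k, IsBRMatching B R (f i)) ∧
    ∀ i < k, Compatible (f i) (f (i + 1))

/-- The line `{p | a * p.1 + b * p.2 = c}`. -/
def lineSet (a b c : ℝ) : Set Pt := {p : Pt | a * p.1 + b * p.2 = c}

/-- The line given by `a * x + b * y = c` is a ham-sandwich cut of the bichromatic point
set `B ∪ R` (with `|B| = |R| = n`): it contains no point of `B ∪ R`, and one of its open
sides contains exactly `⌊n/2⌋` blue and `⌊n/2⌋` red points while the other open side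
contains exactly `⌈n/2⌉` blue and `⌈n/2⌉` red points. -/
def IsHamSandwichCut (a b c : ℝ) (B R : Finset Pt) (n : ℕ) : Prop :=
  (a, b) ≠ ((0 : ℝ), (0 : ℝ)) ∧
  (∀ p ∈ B ∪ R, a * p.1 + b * p.2 ≠ c) ∧
  (((B.filter fun p => a * p.1 + b * p.2 < c).card = n / 2 ∧
    (R.filter fun p => a * p.1 + b * p.2 < c).card = n / 2 ∧
    (B.filter fun p => a * p.1 + b * p.2 > c).card = (n + 1) / 2 ∧
    (R.filter fun p => a * p.1 + b * p.2 > c).card = (n + 1) / 2) ∨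
   ((B.filter fun p => a * p.1 + b * p.2 < c).card = (n + 1) / 2 ∧
    (R.filter fun p => a * p.1 + b * p.2 < c).card = (n + 1) / 2 ∧
    (B.filter fun p => a * p.1 + b * p.2 > c).card = n / 2 ∧
    (R.filter fun p => a * p.1 + b * p.2 > c).card = n / 2))

/-- The edge `e` crosses the line `a * x + b * y = c`: its segment meets the line. -/
def Crosses (a b c : ℝ) (e : Pt × Pt) : Prop :=
  ∃ x ∈ segment ℝ e.1 e.2, a * x.1 + b * x.2 = c

section

/-- The planar cross product. -/
def crs (u v : Pt) : ℝ := u.1 * v.2 - u.2 * v.1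

lemma crs_add_left (u v w : Pt) : crs (u + v) w = crs u w + crs v w := by
  simp only [crs, Prod.fst_add, Prod.snd_add]; ring
lemma crs_add_right (u v w : Pt) : crs w (u + v) = crs w u + crs w v := by
  simp only [crs, Prod.fst_add, Prod.snd_add]; ring
lemma crs_sub_left (u v w : Pt) : crs (u - v) w = crs u w - crs v w := by
  simp only [crs, Prod.fst_sub, Prod.snd_sub]; ring
lemma crs_sub_right (u v w : Pt) : crs w (u - v) = crs w u - crs w v := by
  simp only [crs, Prod.fst_sub, Prod.snd_sub]; ring
lemma crs_smul_left (a : ℝ) (u v : Pt) : crs (a • u) v = a * crs u v := by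
  simp only [crs, Prod.smul_fst, Prod.smul_snd, smul_eq_mul]; ring
lemma crs_smul_right (a : ℝ) (u v : Pt) : crs u (a • v) = a * crs u v := by
  simp only [crs, Prod.smul_fst, Prod.smul_snd, smul_eq_mul]; ring
lemma crs_neg_left (u v : Pt) : crs (-u) v = - crs u v := by
  simp only [crs, Prod.fst_neg, Prod.snd_neg]; ring
lemma crs_neg_right (u v : Pt) : crs u (-v) = - crs u v := by
  simp only [crs, Prod.fst_neg, Prod.snd_neg]; ring
lemma crs_self (u : Pt) : crs u u = 0 := by simp only [crs]; ring
lemma crs_swap (u v : Pt) : crs u v = - crs v u := by simp only [crs]; ring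
lemma crs_zero_left (u : Pt) : crs 0 u = 0 := by simp [crs]
lemma crs_zero_right (u : Pt) : crs u 0 = 0 := by simp [crs]

lemma continuous_crs_left (v : Pt) : Continuous fun u => crs u v := by
  unfold crs; fun_prop
lemma continuous_crs_right (v : Pt) : Continuous fun u => crs v u := by
  unfold crs; fun_prop

/-- Vectors parallel to a nonzero vector are multiples of it. -/
lemma exists_smul_of_crs_eq_zero {u v : Pt} (hu : u ≠ 0) (h : crs u v = 0) :
    ∃ a : ℝ, v = a • u := by
  simp only [crs] at h
  by_cases h1 : u.1 = 0
  · have h2 : u.2 ≠ 0 := fun h2 => hu (Prod.ext h1 h2)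
    refine ⟨v.2 / u.2, Prod.ext ?_ ?_⟩
    · simp only [Prod.smul_fst, smul_eq_mul, h1, mul_zero]
      rw [h1] at h
      have : u.2 * v.1 = 0 := by linarith
      simpa [h2] using this
    · simp [h2]
  · refine ⟨v.1 / u.1, Prod.ext ?_ ?_⟩
    · simp [h1]
    · simp only [Prod.smul_snd, smul_eq_mul]
      field_simp
      linarith

/-- Expansion of a vector in a basis. -/
lemma crs_expand (u v w : Pt) : crs u v • w = crs w v • u + crs u w • v := by
  ext <;> simp only [crs, Prod.smul_fst, Prod.smul_snd, Prod.fst_add, Prod.snd_add, smul_eq_mul] <;>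
    ring

lemma exists_coords {u v : Pt} (h : crs u v ≠ 0) (w : Pt) :
    ∃ a b : ℝ, w = a • u + b • v := by
  refine ⟨crs w v / crs u v, crs u w / crs u v, ?_⟩
  have h2 : (crs u v)⁻¹ • (crs u v • w) = w := by rw [smul_smul, inv_mul_cancel₀ h, one_smul]
  rw [crs_expand u v w, smul_add, smul_smul, smul_smul] at h2
  rw [div_eq_inv_mul, div_eq_inv_mul, h2]

/-- A wall: the part with parameters in `[A, B]` of the line through `b` and `r`,
with labels for its two extensions. -/
structure Wall where
  b : Pt
  r : Pt
  A : ℝ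
  B : ℝ
  al : ℤ
  be : ℤ

namespace Wall

def dir (w : Wall) : Pt := w.r - w.b
def pt (w : Wall) (s : ℝ) : Pt := w.b + s • w.dir
def cl (w : Wall) : Set Pt := w.pt '' Set.Icc w.A w.B
def op (w : Wall) : Set Pt := w.pt '' Set.Ioo w.A w.B
/-- Label of the wall at parameter `s`, seen from the side `u`. -/
noncomputable def lab (w : Wall) (u : Pt) (s : ℝ) : ℤ :=
  if s < 0 then w.al else if 1 < s then w.be else if 0 < crs w.dir u then 1 else 0

lemma pt_zero (w : Wall) : w.pt 0 = w.b := by simp [pt]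
lemma pt_one (w : Wall) : w.pt 1 = w.r := by simp [pt, dir]
lemma pt_add (w : Wall) (s t : ℝ) : w.pt (s + t) = w.pt s + t • w.dir := by
  simp only [pt, add_smul]; abel
lemma pt_eq (w : Wall) (s t : ℝ) : w.pt t = w.pt s + (t - s) • w.dir := by
  rw [← pt_add]; congr 1; ring
lemma continuous_pt (w : Wall) : Continuous w.pt := by unfold pt; fun_prop
lemma isCompact_cl (w : Wall) : IsCompact w.cl := isCompact_Icc.image w.continuous_pt
lemma op_subset_cl (w : Wall) : w.op ⊆ w.cl := Set.image_mono Set.Ioo_subset_Icc_self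
lemma dir_ne {w : Wall} (h : w.b ≠ w.r) : w.dir ≠ 0 := by
  intro h'; exact h (sub_eq_zero.1 h').symm
lemma pt_inj {w : Wall} (h : w.b ≠ w.r) {s t : ℝ} (hst : w.pt s = w.pt t) : s = t := by
  rw [w.pt_eq t s] at hst
  have : (s - t) • w.dir = 0 := by simpa using hst
  rcases smul_eq_zero.1 this with h1 | h1
  · linarith
  · exact absurd h1 (dir_ne h)
lemma lab_zero_one {w : Wall} (ha : w.al = 0 ∨ w.al = 1) (hb : w.be = 0 ∨ w.be = 1) (u : Pt)
    (s : ℝ) : w.lab u s = 0 ∨ w.lab u s = 1 := by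
  unfold lab; split_ifs <;> simp_all
lemma lab_smul (w : Wall) (u : Pt) (s : ℝ) {a : ℝ} (ha : 0 < a) :
    w.lab (a • u) s = w.lab u s := by
  unfold lab
  have : 0 < crs w.dir (a • u) ↔ 0 < crs w.dir u := by
    rw [crs_smul_right]; exact mul_pos_iff_of_pos_left ha
  simp only [this]

end Wall

/-- `p` is an endpoint of a segment in `M`. -/
def EndP (M : Finset (Pt × Pt)) (p : Pt) : Prop := ∃ e ∈ M, p = e.1 ∨ p = e.2

/-- The geometric properties of a matching in general position. -/
structure PM (M : Finset (Pt × Pt)) : Prop where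
  ne : ∀ e ∈ M, ∀ f ∈ M, e.1 ≠ f.2
  inj1 : ∀ e ∈ M, ∀ f ∈ M, e.1 = f.1 → e = f
  inj2 : ∀ e ∈ M, ∀ f ∈ M, e.2 = f.2 → e = f
  gp : ∀ p q r, EndP M p → EndP M q → EndP M r → p ≠ q → p ≠ r → q ≠ r →
    crs (q - p) (r - p) ≠ 0
  disj : ∀ e ∈ M, ∀ f ∈ M, e ≠ f → segment ℝ e.1 e.2 ∩ segment ℝ f.1 f.2 = ∅

/-- Points of the box that lie on no wall. -/
def Free (N : ℝ) (W : Finset Wall) (x : Pt) : Prop := ‖x‖ < N ∧ ∀ w ∈ W, x ∉ w.cl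

/-- `e` lies in the relative interior of a wall transversal to `u`, at a point with label `c`. -/
def TJ (W : Finset Wall) (e u : Pt) (c : ℤ) : Prop :=
  ∃ k ∈ W, ∃ s, k.A < s ∧ s < k.B ∧ s ≠ 0 ∧ s ≠ 1 ∧ k.pt s = e ∧ crs k.dir u ≠ 0 ∧ k.lab u s = c

/-- A labelled configuration of walls containing the matching `M`. -/
structure Cfg (M : Finset (Pt × Pt)) (N : ℝ) (W : Finset Wall) : Prop where
  ne : ∀ w ∈ W, w.b ≠ w.r
  lt : ∀ w ∈ W, w.A < w.B
  al01 : ∀ w ∈ W, w.al = 0 ∨ w.al = 1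
  be01 : ∀ w ∈ W, w.be = 0 ∨ w.be = 1
  typ : ∀ w ∈ W, ((w.b, w.r) ∈ M ∧ w.A ≤ 0 ∧ 1 ≤ w.B) ∨ (w.B < 0 ∧ w.al = w.be)
  opd : ∀ w ∈ W, ∀ k ∈ W, ∀ x, x ∈ w.op → x ∈ k.op → w = k
  endA : ∀ w ∈ W, w.A = 0 ∨ N < ‖w.pt w.A‖ ∨ TJ W (w.pt w.A) w.dir w.al
  endB : ∀ w ∈ W, w.B = 1 ∨ N < ‖w.pt w.B‖ ∨ TJ W (w.pt w.B) (-w.dir) w.be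
  mark : ∀ p, EndP M p → ∀ w ∈ W, ∀ s, w.A ≤ s → s ≤ w.B → w.pt s = p → s = 0 ∨ s = 1
  hasM : ∀ e ∈ M, ∃ w ∈ W, w.b = e.1 ∧ w.r = e.2 ∧ w.A ≤ 0 ∧ 1 ≤ w.B
  encl : ∀ x : Pt, ‖x‖ = N → ∃ w ∈ W, x ∈ w.op

/-- All extensions have been carried out. -/
def Full (W : Finset Wall) : Prop := ∀ w ∈ W, w.A ≠ 0 ∧ w.B ≠ 1

def Vis (N : ℝ) (W : Finset Wall) (x y : Pt) : Prop :=
  ∀ t : ℝ, 0 ≤ t → t ≤ 1 → Free N W (x + t • (y - x))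

def Sees (N : ℝ) (W : Finset Wall) (x y : Pt) : Prop :=
  ∀ t : ℝ, 0 ≤ t → t < 1 → Free N W (x + t • (y - x))

/-- The ray from `o` in direction `u` first hits the walls at time `τ`, in the relative interior
of `w`, at parameter `s`. -/
structure HitAt (N : ℝ) (W : Finset Wall) (o u : Pt) (τ : ℝ) (w : Wall) (s : ℝ) : Prop where
  pos : 0 < τ
  mem : w ∈ W
  hA : w.A < s
  hB : s < w.B
  eq : o + τ • u = w.pt s
  free : ∀ t, 0 ≤ t → t < τ → Free N W (o + t • u)

variable {M : Finset (Pt × Pt)} {N : ℝ} {W : Finset Wall}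

lemma Vis.free_left {x y : Pt} (h : Vis N W x y) : Free N W x := by
  simpa using h 0 le_rfl zero_le_one
lemma Vis.free_right {x y : Pt} (h : Vis N W x y) : Free N W y := by
  simpa using h 1 zero_le_one le_rfl
lemma Vis.symm {x y : Pt} (h : Vis N W x y) : Vis N W y x := by
  intro t h0 h1
  have := h (1 - t) (by linarith) (by linarith)
  convert this using 1
  module
lemma Vis.refl {x : Pt} (h : Free N W x) : Vis N W x x := by
  intro t _ _; simpa using h
lemma Vis.sees {x y : Pt} (h : Vis N W x y) : Sees N W x y := fun t h0 h1 => h t h0 h1.le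
lemma Sees.vis {x y : Pt} (h : Sees N W x y) (hy : Free N W y) : Vis N W x y := by
  intro t h0 h1
  rcases h1.lt_or_eq with h2 | h2
  · exact h t h0 h2
  · subst h2; simpa using hy

lemma isCompact_walls (W : Finset Wall) : IsCompact (⋃ w ∈ W, w.cl) :=
  W.isCompact_biUnion fun w _ => w.isCompact_cl

lemma mem_walls {x : Pt} : x ∈ (⋃ w ∈ W, w.cl) ↔ ∃ w ∈ W, x ∈ w.cl := by simp

lemma isOpen_free (N : ℝ) (W : Finset Wall) : IsOpen {x | Free N W x} := by
  have h : {x | Free N W x} = {x : Pt | ‖x‖ < N} ∩ (⋃ w ∈ W, w.cl)ᶜ := by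
    ext x
    simp [Free]
  rw [h]
  exact (isOpen_lt continuous_norm continuous_const).inter (isCompact_walls W).isClosed.isOpen_compl

namespace Cfg

lemma endP_of_mark (h : Cfg M N W) {w : Wall} (hw : w ∈ W) {s : ℝ} (h0 : w.A ≤ s)
    (h1 : s ≤ w.B) (hs : s = 0 ∨ s = 1) : EndP M (w.pt s) ∧ (w.b, w.r) ∈ M := by
  rcases h.typ w hw with ⟨ht, _, _⟩ | ⟨ht, _⟩
  · refine ⟨⟨_, ht, ?_⟩, ht⟩
    rcases hs with rfl | rfl
    · left; exact w.pt_zero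
    · right; exact w.pt_one
  · rcases hs with rfl | rfl <;> linarith

lemma eq_of_edge (h : Cfg M N W) {w k : Wall} (hw : w ∈ W) (hk : k ∈ W)
    (hA : w.A ≤ 0) (hB : 1 ≤ w.B) (hA' : k.A ≤ 0) (hB' : 1 ≤ k.B)
    (e1 : w.b = k.b) (e2 : w.r = k.r) : w = k := by
  refine h.opd w hw k hk (w.pt (1/2)) ⟨1/2, ⟨by linarith, by linarith⟩, rfl⟩
    ⟨1/2, ⟨by linarith, by linarith⟩, ?_⟩
  simp only [Wall.pt, Wall.dir, e1, e2]

lemma eq_of_endP (hM : PM M) (h : Cfg M N W) {p : Pt} (hp : EndP M p) {w k : Wall} (hw : w ∈ W)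
    (hk : k ∈ W) (h1 : p ∈ w.cl) (h2 : p ∈ k.cl) : w = k := by
  obtain ⟨s, ⟨hs0, hs1⟩, rfl⟩ := h1
  obtain ⟨t, ⟨ht0, ht1⟩, hts⟩ := h2
  have hs := h.mark _ hp w hw s hs0 hs1 rfl
  have ht := h.mark _ hp k hk t ht0 ht1 hts
  have hwM := (h.endP_of_mark hw hs0 hs1 hs).2
  have hkM := (h.endP_of_mark hk ht0 ht1 ht).2
  have tw : w.A ≤ 0 ∧ 1 ≤ w.B := by
    rcases h.typ w hw with ⟨_, a, b⟩ | ⟨a, _⟩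
    · exact ⟨a, b⟩
    · rcases hs with rfl | rfl <;> linarith
  have tk : k.A ≤ 0 ∧ 1 ≤ k.B := by
    rcases h.typ k hk with ⟨_, a, b⟩ | ⟨a, _⟩
    · exact ⟨a, b⟩
    · rcases ht with rfl | rfl <;> linarith
  have key : (w.b, w.r) = (k.b, k.r) := by
    rcases hs with rfl | rfl <;> rcases ht with rfl | rfl <;>
      simp only [Wall.pt_zero, Wall.pt_one] at hts
    · exact hM.inj1 _ hwM _ hkM hts.symm
    · exact absurd hts.symm (hM.ne _ hwM _ hkM)
    · exact absurd hts (hM.ne _ hkM _ hwM)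
    · exact hM.inj2 _ hwM _ hkM hts.symm
  have := Prod.mk.inj key
  exact h.eq_of_edge hw hk tw.1 tw.2 tk.1 tk.2 this.1 this.2

/-- Every point on the walls inside the box, other than the matched points, lies in the relative
interior of some wall. -/
lemma mem_op (h : Cfg M N W) {x : Pt} (hx : ‖x‖ ≤ N) {w : Wall} (hw : w ∈ W) (hxw : x ∈ w.cl)
    (hxM : Full W ∨ ¬ EndP M x) : ∃ k ∈ W, x ∈ k.op := by
  obtain ⟨s, ⟨hs0, hs1⟩, rfl⟩ := hxw
  rcases hs0.lt_or_eq with h0 | h0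
  · rcases hs1.lt_or_eq with h1 | h1
    · exact ⟨w, hw, s, ⟨h0, h1⟩, rfl⟩
    · subst h1
      rcases h.endB w hw with h2 | h2 | ⟨k, hk, t, a, b, -, -, c, -⟩
      · rcases hxM with hf | hx'
        · exact absurd h2 (hf w hw).2
        · exact absurd (h.endP_of_mark hw hs0 hs1 (Or.inr h2)).1 hx'
      · linarith
      · exact ⟨k, hk, t, ⟨a, b⟩, c⟩
  · subst h0
    rcases h.endA w hw with h2 | h2 | ⟨k, hk, t, a, b, -, -, c, -⟩
    · rcases hxM with hf | hx'
      · exact absurd h2 (hf w hw).1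
      · exact absurd (h.endP_of_mark hw hs0 hs1 (Or.inl h2)).1 hx'
    · linarith
    · exact ⟨k, hk, t, ⟨a, b⟩, c⟩

lemma first_hit (h : Cfg M N W) {o u : Pt} (ho : Free N W o) (hu : u ≠ 0) :
    ∃ τ : ℝ, 0 < τ ∧ (∀ t, 0 ≤ t → t < τ → Free N W (o + t • u)) ∧ ‖o + τ • u‖ ≤ N ∧
      ∃ w ∈ W, o + τ • u ∈ w.cl := by
  have hc : Continuous fun t : ℝ => o + t • u := by fun_prop
  set S : Set ℝ := {t | 0 ≤ t ∧ ¬ Free N W (o + t • u)} with hS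
  have hSc : IsClosed S := by
    have h1 : IsClosed {t : ℝ | ¬ Free N W (o + t • u)} := by
      have := ((isOpen_free N W).preimage hc).isClosed_compl
      exact this
    exact (isClosed_Ici (a := (0 : ℝ))).inter h1
  have hne : S.Nonempty := by
    have hpos : 0 < ‖u‖ := norm_pos_iff.2 hu
    refine ⟨(N + ‖o‖) / ‖u‖, ?_, ?_⟩
    · have : 0 ≤ ‖o‖ := norm_nonneg o
      have : 0 < N := lt_of_le_of_lt (norm_nonneg o) ho.1
      positivity
    · rintro ⟨h1, -⟩
      have h0 : 0 < N := lt_of_le_of_lt (norm_nonneg o) ho.1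
      have h2 : ‖((N + ‖o‖) / ‖u‖) • u‖ = N + ‖o‖ := by
        rw [norm_smul, Real.norm_of_nonneg (by positivity)]; field_simp
      have h3 := norm_sub_le (o + ((N + ‖o‖) / ‖u‖) • u) o
      rw [add_sub_cancel_left, h2] at h3
      linarith
  have hbdd : BddBelow S := ⟨0, fun t ht => ht.1⟩
  have hmem := hSc.csInf_mem hne hbdd
  set τ := sInf S with hτ
  have hfree : ∀ t, 0 ≤ t → t < τ → Free N W (o + t • u) := by
    intro t h0 h1
    by_contra hcon
    exact absurd (csInf_le hbdd (show t ∈ S from ⟨h0, hcon⟩)) (not_le.2 h1)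
  have hτ0 : 0 < τ := by
    rcases hmem.1.lt_or_eq with h1 | h1
    · exact h1
    · exfalso; apply hmem.2; rw [← h1]; simpa using ho
  have hnorm : ‖o + τ • u‖ ≤ N := by
    have hcn : Continuous fun t : ℝ => ‖o + t • u‖ := by fun_prop
    have h1 : τ ∈ closure (Set.Ico 0 τ) := by
      rw [closure_Ico hτ0.ne]; exact ⟨hτ0.le, le_rfl⟩
    have h2 : Set.Ico 0 τ ⊆ {t : ℝ | ‖o + t • u‖ ≤ N} := fun t ht => (hfree t ht.1 ht.2).1.le
    have h3 : IsClosed {t : ℝ | ‖o + t • u‖ ≤ N} := isClosed_le hcn continuous_const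
    exact h3.closure_subset_iff.2 h2 h1
  refine ⟨τ, hτ0, hfree, hnorm, ?_⟩
  rcases hnorm.lt_or_eq with h1 | h1
  · by_contra hcon
    push Not at hcon
    exact hmem.2 ⟨h1, hcon⟩
  · obtain ⟨w, hw, hx⟩ := h.encl _ h1
    exact ⟨w, hw, w.op_subset_cl hx⟩

lemma exists_hit (h : Cfg M N W) {o u : Pt} (ho : Free N W o) (hu : u ≠ 0)
    (hM : Full W ∨ ∀ t : ℝ, ¬ EndP M (o + t • u)) : ∃ τ w s, HitAt N W o u τ w s := by
  obtain ⟨τ, h0, h1, h2, w, hw, h3⟩ := h.first_hit ho hu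
  obtain ⟨k, hk, s, ⟨ha, hb⟩, hs⟩ := h.mem_op h2 hw h3 (hM.imp id fun h => h τ)
  exact ⟨τ, k, s, h0, hk, ha, hb, hs.symm, h1⟩

end Cfg

lemma HitAt.transversal {o u : Pt} {τ s : ℝ} {w : Wall} (h : HitAt N W o u τ w s)
    (hne : w.b ≠ w.r) : crs w.dir u ≠ 0 := by
  intro hc
  obtain ⟨a, rfl⟩ := exists_smul_of_crs_eq_zero (Wall.dir_ne hne) hc
  have hcont : Filter.Tendsto (fun ε : ℝ => s - ε * a) (nhdsWithin 0 (Set.Ioi 0)) (nhds s) := by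
    have : Continuous fun ε : ℝ => s - ε * a := by fun_prop
    have h2 := this.tendsto 0
    simp only [zero_mul, sub_zero] at h2
    exact h2.mono_left nhdsWithin_le_nhds
  have e1 := hcont.eventually (Ioo_mem_nhds h.hA h.hB)
  have e2 : ∀ᶠ ε : ℝ in nhdsWithin 0 (Set.Ioi 0), ε ∈ Set.Ioo 0 τ :=
    Ioo_mem_nhdsGT h.pos
  obtain ⟨ε, he1, he2⟩ := (e1.and e2).exists
  have := (h.free (τ - ε) (by linarith [he2.2]) (by linarith [he2.1])).2 w h.mem
  apply this
  refine ⟨s - ε * a, ⟨he1.1.le, he1.2.le⟩, ?_⟩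
  rw [w.pt_eq s, ← h.eq]
  module

lemma HitAt.unique (hc : Cfg M N W) {o u : Pt} {τ τ' s s' : ℝ} {w w' : Wall}
    (h : HitAt N W o u τ w s) (h' : HitAt N W o u τ' w' s') : τ = τ' ∧ w = w' ∧ s = s' := by
  have ht : τ = τ' := by
    rcases lt_trichotomy τ τ' with h1 | h1 | h1
    · refine absurd ?_ ((h'.free τ h.pos.le h1).2 w h.mem)
      rw [h.eq]; exact ⟨s, ⟨h.hA.le, h.hB.le⟩, rfl⟩
    · exact h1
    · refine absurd ?_ ((h.free τ' h'.pos.le h1).2 w' h'.mem)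
      rw [h'.eq]; exact ⟨s', ⟨h'.hA.le, h'.hB.le⟩, rfl⟩
  subst ht
  have hw : w = w' := hc.opd w h.mem w' h'.mem (o + τ • u)
    (by rw [h.eq]; exact ⟨s, ⟨h.hA, h.hB⟩, rfl⟩) (by rw [h'.eq]; exact ⟨s', ⟨h'.hA, h'.hB⟩, rfl⟩)
  subst hw
  exact ⟨rfl, rfl, Wall.pt_inj (hc.ne w h.mem) (h.eq.symm.trans h'.eq)⟩

lemma HitAt.sees {o u : Pt} {τ s : ℝ} {w : Wall} (h : HitAt N W o u τ w s) :
    Sees N W o (w.pt s) := by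
  intro t h0 h1
  rw [← h.eq, add_sub_cancel_left, smul_smul]
  exact h.free _ (mul_nonneg h0 h.pos.le) (by nlinarith [h.pos])

namespace Cfg

/-- If two sides of a triangle are free of walls, then so is its interior. -/
lemma triangle_free (h : Cfg M N W) (hf : Full W) {y q v : Pt} (hnc : crs (q - y) (v - y) ≠ 0)
    (hyq : Vis N W y q) (hyv : Sees N W y v) (hv : ‖v‖ < N) {a b : ℝ} (ha : 0 ≤ a) (hb : 0 ≤ b)
    (hab : a + b ≤ 1) (hb1 : b < 1) : Free N W (y + a • (q - y) + b • (v - y)) := by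
  set P : ℝ × ℝ → Pt := fun z => y + z.1 • (q - y) + z.2 • (v - y) with hP
  have hPc : Continuous P := by rw [hP]; fun_prop
  have hnorm : ∀ z : ℝ × ℝ, 0 ≤ z.1 → 0 ≤ z.2 → z.1 + z.2 ≤ 1 → ‖P z‖ < N := by
    intro z h1 h2 h3
    have h4 : P z = (1 - z.1 - z.2) • y + z.1 • q + z.2 • v := by simp only [hP]; module
    have hy := hyq.free_left.1
    have hq := hyq.free_right.1
    have h5 : ‖P z‖ ≤ (1 - z.1 - z.2) * ‖y‖ + z.1 * ‖q‖ + z.2 * ‖v‖ := by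
      rw [h4]
      refine norm_add₃_le.trans_eq ?_
      rw [norm_smul, norm_smul, norm_smul, Real.norm_of_nonneg (by linarith),
        Real.norm_of_nonneg h1, Real.norm_of_nonneg h2]
    have h6 : 0 < 1 - z.1 - z.2 ∨ 0 < z.1 ∨ 0 < z.2 := by
      by_contra hcon; push Not at hcon; linarith [hcon.1, hcon.2.1, hcon.2.2]
    have k1 := mul_nonneg (show 0 ≤ 1 - z.1 - z.2 by linarith) (sub_nonneg.2 hy.le)
    have k2 := mul_nonneg h1 (sub_nonneg.2 hq.le)
    have k3 := mul_nonneg h2 (sub_nonneg.2 hv.le)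
    rcases h6 with h6 | h6 | h6
    · nlinarith [mul_pos h6 (sub_pos.2 hy)]
    · nlinarith [mul_pos h6 (sub_pos.2 hq)]
    · nlinarith [mul_pos h6 (sub_pos.2 hv)]
  by_contra hbad
  have hbad' : P (a, b) ∈ ⋃ w ∈ W, w.cl := by
    by_contra hcon
    rw [mem_walls] at hcon; push Not at hcon
    exact hbad ⟨hnorm (a, b) ha hb hab, hcon⟩
  set K : Set (ℝ × ℝ) := {z | 0 ≤ z.1 ∧ 0 ≤ z.2 ∧ z.1 + z.2 ≤ 1 ∧ P z ∈ ⋃ w ∈ W, w.cl} with hK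
  have hKc : IsCompact K := by
    refine (isCompact_Icc (a := ((0, 0) : ℝ × ℝ)) (b := (1, 1))).of_isClosed_subset ?_ ?_
    · refine (isClosed_le continuous_const continuous_fst).inter
        ((isClosed_le continuous_const continuous_snd).inter
        ((isClosed_le (f := fun z : ℝ × ℝ => z.1 + z.2) (by fun_prop) continuous_const).inter
          ((isCompact_walls W).isClosed.preimage hPc)))
    · rintro ⟨z1, z2⟩ ⟨h1, h2, h3, -⟩
      simp only at h1 h2 h3
      exact ⟨⟨h1, h2⟩, ⟨by simp only; linarith, by simp only; linarith⟩⟩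
  have hKab : (a, b) ∈ K := ⟨ha, hb, hab, hbad'⟩
  obtain ⟨z1, hz1, hmin1⟩ := hKc.exists_isMinOn ⟨_, hKab⟩
    (f := fun z : ℝ × ℝ => z.1 + z.2) (by fun_prop)
  have hK2c : IsCompact (K ∩ {z | z.1 + z.2 ≤ z1.1 + z1.2}) :=
    hKc.inter_right (isClosed_le (by fun_prop) continuous_const)
  obtain ⟨z, ⟨hz, hzle⟩, hmin2⟩ := hK2c.exists_isMinOn ⟨z1, hz1, le_refl (z1.1 + z1.2)⟩
    (f := fun z : ℝ × ℝ => z.2) (by fun_prop)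
  have m1 : ∀ x ∈ K, z.1 + z.2 ≤ x.1 + x.2 := fun x hx => le_trans hzle (hmin1 hx)
  have m2 : ∀ x ∈ K, x.1 + x.2 ≤ z.1 + z.2 → z.2 ≤ x.2 := fun x hx hx2 =>
    hmin2 ⟨hx, hx2.trans hzle⟩
  obtain ⟨hz0, hz0', hzs, hzw⟩ := hz
  have hz2 : z.2 < 1 := by
    by_contra hcon
    have e1 := m1 _ hKab
    simp only at e1
    have e2 := m2 _ hKab (by simp only; linarith)
    simp only at e2
    linarith
  have hp1 : 0 < z.1 := by
    rcases hz0.lt_or_eq with h1 | h1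
    · exact h1
    · exfalso
      obtain ⟨w, hw, hx⟩ := mem_walls.1 hzw
      have := (hyv z.2 hz0' hz2).2 w hw
      apply this
      convert hx using 1
      simp only [hP, ← h1]; module
  have hp2 : 0 < z.2 := by
    rcases hz0'.lt_or_eq with h1 | h1
    · exact h1
    · exfalso
      obtain ⟨w, hw, hx⟩ := mem_walls.1 hzw
      have := (hyq z.1 hz0 (by linarith)).2 w hw
      apply this
      convert hx using 1
      simp only [hP, ← h1]; module
  obtain ⟨w, hw, hx⟩ := mem_walls.1 hzw
  obtain ⟨k, hk, s, ⟨hsA, hsB⟩, hs⟩ := h.mem_op (hnorm z hz0 hz0' hzs).le hw hx (Or.inl hf)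
  obtain ⟨p, r, hpr⟩ := exists_coords hnc k.dir
  have hmove : ∀ ε : ℝ, P (z.1 + ε * p, z.2 + ε * r) = k.pt (s + ε) := by
    intro ε
    rw [k.pt_add, hs, hpr]; simp only [hP]; module
  have hev : ∀ g : ℝ, ∃ ε > 0, k.A < s + ε * g ∧ s + ε * g < k.B ∧ 0 < z.1 + (ε * g) * p ∧
      0 < z.2 + (ε * g) * r := by
    intro g
    have c1 : ContinuousAt (fun ε : ℝ => s + ε * g) 0 := by fun_prop
    have c2 : ContinuousAt (fun ε : ℝ => z.1 + (ε * g) * p) 0 := by fun_prop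
    have c3 : ContinuousAt (fun ε : ℝ => z.2 + (ε * g) * r) 0 := by fun_prop
    have e1 := c1.eventually (lt_mem_nhds (a := k.A) (by simpa using hsA))
    have e2 := c1.eventually (gt_mem_nhds (a := k.B) (by simpa using hsB))
    have e3 := c2.eventually (lt_mem_nhds (a := 0) (by simpa using hp1))
    have e4 := c3.eventually (lt_mem_nhds (a := 0) (by simpa using hp2))
    have e5 := (e1.and (e2.and (e3.and e4))).filter_mono
      (nhdsWithin_le_nhds (s := Set.Ioi (0 : ℝ)))
    obtain ⟨ε, he, he'⟩ := (e5.and (self_mem_nhdsWithin)).exists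
    exact ⟨ε, he', he⟩
  have hmem : ∀ e : ℝ, k.A < s + e → s + e < k.B → 0 < z.1 + e * p → 0 < z.2 + e * r →
      e * (p + r) ≤ 0 → (z.1 + e * p, z.2 + e * r) ∈ K := by
    intro e g1 g2 g3 g4 g5
    refine ⟨g3.le, g4.le, by simp only; nlinarith, ?_⟩
    rw [hmove, mem_walls]
    exact ⟨k, hk, s + e, ⟨g1.le, g2.le⟩, rfl⟩
  by_cases hsum : p + r = 0
  · have hr : r ≠ 0 := by
      rintro rfl
      have : p = 0 := by linarith
      subst this
      exact Wall.dir_ne (h.ne k hk) (by rw [hpr]; simp)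
    obtain ⟨ε, hε, g1, g2, g3, g4⟩ := hev (-r)
    have hin := hmem _ g1 g2 g3 g4 (by rw [hsum]; simp)
    have := m2 _ hin (by simp only; nlinarith)
    simp only at this
    have : 0 < ε * (r * r) := mul_pos hε (mul_self_pos.2 hr)
    nlinarith
  · obtain ⟨ε, hε, g1, g2, g3, g4⟩ := hev (-(p + r))
    have hpos : 0 < ε * ((p + r) * (p + r)) := mul_pos hε (mul_self_pos.2 hsum)
    have hin := hmem _ g1 g2 g3 g4 (by nlinarith)
    have := m1 _ hin
    simp only at this
    nlinarith

end Cfg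

lemma Vis.sees_trans_of_collinear {y q v : Pt} (hc : crs (q - y) (v - y) = 0)
    (hyq : Vis N W y q) (hyv : Sees N W y v) : Sees N W q v := by
  by_cases h1 : q = y
  · rw [h1]; exact hyv
  by_cases h2 : v = y
  · rw [h2]; exact hyq.symm.sees
  obtain ⟨l, hl⟩ := exists_smul_of_crs_eq_zero (sub_ne_zero.2 h1) hc
  have hl0 : l ≠ 0 := by
    rintro rfl
    rw [zero_smul, sub_eq_zero] at hl
    exact h2 hl
  intro t ht0 ht1
  have hv : v = y + l • (q - y) := by rw [← hl]; abel
  have key : q + t • (v - q) = y + (1 - t + t * l) • (q - y) := by rw [hv]; module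
  have key2 : q + t • (v - q) = y + ((1 - t + t * l) / l) • (v - y) := by
    rw [key, hl, smul_smul, div_mul_cancel₀ _ hl0]
  by_cases m0 : 0 ≤ 1 - t + t * l
  · by_cases m1 : 1 - t + t * l ≤ 1
    · rw [key]; exact hyq _ m0 m1
    · push Not at m1
      have : 1 < l := by
        by_contra hcon
        push Not at hcon
        nlinarith
      rw [key2]
      refine hyv _ (by positivity) ?_
      rw [div_lt_one (by linarith)]
      nlinarith
  · push Not at m0
    have : l < 0 := by
      by_contra hcon
      push Not at hcon
      nlinarith
    rw [key2]
    refine hyv _ (div_nonneg_of_nonpos m0.le this.le) ?_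
    rw [div_lt_one_of_neg this]
    nlinarith

lemma Vis.trans_of_collinear {x y z : Pt} (hc : crs (y - x) (z - y) = 0)
    (h1 : Vis N W x y) (h2 : Vis N W y z) : Vis N W x z := by
  refine (h1.symm.sees_trans_of_collinear ?_ h2.sees).vis h2.free_right
  rw [← neg_sub, crs_neg_left, hc, neg_zero]

lemma Cfg.sees_trans (h : Cfg M N W) (hf : Full W) {y q v : Pt} (hyq : Vis N W y q)
    (hyv : Sees N W y v) (hv : ‖v‖ < N) : Sees N W q v := by
  by_cases hc : crs (q - y) (v - y) = 0
  · exact hyq.sees_trans_of_collinear hc hyv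
  intro t ht0 ht1
  have := h.triangle_free hf hc hyq hyv hv (a := 1 - t) (b := t) (by linarith) ht0 (by linarith) ht1
  convert this using 1
  module

lemma Cfg.vis_trans (h : Cfg M N W) (hf : Full W) {x y z : Pt} (h1 : Vis N W x y)
    (h2 : Vis N W y z) : Vis N W x z :=
  (h.sees_trans hf h1.symm h2.sees h2.free_right.1).vis h2.free_right

def perp (u : Pt) : Pt := (-u.2, u.1)

lemma crs_perp_pos {u : Pt} (hu : u ≠ 0) : 0 < crs u (perp u) := by
  simp only [crs, perp]
  have : u.1 ≠ 0 ∨ u.2 ≠ 0 := by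
    by_contra hcon; push Not at hcon; exact hu (Prod.ext hcon.1 hcon.2)
  rcases this with h | h
  · have := mul_self_pos.2 h; nlinarith [mul_self_nonneg u.2]
  · have := mul_self_pos.2 h; nlinarith [mul_self_nonneg u.1]

/-- The subset of free points that see `v = w.pt s` from the side of `w` selected by `g`. -/
def SeesFrom (N : ℝ) (W : Finset Wall) (w : Wall) (s g : ℝ) (o : Pt) : Prop :=
  Sees N W o (w.pt s) ∧ 0 < g * crs w.dir (o - w.pt s)

namespace Cfg

/-- Near a matched point the only wall is the one through it. -/
lemma exists_ball (hM : PM M) (h : Cfg M N W) {w : Wall} (hw : w ∈ W) {s : ℝ} (hA : w.A < s)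
    (hB : s < w.B) (hP : EndP M (w.pt s)) (hN : ‖w.pt s‖ < N) :
    ∃ ρ > 0, ∀ x, ‖x - w.pt s‖ < ρ →
      ‖x‖ < N ∧ (∀ k ∈ W, k ≠ w → x ∉ k.cl) ∧ (crs w.dir (x - w.pt s) = 0 → x ∈ w.cl) := by
  have e1 : ∀ᶠ x in nhds (w.pt s), ‖x‖ < N :=
    (isOpen_lt continuous_norm continuous_const).mem_nhds hN
  have e2 : ∀ᶠ x in nhds (w.pt s), ∀ k ∈ W, k ≠ w → x ∉ k.cl := by
    rw [Filter.eventually_all_finset]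
    intro k hk
    by_cases hkw : k = w
    · exact Filter.Eventually.of_forall fun x hx => absurd hkw hx
    · have : w.pt s ∉ k.cl := fun hc =>
        hkw (h.eq_of_endP hM hP hk hw hc ⟨s, ⟨hA.le, hB.le⟩, rfl⟩)
      filter_upwards [k.isCompact_cl.isClosed.isOpen_compl.mem_nhds this] with x hx _
      exact hx
  obtain ⟨ρ, hρ, hball⟩ := Metric.eventually_nhds_iff.1 (e1.and e2)
  have hd : 0 < ‖w.dir‖ := norm_pos_iff.2 (Wall.dir_ne (h.ne w hw))
  have hm : 0 < min (s - w.A) (w.B - s) := lt_min (by linarith) (by linarith)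
  refine ⟨min ρ (min (s - w.A) (w.B - s) * ‖w.dir‖), lt_min hρ (mul_pos hm hd), ?_⟩
  intro x hx
  have hx1 := lt_of_lt_of_le hx (min_le_left _ _)
  have hx2 := lt_of_lt_of_le hx (min_le_right _ _)
  obtain ⟨b1, b2⟩ := hball (show dist x (w.pt s) < ρ by rwa [dist_eq_norm])
  refine ⟨b1, b2, fun hc => ?_⟩
  obtain ⟨a, ha⟩ := exists_smul_of_crs_eq_zero (Wall.dir_ne (h.ne w hw)) hc
  rw [ha, norm_smul, Real.norm_eq_abs] at hx2
  have h3 := lt_of_mul_lt_mul_right hx2 hd.le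
  have h4 := lt_min_iff.1 h3
  have h5 := abs_lt.1 h4.1
  have h6 := abs_lt.1 h4.2
  refine ⟨s + a, ⟨by linarith, by linarith⟩, ?_⟩
  rw [w.pt_add, ← ha]; abel

/-- The points that see a matched point from a given side form a visibility class. -/
lemma exists_hat (hM : PM M) (h : Cfg M N W) (hf : Full W) {w : Wall} (hw : w ∈ W) {s : ℝ}
    (hA : w.A < s) (hB : s < w.B) (hP : EndP M (w.pt s)) (hN : ‖w.pt s‖ < N) {g : ℝ}
    (hg : g ≠ 0) {δ : ℝ} (hδ : 0 < δ) :
    ∃ v, Free N W v ∧ ‖v - w.pt s‖ < δ ∧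
      ∀ o, Free N W o → (SeesFrom N W w s g o ↔ Vis N W o v) := by
  obtain ⟨ρ, hρ, hball⟩ := h.exists_ball hM hw hA hB hP hN
  set v0 := w.pt s with hv0
  have hd := Wall.dir_ne (h.ne w hw)
  have hside : ∀ x, ‖x - v0‖ < ρ → 0 < g * crs w.dir (x - v0) → Free N W x := by
    intro x hx hx2
    obtain ⟨b1, b2, -⟩ := hball x hx
    refine ⟨b1, fun k hk => ?_⟩
    by_cases hkw : k = w
    · subst hkw
      rintro ⟨t, -, rfl⟩
      rw [hv0, k.pt_eq s t, add_sub_cancel_left, crs_smul_right, crs_self] at hx2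
      simp at hx2
    · exact b2 k hk hkw
  -- the nearby point
  have hpn : 0 < ‖g • perp w.dir‖ := by
    rw [norm_pos_iff]; intro hc
    have := crs_perp_pos hd
    rw [smul_eq_zero] at hc
    rcases hc with hc | hc
    · exact hg hc
    · rw [hc, crs_zero_right] at this; exact lt_irrefl _ this
  set κ := min δ ρ / (2 * ‖g • perp w.dir‖) with hκ
  have hκ0 : 0 < κ := by positivity
  set v := v0 + κ • (g • perp w.dir) with hv
  have hvn : ‖v - v0‖ = min δ ρ / 2 := by
    rw [hv, add_sub_cancel_left, norm_smul, Real.norm_of_nonneg hκ0.le, hκ]; field_simp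
  have hmin : 0 < min δ ρ := lt_min hδ hρ
  have hvρ : ‖v - v0‖ < ρ := by rw [hvn]; linarith [min_le_right δ ρ]
  have hvs : 0 < g * crs w.dir (v - v0) := by
    rw [hv, add_sub_cancel_left, crs_smul_right, crs_smul_right]
    have h1 := mul_pos hκ0 (mul_pos (mul_self_pos.2 hg) (crs_perp_pos hd))
    nlinarith
  have hconv : ∀ x y : Pt, ∀ t : ℝ, 0 ≤ t → t ≤ 1 → ‖x - v0‖ < ρ → ‖y - v0‖ < ρ →
      ‖x + t • (y - x) - v0‖ < ρ := by
    intro x y t h0 h1 hx hy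
    have := (convex_ball v0 ρ).add_smul_sub_mem (x := x) (y := y)
      (by rwa [Metric.mem_ball, dist_eq_norm]) (by rwa [Metric.mem_ball, dist_eq_norm]) ⟨h0, h1⟩
    rwa [Metric.mem_ball, dist_eq_norm] at this
  have hcr : ∀ x y : Pt, ∀ t : ℝ, crs w.dir (x + t • (y - x) - v0) =
      (1 - t) * crs w.dir (x - v0) + t * crs w.dir (y - v0) := by
    intro x y t
    simp only [crs_sub_right, crs_add_right, crs_smul_right]; ring
  -- points on a segment to `v0` close to `v0`
  have hnear : ∀ o, ∃ t : ℝ, 0 < t ∧ t < 1 ∧ ‖o + t • (v0 - o) - v0‖ < ρ := by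
    intro o
    have hden : 0 < 2 * (‖o - v0‖ + ρ) := by positivity
    refine ⟨1 - ρ / (2 * (‖o - v0‖ + ρ)), ?_, ?_, ?_⟩
    · rw [sub_pos, div_lt_one hden]; linarith [norm_nonneg (o - v0)]
    · rw [sub_lt_self_iff]; positivity
    · have : o + (1 - ρ / (2 * (‖o - v0‖ + ρ))) • (v0 - o) - v0 =
        (ρ / (2 * (‖o - v0‖ + ρ))) • (o - v0) := by module
      rw [this, norm_smul, Real.norm_of_nonneg (by positivity), div_mul_eq_mul_div,
        div_lt_iff₀ hden]
      nlinarith [norm_nonneg (o - v0)]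
  have hvF := hside v hvρ hvs
  refine ⟨v, hvF, by rw [hvn]; linarith [min_le_left δ ρ], ?_⟩
  intro o ho
  constructor
  · rintro ⟨h1, h2⟩
    obtain ⟨t, t0, t1, ht⟩ := hnear o
    have hvis1 : Vis N W o (o + t • (v0 - o)) := by
      intro a a0 a1
      have := h1 (a * t) (by positivity) (by nlinarith)
      convert this using 1
      module
    have hs1 : 0 < g * crs w.dir (o + t • (v0 - o) - v0) := by
      rw [hcr, sub_self, crs_zero_right]
      have := mul_pos (sub_pos.2 t1) h2
      nlinarith
    have hvis2 : Vis N W (o + t • (v0 - o)) v := by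
      intro a a0 a1
      refine hside _ (hconv _ _ _ a0 a1 ht hvρ) ?_
      rw [hcr]
      rcases a0.lt_or_eq with h5 | h5
      · have k1 := mul_pos h5 hvs
        have k2 := mul_nonneg (sub_nonneg.2 a1) hs1.le
        nlinarith
      · rw [← h5]; simpa using hs1
    exact h.vis_trans hf hvis1 hvis2
  · intro hvis
    have hsv : Sees N W v v0 := by
      intro a a0 a1
      refine hside _ (hconv _ _ _ a0 a1.le hvρ (by simpa using hρ)) ?_
      rw [hcr, sub_self, crs_zero_right]
      have := mul_pos (sub_pos.2 a1) hvs
      nlinarith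
    have hso := h.sees_trans hf hvis.symm hsv hN
    refine ⟨hso, ?_⟩
    by_contra hcon
    push Not at hcon
    obtain ⟨t, t0, t1, ht⟩ := hnear o
    set o' := o + t • (v0 - o) with ho'
    have hvis1 : Vis N W o o' := by
      intro a a0 a1
      have := hso (a * t) (by positivity) (by nlinarith)
      convert this using 1
      rw [ho']; module
    have hvis2 : Vis N W v o' := h.vis_trans hf hvis.symm hvis1
    have hs1 : g * crs w.dir (o' - v0) ≤ 0 := by
      rw [ho', hcr, sub_self, crs_zero_right]
      have := mul_nonneg (sub_pos.2 t1).le (neg_nonneg.2 hcon)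
      nlinarith
    set p := g * crs w.dir (v - v0) with hp
    set q := g * crs w.dir (o' - v0) with hq
    have hpq : 0 < p - q := by linarith
    have a0 : 0 ≤ p / (p - q) := by positivity
    have a1 : p / (p - q) ≤ 1 := by rw [div_le_one hpq]; linarith
    have hz := hball _ (hconv v o' _ a0 a1 hvρ ht)
    refine (hvis2 _ a0 a1).2 w hw (hz.2.2 ?_)
    have : g * crs w.dir (v + (p / (p - q)) • (o' - v) - v0) = 0 := by
      rw [hcr, mul_add, mul_left_comm, mul_left_comm g, ← hp, ← hq]; field_simp; ring
    exact (mul_eq_zero.1 this).resolve_left hg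

end Cfg

open Filter in
/-- A function of one real variable that is locally constant except for finitely many jumps changes,
from `-∞` to `∞`, by the sum of its jumps. -/
lemma sub_eq_sum_jumps {ι : Type*} (L : Finset ι) (c : ι → ℤ) (t : ι → ℝ) (F : ℝ → ℤ) (a b : ℤ)
    (hb : ∀ᶠ x in atTop, F x = b) (ha : ∀ᶠ x in atBot, F x = a)
    (hj : ∀ x, ∃ l r, (∀ᶠ y in nhdsWithin x (Set.Iio x), F y = l) ∧
      (∀ᶠ y in nhdsWithin x (Set.Ioi x), F y = r) ∧ r - l = ∑ i ∈ L with t i = x, c i) :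
    b - a = ∑ i ∈ L, c i := by
  set G : ℝ → ℤ := fun x => ∑ i ∈ L with t i < x, c i with hG
  have hK : ∀ x, ∃ h : ℤ, ∀ᶠ y in nhdsWithin x {x}ᶜ, F y - G y = h := by
    intro x
    obtain ⟨l, r, h1, h2, h3⟩ := hj x
    have hne : ∀ᶠ y in nhds x, ∀ i ∈ L, t i ≠ x → (t i < y ↔ t i < x) := by
      rw [eventually_all_finset]
      intro i _
      rcases lt_trichotomy (t i) x with hlt | heq | hgt
      · filter_upwards [lt_mem_nhds hlt] with y hy _
        exact ⟨fun _ => hlt, fun _ => hy⟩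
      · exact Eventually.of_forall fun y hy => absurd heq hy
      · filter_upwards [gt_mem_nhds hgt] with y hy _
        exact ⟨fun h => absurd h (not_lt.2 hy.le), fun h => absurd h (not_lt.2 hgt.le)⟩
    refine ⟨l - G x, ?_⟩
    rw [← Set.Iio_union_Ioi, nhdsWithin_union, eventually_sup]
    constructor
    · filter_upwards [h1, hne.filter_mono nhdsWithin_le_nhds, self_mem_nhdsWithin] with y e1 e2 e3
      rw [e1]; congr 1
      refine Finset.sum_congr (Finset.filter_congr fun i hi => ?_) fun _ _ => rfl
      by_cases hx : t i = x
      · rw [hx]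
        have : y < x := e3
        exact ⟨fun h => absurd h (not_lt.2 this.le), fun h => absurd h (lt_irrefl _)⟩
      · exact e2 i hi hx
    · filter_upwards [h2, hne.filter_mono nhdsWithin_le_nhds, self_mem_nhdsWithin] with y e1 e2 e3
      have hxy : x < y := e3
      have : G y = G x + ∑ i ∈ L with t i = x, c i := by
        simp only [hG]
        rw [← Finset.sum_union]
        · refine Finset.sum_congr ?_ fun _ _ => rfl
          ext i
          simp only [Finset.mem_filter, Finset.mem_union]
          by_cases hi : i ∈ L
          · by_cases hx : t i = x
            · simp [hi, hx, hxy]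
            · simp [hi, hx, e2 i hi hx]
          · simp [hi]
        · rw [Finset.disjoint_filter]
          intro i _ h1 h2
          exact absurd h2 h1.ne
      rw [this, e1, ← h3]; ring
  choose K hK using hK
  have hKloc : IsLocallyConstant K := by
    rw [IsLocallyConstant.iff_eventually_eq]
    intro x
    have h1 := hK x
    rw [eventually_nhdsWithin_iff] at h1
    filter_upwards [h1.eventually_nhds] with y hy
    by_cases hyx : y = x
    · rw [hyx]
    · have h2 : ∀ᶠ z in nhdsWithin y {y}ᶜ, F z - G z = K x := by
        have h3 : ∀ᶠ z in nhds y, z ≠ x := isOpen_ne.mem_nhds hyx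
        filter_upwards [(hy.and h3).filter_mono nhdsWithin_le_nhds] with z hz
        exact hz.1 hz.2
      obtain ⟨z, hz1, hz2⟩ := ((hK y).and h2).exists
      rw [← hz1, hz2]
  have hconst : ∀ x y, K x = K y := fun x y => hKloc.apply_eq_of_preconnectedSpace x y
  have htop : ∃ x, K x = b - ∑ i ∈ L, c i := by
    have e : ∀ᶠ x in atTop, ∀ i ∈ L, t i < x := by
      rw [eventually_all_finset]; intro i _; exact eventually_gt_atTop _
    obtain ⟨T, hT⟩ := eventually_atTop.1 (hb.and e)
    refine ⟨T + 1, ?_⟩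
    have h3 : ∀ᶠ z in nhds (T + 1), T ≤ z := by
      filter_upwards [lt_mem_nhds (show T < T + 1 by linarith)] with z hz using hz.le
    obtain ⟨z, hz1, hz2⟩ := ((hK (T + 1)).and (h3.filter_mono nhdsWithin_le_nhds)).exists
    obtain ⟨g1, g2⟩ := hT z hz2
    rw [← hz1, g1]
    simp only [hG]
    rw [Finset.filter_true_of_mem g2]
  have hbot : ∃ x, K x = a := by
    have e : ∀ᶠ x in atBot, ∀ i ∈ L, x < t i := by
      rw [eventually_all_finset]; intro i _; exact eventually_lt_atBot _
    obtain ⟨T, hT⟩ := eventually_atBot.1 (ha.and e)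
    refine ⟨T - 1, ?_⟩
    have h3 : ∀ᶠ z in nhds (T - 1), z ≤ T := by
      filter_upwards [gt_mem_nhds (show T - 1 < T by linarith)] with z hz using hz.le
    obtain ⟨z, hz1, hz2⟩ := ((hK (T - 1)).and (h3.filter_mono nhdsWithin_le_nhds)).exists
    obtain ⟨g1, g2⟩ := hT z hz2
    rw [← hz1, g1]
    simp only [hG]
    rw [Finset.filter_false_of_mem fun i hi => not_lt.2 (g2 i hi).le]
    simp
  obtain ⟨x, hx⟩ := htop
  obtain ⟨y, hy⟩ := hbot
  have := hconst x y
  rw [hx, hy] at this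
  linarith


lemma HitAt.line_eq {o u : Pt} {τ s : ℝ} {w : Wall} (h : HitAt N W o u τ w s) :
    o - w.b = s • w.dir - τ • u := by
  have := h.eq
  simp only [Wall.pt] at this
  rw [sub_eq_sub_iff_add_eq_add, this]; abel

set_option maxHeartbeats 1000000 in
open Filter in
/-- How the first hit of a ray changes when its direction is perturbed. -/
lemma Cfg.hit_near (hM : PM M) (h : Cfg M N W) (hf : Full W) {o u₀ : Pt} {τ₀ s₀ : ℝ} {w : Wall}
    (hh : HitAt N W o u₀ τ₀ w s₀) :
    ∀ᶠ u in nhds u₀, ∃ τ k s, HitAt N W o u τ k s ∧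
      ((k = w ∧ s = crs (o - w.b) u / crs w.dir u) ∨
        (s₀ ≠ 0 ∧ s₀ ≠ 1 ∧ k.lab (-u) s = w.lab (-u₀) s₀)) := by
  have hne := h.ne w hh.mem
  have htr := hh.transversal hne
  have hd := Wall.dir_ne hne
  set z := w.pt s₀ with hz
  have hzcl : z ∈ w.cl := ⟨s₀, ⟨hh.hA.le, hh.hB.le⟩, rfl⟩
  have hzop : z ∈ w.op := ⟨s₀, ⟨hh.hA, hh.hB⟩, rfl⟩
  have ho : Free N W o := by simpa using hh.free 0 le_rfl hh.pos
  have hzN : ‖z‖ ≤ N := by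
    have hc : Continuous fun t : ℝ => ‖o + t • u₀‖ := by fun_prop
    have h1 : τ₀ ∈ closure (Set.Ico 0 τ₀) := by
      rw [closure_Ico hh.pos.ne]; exact ⟨hh.pos.le, le_rfl⟩
    have h2 : Set.Ico 0 τ₀ ⊆ {t : ℝ | ‖o + t • u₀‖ ≤ N} := fun t ht => (hh.free t ht.1 ht.2).1.le
    have := (isClosed_le hc continuous_const).closure_subset_iff.2 h2 h1
    rw [hz, ← hh.eq]; exact this
  -- a neighbourhood of the hit point
  have hG : ∀ᶠ x in nhds z, ∀ k ∈ W, (z ∉ k.cl → x ∉ k.cl) ∧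
      (k.A < 0 → z = k.pt k.A → x ∉ k.pt '' Set.Icc 0 k.B) ∧
      (1 < k.B → z = k.pt k.B → x ∉ k.pt '' Set.Icc k.A 1) := by
    rw [eventually_all_finset]
    intro k hk
    refine Filter.Eventually.and ?_ (Filter.Eventually.and ?_ ?_)
    · by_cases hc : z ∈ k.cl
      · exact Eventually.of_forall fun x hx => absurd hc hx
      · filter_upwards [k.isCompact_cl.isClosed.isOpen_compl.mem_nhds hc] with x hx _ using hx
    · by_cases hc : k.A < 0 ∧ z = k.pt k.A
      · have : z ∉ k.pt '' Set.Icc 0 k.B := by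
          rintro ⟨t, ht, ht2⟩
          have := Wall.pt_inj (h.ne k hk) (ht2.trans hc.2)
          linarith [ht.1, hc.1]
        filter_upwards [(isCompact_Icc.image k.continuous_pt).isClosed.isOpen_compl.mem_nhds this]
          with x hx _ _ using hx
      · exact Eventually.of_forall fun x h1 h2 => absurd ⟨h1, h2⟩ hc
    · by_cases hc : 1 < k.B ∧ z = k.pt k.B
      · have : z ∉ k.pt '' Set.Icc k.A 1 := by
          rintro ⟨t, ht, ht2⟩
          have := Wall.pt_inj (h.ne k hk) (ht2.trans hc.2)
          linarith [ht.2, hc.1]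
        filter_upwards [(isCompact_Icc.image k.continuous_pt).isClosed.isOpen_compl.mem_nhds this]
          with x hx _ _ using hx
      · exact Eventually.of_forall fun x h1 h2 => absurd ⟨h1, h2⟩ hc
  -- the intersection with the line of `w`
  set T : Pt → ℝ := fun u => crs w.dir (w.b - o) / crs w.dir u with hT
  set S : Pt → ℝ := fun u => crs (o - w.b) u / crs w.dir u with hS
  have hcd : ContinuousAt (fun u => crs w.dir u) u₀ := (continuous_crs_right _).continuousAt
  have hTc : ContinuousAt T u₀ := continuousAt_const.div hcd htr
  have hSc : ContinuousAt S u₀ := (continuous_crs_right _).continuousAt.div hcd htr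
  have hT0 : T u₀ = τ₀ := by
    simp only [hT]
    rw [div_eq_iff htr, ← neg_sub, hh.line_eq]
    simp only [crs_sub_right, crs_smul_right, crs_self, crs_neg_right]; ring
  have hS0 : S u₀ = s₀ := by
    simp only [hS]
    rw [div_eq_iff htr, hh.line_eq]
    simp only [crs_sub_left, crs_smul_left, crs_self]; ring
  have hTS : ∀ u, crs w.dir u ≠ 0 → o + T u • u = w.pt (S u) := by
    intro u hu
    have h1 : crs w.dir u • (o - w.b) = (crs (o - w.b) u) • w.dir + crs w.dir (o - w.b) • u :=
      crs_expand _ _ _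
    have h2 : o - w.b = S u • w.dir - T u • u := by
      have h3 : (crs w.dir u)⁻¹ • (crs w.dir u • (o - w.b)) = o - w.b := by
        rw [smul_smul, inv_mul_cancel₀ hu, one_smul]
      rw [← h3, h1, ← neg_sub w.b o, crs_neg_right, smul_add, smul_smul, smul_smul]
      simp only [hS, hT]
      rw [div_eq_inv_mul, div_eq_inv_mul]
      rw [← neg_sub w.b o]
      module
    simp only [Wall.pt]
    rw [add_comm w.b, ← sub_eq_sub_iff_add_eq_add.1 h2]
  have E0 : ∀ᶠ u in nhds u₀, 0 < crs w.dir u * crs w.dir u₀ := by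
    have : ContinuousAt (fun u => crs w.dir u * crs w.dir u₀) u₀ := hcd.mul continuousAt_const
    exact this.eventually (lt_mem_nhds (mul_self_pos.2 htr))
  have E1 : ∀ᶠ u in nhds u₀, w.A < S u := hSc.eventually (lt_mem_nhds (by rw [hS0]; exact hh.hA))
  have E2 : ∀ᶠ u in nhds u₀, S u < w.B := hSc.eventually (gt_mem_nhds (by rw [hS0]; exact hh.hB))
  have E3 : ∀ᶠ u in nhds u₀, 0 < T u := hTc.eventually (lt_mem_nhds (by rw [hT0]; exact hh.pos))
  have E5 : ∀ᶠ u in nhds u₀, ∀ θ ∈ Set.Icc (0 : ℝ) 1, Free N W (o + (θ * T u) • u) ∨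
      ∀ k ∈ W, (z ∉ k.cl → o + (θ * T u) • u ∉ k.cl) ∧
      (k.A < 0 → z = k.pt k.A → o + (θ * T u) • u ∉ k.pt '' Set.Icc 0 k.B) ∧
      (1 < k.B → z = k.pt k.B → o + (θ * T u) • u ∉ k.pt '' Set.Icc k.A 1) := by
    refine isCompact_Icc.eventually_forall_of_forall_eventually (P := fun u θ =>
      Free N W (o + (θ * T u) • u) ∨
      ∀ k ∈ W, (z ∉ k.cl → o + (θ * T u) • u ∉ k.cl) ∧
      (k.A < 0 → z = k.pt k.A → o + (θ * T u) • u ∉ k.pt '' Set.Icc 0 k.B) ∧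
      (1 < k.B → z = k.pt k.B → o + (θ * T u) • u ∉ k.pt '' Set.Icc k.A 1)) ?_
    intro θ hθ
    have hc : ContinuousAt (fun q : Pt × ℝ => o + (q.2 * T q.1) • q.1) (u₀, θ) := by
      have : ContinuousAt (fun q : Pt × ℝ => T q.1) (u₀, θ) :=
        ContinuousAt.comp (g := T) (f := Prod.fst) hTc continuousAt_fst
      fun_prop
    rcases hθ.2.lt_or_eq with h1 | h1
    · have : Free N W (o + (θ * T u₀) • u₀) := by
        rw [hT0]
        exact hh.free _ (mul_nonneg hθ.1 hh.pos.le) (by nlinarith [hh.pos])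
      have := hc.eventually ((isOpen_free N W).mem_nhds this)
      filter_upwards [this] with q hq
      exact Or.inl hq
    · have hval : o + (θ * T u₀) • u₀ = z := by rw [h1, one_mul, hT0]; exact hh.eq
      have := hc.eventually (p := fun x => ∀ k ∈ W, (z ∉ k.cl → x ∉ k.cl) ∧
        (k.A < 0 → z = k.pt k.A → x ∉ k.pt '' Set.Icc 0 k.B) ∧
        (1 < k.B → z = k.pt k.B → x ∉ k.pt '' Set.Icc k.A 1)) (by
          simp only [hval]; exact hG)
      filter_upwards [this] with q hq
      exact Or.inr hq
  filter_upwards [E0, E1, E2, E3, E5] with u e0 e1 e2 e3 e5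
  have htu : crs w.dir u ≠ 0 := by
    intro hc; rw [hc, zero_mul] at e0; exact lt_irrefl _ e0
  have hu0 : u ≠ 0 := by rintro rfl; exact htu (crs_zero_right _)
  obtain ⟨τ, k, s, hk⟩ := h.exists_hit ho hu0 (Or.inl hf)
  refine ⟨τ, k, s, hk, ?_⟩
  have hle : τ ≤ T u := by
    by_contra hcon
    push Not at hcon
    refine (hk.free _ e3.le hcon).2 w hh.mem ?_
    rw [hTS u htu]
    exact ⟨_, ⟨e1.le, e2.le⟩, rfl⟩
  have hkcl : o + τ • u ∈ k.cl := by rw [hk.eq]; exact ⟨s, ⟨hk.hA.le, hk.hB.le⟩, rfl⟩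
  by_cases hkw : k = w
  · left
    refine ⟨hkw, ?_⟩
    subst hkw
    rw [eq_div_iff htu, hk.line_eq]
    simp only [crs_sub_left, crs_smul_left, crs_self]; ring
  right
  have hG' := e5 (τ / T u) ⟨by have := hk.pos; positivity, by rw [div_le_one e3]; exact hle⟩
  rw [div_mul_cancel₀ _ e3.ne'] at hG'
  have hG'' := hG'.resolve_left (fun hfree => hfree.2 k hk.mem hkcl)
  obtain ⟨g1, g2, g3⟩ := hG'' k hk.mem
  have hzk : z ∈ k.cl := by by_contra hc; exact g1 hc hkcl
  have hs00 : s₀ ≠ 0 ∧ s₀ ≠ 1 := by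
    by_contra hcon
    have h01 : s₀ = 0 ∨ s₀ = 1 := by tauto
    have := (h.endP_of_mark hh.mem hh.hA.le hh.hB.le h01).1
    exact hkw (h.eq_of_endP hM this hk.mem hh.mem hzk hzcl)
  refine ⟨hs00.1, hs00.2, ?_⟩
  -- the wall `k` ends at `z`
  have hend : ∃ v : Pt, ∃ c : ℝ, 0 < c ∧ o + τ • u = z + c • v ∧ crs w.dir v ≠ 0 ∧
      ∀ y, k.lab y s = w.lab v s₀ := by
    have hTJ : ∀ v l, TJ W z v l → crs w.dir v ≠ 0 ∧ w.lab v s₀ = l := by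
      rintro v l ⟨k', hk', s', a1, a2, -, -, a5, a6, a7⟩
      have : k' = w := h.opd k' hk' w hh.mem z ⟨s', ⟨a1, a2⟩, a5⟩ hzop
      subst this
      have : s' = s₀ := Wall.pt_inj hne a5
      subst this
      exact ⟨a6, a7⟩
    obtain ⟨σ, ⟨hσ0, hσ1⟩, hσ⟩ := hzk
    rcases hσ0.lt_or_eq with h0 | h0
    · rcases hσ1.lt_or_eq with h1 | h1
      · exact absurd (h.opd k hk.mem w hh.mem z ⟨σ, ⟨h0, h1⟩, hσ⟩ hzop) hkw
      · subst h1
        rcases h.endB k hk.mem with hB | hB | hB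
        · exact absurd hB (hf k hk.mem).2
        · rw [hσ] at hB; linarith
        rw [hσ] at hB
        obtain ⟨t1, t2⟩ := hTJ _ _ hB
        refine ⟨-k.dir, k.B - s, by linarith [hk.hB], ?_, t1, ?_⟩
        · rw [hk.eq, k.pt_eq k.B s, hσ]; module
        · intro y
          rw [t2]
          rcases h.typ k hk.mem with ⟨-, q1, q2⟩ | ⟨q1, q2⟩
          · have q3 : 1 < k.B := lt_of_le_of_ne q2 (hf k hk.mem).2.symm
            have q4 : 1 < s := by
              by_contra hcon
              push Not at hcon
              apply g3 q3 hσ.symm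
              rw [hk.eq]; exact ⟨s, ⟨hk.hA.le, hcon⟩, rfl⟩
            simp only [Wall.lab]
            rw [if_neg (by linarith), if_pos q4]
          · simp only [Wall.lab]
            rw [if_pos (by linarith [hk.hB]), q2]
    · subst h0
      rcases h.endA k hk.mem with hB | hB | hB
      · exact absurd hB (hf k hk.mem).1
      · rw [hσ] at hB; linarith
      rw [hσ] at hB
      obtain ⟨t1, t2⟩ := hTJ _ _ hB
      refine ⟨k.dir, s - k.A, by linarith [hk.hA], ?_, t1, ?_⟩
      · rw [hk.eq, k.pt_eq k.A s, hσ]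
      · intro y
        rw [t2]
        have hA0 : k.A < 0 := by
          rcases h.typ k hk.mem with ⟨-, q1, q2⟩ | ⟨q1, q2⟩
          · exact lt_of_le_of_ne q1 (hf k hk.mem).1
          · linarith [h.lt k hk.mem]
        have q4 : s < 0 := by
          by_contra hcon
          push Not at hcon
          apply g2 hA0 hσ.symm
          rw [hk.eq]; exact ⟨s, ⟨hcon, hk.hB.le⟩, rfl⟩
        simp only [Wall.lab]
        rw [if_pos q4]
  obtain ⟨v, c, hc, hv1, hv2, hv3⟩ := hend
  rw [hv3]
  have hsign : 0 < crs w.dir v ↔ 0 < crs w.dir (-u₀) := by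
    have k1 : c * crs w.dir v = crs w.dir (o - w.b) + τ * crs w.dir u := by
      have := congrArg (crs w.dir) hv1
      simp only [hz, Wall.pt, crs_add_right, crs_smul_right, crs_self] at this
      simp only [crs_sub_right]; linarith
    have k2 : T u * crs w.dir u = - crs w.dir (o - w.b) := by
      simp only [hT]
      rw [div_mul_cancel₀ _ htu, ← neg_sub, crs_neg_right]
    have k3 : c * crs w.dir v = (T u - τ) * (- crs w.dir u) := by rw [k1]; linarith
    have k4 : 0 < T u - τ := by
      rcases hle.lt_or_eq with q | q
      · linarith
      · exfalso; rw [q, sub_self, zero_mul] at k3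
        exact hv2 ((mul_eq_zero.1 k3).resolve_left hc.ne')
    rw [crs_neg_right]
    constructor
    · intro q
      have : 0 < (T u - τ) * (- crs w.dir u) := by rw [← k3]; exact mul_pos hc q
      have := (mul_pos_iff_of_pos_left k4).1 this
      nlinarith
    · intro q
      have : 0 < - crs w.dir u := by nlinarith
      have : 0 < c * crs w.dir v := by rw [k3]; exact mul_pos k4 this
      exact (mul_pos_iff_of_pos_left hc).1 this
  simp only [Wall.lab, hsign]

/-- Parameter of the blue (`false`) or red (`true`) endpoint of a wall. -/
def mpar (i : Bool) : ℝ := if i then 1 else 0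
def csg (i : Bool) : ℤ := if i then -1 else 1
def Wall.vlab (w : Wall) (i : Bool) : ℤ := if i then w.be else w.al
/-- The side of the wall to which an endpoint is assigned. -/
noncomputable def Wall.sg (w : Wall) (i : Bool) : ℝ := if w.vlab i = 0 then 1 else -1
def vpt (v : Wall × Bool) : Pt := v.1.pt (mpar v.2)
noncomputable def VW (W : Finset Wall) : Finset (Wall × Bool) := {w ∈ W | 1 ≤ w.B} ×ˢ univ
/-- The free points to whose class the endpoint `v` is assigned. -/
def Mem (N : ℝ) (W : Finset Wall) (v : Wall × Bool) (o : Pt) : Prop :=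
  SeesFrom N W v.1 (mpar v.2) (v.1.sg v.2) o

/-- The first wall seen from `o` in direction `u` has label `l`. -/
def HitLab (N : ℝ) (W : Finset Wall) (o u : Pt) (l : ℤ) : Prop :=
  ∃ τ w s, HitAt N W o u τ w s ∧ w.lab (-u) s = l

lemma HitLab.unique (hc : Cfg M N W) {o u : Pt} {l l' : ℤ} (h : HitLab N W o u l)
    (h' : HitLab N W o u l') : l = l' := by
  obtain ⟨τ, w, s, h1, rfl⟩ := h
  obtain ⟨τ', w', s', h1', rfl⟩ := h'
  obtain ⟨-, rfl, rfl⟩ := h1.unique hc h1'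
  rfl

lemma HitAt.smul {o u : Pt} {τ s : ℝ} {w : Wall} (h : HitAt N W o u τ w s) {a : ℝ} (ha : 0 < a) :
    HitAt N W o (a • u) (τ / a) w s where
  pos := div_pos h.pos ha
  mem := h.mem
  hA := h.hA
  hB := h.hB
  eq := by rw [smul_smul, div_mul_cancel₀ _ ha.ne', h.eq]
  free := fun t h0 h1 => by
    rw [smul_smul]
    exact h.free _ (by positivity) (by rwa [lt_div_iff₀ ha] at h1)

lemma HitLab.smul {o u : Pt} {l : ℤ} (h : HitLab N W o u l) {a : ℝ} (ha : 0 < a) :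
    HitLab N W o (a • u) l := by
  obtain ⟨τ, w, s, h1, rfl⟩ := h
  exact ⟨_, w, s, h1.smul ha, by rw [← smul_neg, w.lab_smul _ _ ha]⟩

open Filter in
lemma HitAt.eventually_sign {o u₀ : Pt} {τ s : ℝ} {w : Wall} (h : HitAt N W o u₀ τ w s)
    (hne : w.b ≠ w.r) : ∀ᶠ u in nhds u₀, 0 < crs w.dir u * crs w.dir u₀ := by
  have : Continuous (fun u => crs w.dir u * crs w.dir u₀) :=
    (continuous_crs_right _).mul continuous_const
  exact this.continuousAt.eventually (lt_mem_nhds (mul_self_pos.2 (h.transversal hne)))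

lemma HitAt.param {o u₀ : Pt} {τ s : ℝ} {w : Wall} (h : HitAt N W o u₀ τ w s) {u : Pt}
    (hu : crs w.dir u ≠ 0) :
    (crs (o - w.b) u / crs w.dir u - s) * crs w.dir u = - (τ * crs u₀ u) := by
  rw [sub_mul, div_mul_cancel₀ _ hu, h.line_eq]
  simp only [crs_sub_left, crs_smul_left]; ring

open Filter in
lemma HitAt.tendsto_param {o u₀ : Pt} {τ s : ℝ} {w : Wall} (h : HitAt N W o u₀ τ w s)
    (hne : w.b ≠ w.r) :
    Tendsto (fun u => crs (o - w.b) u / crs w.dir u) (nhds u₀) (nhds s) := by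
  have htr := h.transversal hne
  have h1 : ContinuousAt (fun u => crs (o - w.b) u / crs w.dir u) u₀ :=
    (continuous_crs_right _).continuousAt.div (continuous_crs_right _).continuousAt htr
  have h2 : crs (o - w.b) u₀ / crs w.dir u₀ = s := by
    have := h.param htr
    rw [crs_self, mul_zero, neg_zero] at this
    linarith [(mul_eq_zero.1 this).resolve_right htr]
  have h3 := h1.tendsto
  rwa [h2] at h3

open Filter in
/-- Away from matched points, the label of the first hit is locally constant. -/
lemma Cfg.hitLab_near (hM : PM M) (h : Cfg M N W) (hf : Full W) {o u₀ : Pt} {τ₀ s₀ : ℝ} {w : Wall}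
    (hh : HitAt N W o u₀ τ₀ w s₀) (h0 : s₀ ≠ 0) (h1 : s₀ ≠ 1) :
    ∀ᶠ u in nhds u₀, HitLab N W o u (w.lab (-u₀) s₀) := by
  have hne := h.ne w hh.mem
  have hT := hh.tendsto_param hne
  have E4 : ∀ᶠ s in nhds s₀, (s₀ < 0 → s < 0) ∧ (0 < s₀ → 0 < s) ∧ (s₀ < 1 → s < 1) ∧
      (1 < s₀ → 1 < s) := by
    refine Eventually.and ?_ (Eventually.and ?_ (Eventually.and ?_ ?_)) <;>
      rw [eventually_imp_distrib_left] <;> intro hlt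
    · exact gt_mem_nhds hlt
    · exact lt_mem_nhds hlt
    · exact gt_mem_nhds hlt
    · exact lt_mem_nhds hlt
  filter_upwards [h.hit_near hM hf hh, hT.eventually E4, hh.eventually_sign hne] with u hu e4 e0
  obtain ⟨τ, k, s, hk, hk2⟩ := hu
  rcases hk2 with ⟨rfl, rfl⟩ | ⟨-, -, hk2⟩
  · refine ⟨τ, k, _, hk, ?_⟩
    have hs : 0 < crs k.dir (-u) ↔ 0 < crs k.dir (-u₀) := by
      rw [crs_neg_right, crs_neg_right]
      constructor <;> intro <;> nlinarith
    simp only [Wall.lab, hs]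
    obtain ⟨a1, a2, a3, a4⟩ := e4
    rcases lt_or_gt_of_ne h0 with q | q
    · rw [if_pos q, if_pos (a1 q)]
    · rw [if_neg (not_lt.2 q.le), if_neg (not_lt.2 (a2 q).le)]
      rcases lt_or_gt_of_ne h1 with q' | q'
      · rw [if_neg (not_lt.2 q'.le), if_neg (not_lt.2 (a3 q').le)]
      · rw [if_pos q', if_pos (a4 q')]
  · exact ⟨τ, k, s, hk, hk2⟩

lemma mem_VW {v : Wall × Bool} : v ∈ VW W ↔ v.1 ∈ W ∧ 1 ≤ v.1.B := by
  simp [VW]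

lemma Cfg.vertex (h : Cfg M N W) (hf : Full W) {v : Wall × Bool} (hv : v ∈ VW W) :
    (v.1.b, v.1.r) ∈ M ∧ v.1.A < mpar v.2 ∧ mpar v.2 < v.1.B ∧ EndP M (vpt v) := by
  obtain ⟨h1, h2⟩ := mem_VW.1 hv
  rcases h.typ v.1 h1 with ⟨a, b, -⟩ | ⟨a, -⟩
  · have hA : v.1.A < 0 := lt_of_le_of_ne b (hf _ h1).1
    have hB : 1 < v.1.B := lt_of_le_of_ne h2 (hf _ h1).2.symm
    refine ⟨a, ?_, ?_, ?_⟩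
    · rcases v with ⟨v, _ | _⟩ <;> simp [mpar] at * <;> linarith
    · rcases v with ⟨v, _ | _⟩ <;> simp [mpar] at * <;> linarith
    · refine (h.endP_of_mark (w := v.1) h1 (s := mpar v.2) ?_ ?_ ?_).1 <;>
        rcases v with ⟨v, _ | _⟩ <;> simp [mpar] at * <;> linarith
  · linarith

open Filter in
/-- Turning from `-e` to `e`, the label of the first hit changes by the signed number of
vertices seen from the side they are assigned to. -/
lemma Cfg.half_sum (hM : PM M) (h : Cfg M N W) (hf : Full W) {o e : Pt} (ho : Free N W o)
    (he : e ≠ 0) (hnP : ∀ t : ℝ, ¬ EndP M (o + t • e)) {lp lm : ℤ} (hp : HitLab N W o e lp)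
    (hm : HitLab N W o (-e) lm) :
    lp - lm = ∑ v ∈ VW W with Mem N W v o ∧ 0 < crs (vpt v - o) e, csg v.2 := by
  set n := -perp e with hn
  have hne : 0 < crs n e := by
    rw [hn, crs_neg_left, crs_swap, neg_neg]; exact crs_perp_pos he
  set u : ℝ → Pt := fun t => n + t • e with hu
  have hue : ∀ t, crs (u t) e = crs n e := fun t => by
    simp only [hu, crs_add_left, crs_smul_left, crs_self]; ring
  have hu0 : ∀ t, u t ≠ 0 := fun t hc => by
    have := hue t; rw [hc, crs_zero_left] at this; linarith
  have hucont : Continuous u := by rw [hu]; fun_prop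
  have hex : ∀ t, ∃ l, HitLab N W o (u t) l := fun t => by
    obtain ⟨τ, w, s, hh⟩ := h.exists_hit ho (hu0 t) (Or.inl hf)
    exact ⟨_, τ, w, s, hh, rfl⟩
  choose F hF using hex
  -- the limits at infinity
  have hnear : ∀ e' l, (∀ t : ℝ, ¬ EndP M (o + t • e')) → HitLab N W o e' l →
      ∀ᶠ x in nhds e', HitLab N W o x l := by
    rintro e' l hP ⟨τ, w, s, hh, rfl⟩
    refine h.hitLab_near hM hf hh ?_ ?_ <;> rintro rfl <;> apply hP τ <;> rw [hh.eq]
    · exact (h.endP_of_mark hh.mem hh.hA.le hh.hB.le (Or.inl rfl)).1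
    · exact (h.endP_of_mark hh.mem hh.hA.le hh.hB.le (Or.inr rfl)).1
  have htop : ∀ᶠ t in atTop, F t = lp := by
    have h1 : Tendsto (fun t : ℝ => t⁻¹ • n + e) atTop (nhds e) := by
      have := (tendsto_inv_atTop_zero (𝕜 := ℝ)).smul_const n
      simpa using this.add_const e
    filter_upwards [h1.eventually (hnear e lp hnP hp), eventually_gt_atTop 0] with t ht ht0
    have h2 := ht.smul ht0
    have h3 : t • (t⁻¹ • n + e) = u t := by
      rw [smul_add, smul_smul, mul_inv_cancel₀ ht0.ne', one_smul]
    rw [h3] at h2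
    exact (hF t).unique h h2
  have hbot : ∀ᶠ t in atBot, F t = lm := by
    have h1 : Tendsto (fun t : ℝ => (-t)⁻¹ • n + -e) atBot (nhds (-e)) := by
      have := ((tendsto_inv_atTop_zero (𝕜 := ℝ)).comp tendsto_neg_atBot_atTop).smul_const n
      simpa using this.add_const (-e)
    have hnP' : ∀ t : ℝ, ¬ EndP M (o + t • -e) := fun t => by
      have := hnP (-t); rwa [neg_smul, ← smul_neg] at this
    filter_upwards [h1.eventually (hnear (-e) lm hnP' hm), eventually_lt_atBot 0] with t ht ht0
    have ht1 : 0 < -t := by linarith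
    have h2 := ht.smul ht1
    have h3 : (-t) • ((-t)⁻¹ • n + -e) = u t := by
      rw [smul_add, smul_smul, mul_inv_cancel₀ ht1.ne', one_smul]; simp [hu]
    rw [h3] at h2
    exact (hF t).unique h h2
  refine sub_eq_sum_jumps _ _ (fun v => crs n (vpt v - o) / crs (vpt v - o) e) F lm lp htop hbot ?_
  intro x
  obtain ⟨τ₀, w, s₀, hh⟩ := h.exists_hit ho (hu0 x) (Or.inl hf)
  have hwne := h.ne w hh.mem
  have huniq : ∀ v ∈ VW W, Mem N W v o → 0 < crs (vpt v - o) e →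
      crs n (vpt v - o) / crs (vpt v - o) e = x → v.1 = w ∧ mpar v.2 = s₀ := by
    intro v hv hvm hve hvx
    obtain ⟨-, g1, g2, -⟩ := h.vertex hf hv
    have hτ : 0 < crs (vpt v - o) e / crs n e := div_pos hve hne
    have heq : vpt v - o = (crs (vpt v - o) e / crs n e) • u x := by
      have h1 := crs_expand n e (vpt v - o)
      rw [div_eq_iff hve.ne'] at hvx
      rw [hvx] at h1
      have h2 : vpt v - o = (crs n e)⁻¹ • (crs n e • (vpt v - o)) := by
        rw [smul_smul, inv_mul_cancel₀ hne.ne', one_smul]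
      rw [h1] at h2
      rw [div_eq_inv_mul, mul_smul]
      refine h2.trans ?_
      simp only [hu]; module
    have hit : HitAt N W o (u x) (crs (vpt v - o) e / crs n e) v.1 (mpar v.2) := by
      refine ⟨hτ, (mem_VW.1 hv).1, g1, g2, ?_, ?_⟩
      · rw [← heq]; simp only [vpt]; abel
      · intro t t0 t1
        have := hvm.1 (t / (crs (vpt v - o) e / crs n e)) (by positivity) (by rwa [div_lt_one hτ])
        change Free N W (o + _ • (vpt v - o)) at this
        rw [heq, smul_smul] at this
        rwa [← heq, div_mul_cancel₀ _ hτ.ne'] at this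
    obtain ⟨-, a, b⟩ := hit.unique h hh
    exact ⟨a, b⟩
  by_cases hmark : s₀ = 0 ∨ s₀ = 1
  swap
  · push Not at hmark
    have hev := hucont.continuousAt.eventually (h.hitLab_near hM hf hh hmark.1 hmark.2)
    have hev' : ∀ᶠ y in nhds x, F y = w.lab (-u x) s₀ := by
      filter_upwards [hev] with y hy using (hF y).unique h hy
    refine ⟨_, _, hev'.filter_mono nhdsWithin_le_nhds, hev'.filter_mono nhdsWithin_le_nhds, ?_⟩
    rw [sub_self, eq_comm]
    apply Finset.sum_eq_zero
    intro v hv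
    simp only [mem_filter] at hv
    obtain ⟨-, g⟩ := huniq v hv.1.1 hv.1.2.1 hv.1.2.2 hv.2
    exfalso
    rcases v with ⟨v, _ | _⟩ <;> simp [mpar] at g
    · exact hmark.1 g.symm
    · exact hmark.2 g.symm
  obtain ⟨i, rfl⟩ : ∃ i, s₀ = mpar i := by
    rcases hmark with rfl | rfl
    · exact ⟨false, rfl⟩
    · exact ⟨true, rfl⟩
  have hvpt : vpt (w, i) = o + τ₀ • u x := hh.eq.symm
  have hwV : (w, i) ∈ VW W := by
    rw [mem_VW]; refine ⟨hh.mem, ?_⟩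
    rcases h.typ w hh.mem with ⟨-, -, a⟩ | ⟨a, -⟩
    · exact a
    · have := hh.hB; exfalso
      rcases i with _ | _ <;> simp [mpar] at this <;> linarith
  have hsub : vpt (w, i) - o = τ₀ • u x := by rw [hvpt]; abel
  have hc1 : 0 < crs (vpt (w, i) - o) e := by
    rw [hsub, crs_smul_left, hue]; exact mul_pos hh.pos hne
  have hc2 : crs n (vpt (w, i) - o) / crs (vpt (w, i) - o) e = x := by
    rw [div_eq_iff hc1.ne', hsub, crs_smul_left, hue]
    simp only [hu, crs_smul_right, crs_add_right, crs_self]; ring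
  have hside : crs w.dir (o - w.pt (mpar i)) = - (τ₀ * crs w.dir (u x)) := by
    rw [← hh.eq, ← crs_smul_right, ← crs_neg_right]; congr 1; abel
  have hmem : Mem N W (w, i) o ↔ w.sg i * crs w.dir (u x) < 0 := by
    simp only [Mem, SeesFrom]
    rw [hside]
    constructor
    · rintro ⟨-, q⟩; nlinarith [hh.pos]
    · intro q; exact ⟨hh.sees, by nlinarith [hh.pos]⟩
  have hsum : ∑ v ∈ {v ∈ {v ∈ VW W | Mem N W v o ∧ 0 < crs (vpt v - o) e} |
      crs n (vpt v - o) / crs (vpt v - o) e = x}, csg v.2 =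
      if w.sg i * crs w.dir (u x) < 0 then csg i else 0 := by
    have hsubset : ∀ v ∈ VW W, Mem N W v o → 0 < crs (vpt v - o) e →
        crs n (vpt v - o) / crs (vpt v - o) e = x → v = (w, i) := by
      intro v a1 a2 a3 a4
      obtain ⟨b1, b2⟩ := huniq v a1 a2 a3 a4
      refine Prod.ext b1 ?_
      rcases v with ⟨v, _ | _⟩ <;> rcases i with _ | _ <;> simp [mpar] at b2 ⊢
    split_ifs with hcond
    · rw [Finset.sum_eq_single (w, i)]
      · intro v hv hv2
        simp only [mem_filter] at hv
        exact absurd (hsubset v hv.1.1 hv.1.2.1 hv.1.2.2 hv.2) hv2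
      · intro hv
        exfalso; apply hv
        simp only [mem_filter]
        exact ⟨⟨hwV, hmem.2 hcond, hc1⟩, hc2⟩
    · apply Finset.sum_eq_zero
      intro v hv
      simp only [mem_filter] at hv
      have := hsubset v hv.1.1 hv.1.2.1 hv.1.2.2 hv.2
      subst this
      exact absurd (hmem.1 hv.1.2.1) hcond
  rw [hsum]
  have hmp : mpar i - 1 / 2 < mpar i ∧ mpar i < mpar i + 1 / 2 := ⟨by linarith, by linarith⟩
  have key : ∀ᶠ y in nhds x, ∃ s, F y = w.lab (-u y) s ∧ mpar i - 1 / 2 < s ∧ s < mpar i + 1 / 2 ∧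
      0 < crs w.dir (u y) * crs w.dir (u x) ∧
      (s - mpar i) * crs w.dir (u y) = - (τ₀ * ((y - x) * crs n e)) := by
    have c1 := hucont.continuousAt.eventually (h.hit_near hM hf hh)
    have c2 := hucont.continuousAt.eventually (hh.eventually_sign hwne)
    have c3 := hucont.continuousAt.eventually ((hh.tendsto_param hwne).eventually
      (Ioo_mem_nhds hmp.1 hmp.2))
    filter_upwards [c1, c2, c3] with y hy1 hy2 hy3
    obtain ⟨τ, k, s, hk, hk2⟩ := hy1
    have hk3 := hk2.resolve_right (fun hc => by
      rcases hmark with q | q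
      · exact hc.1 q
      · exact hc.2.1 q)
    obtain ⟨rfl, rfl⟩ := hk3
    refine ⟨_, (hF y).unique h ⟨_, _, _, hk, rfl⟩, hy3.1, hy3.2, hy2, ?_⟩
    rw [hh.param (fun hc => by rw [hc, zero_mul] at hy2; exact lt_irrefl _ hy2)]
    simp only [hu, crs_add_left, crs_add_right, crs_smul_left, crs_smul_right, crs_self]
    rw [crs_swap e n]; ring
  have hpos := hh.pos
  have hR : ∀ᶠ y in nhdsWithin x (Set.Ioi x), ∃ s, F y = w.lab (-u y) s ∧ mpar i - 1 / 2 < s ∧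
      s < mpar i + 1 / 2 ∧ 0 < crs w.dir (u y) * crs w.dir (u x) ∧
      (s - mpar i) * crs w.dir (u y) < 0 := by
    filter_upwards [key.filter_mono nhdsWithin_le_nhds, self_mem_nhdsWithin] with y hy hxy
    obtain ⟨s, a1, a2, a3, a4, a5⟩ := hy
    refine ⟨s, a1, a2, a3, a4, ?_⟩
    rw [a5, neg_lt_zero]
    exact mul_pos hpos (mul_pos (sub_pos.2 hxy) hne)
  have hL : ∀ᶠ y in nhdsWithin x (Set.Iio x), ∃ s, F y = w.lab (-u y) s ∧ mpar i - 1 / 2 < s ∧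
      s < mpar i + 1 / 2 ∧ 0 < crs w.dir (u y) * crs w.dir (u x) ∧
      0 < (s - mpar i) * crs w.dir (u y) := by
    filter_upwards [key.filter_mono nhdsWithin_le_nhds, self_mem_nhdsWithin] with y hy hxy
    obtain ⟨s, a1, a2, a3, a4, a5⟩ := hy
    refine ⟨s, a1, a2, a3, a4, ?_⟩
    rw [a5, ← mul_neg, ← neg_mul]
    exact mul_pos hpos (mul_pos (by rw [neg_sub]; exact sub_pos.2 hxy) hne)
  have htr := hh.transversal hwne
  have hal := h.al01 w hh.mem
  have hbe := h.be01 w hh.mem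
  clear key hsum huniq hmem hF htop hbot hnear
  rcases lt_or_gt_of_ne htr with hq | hq
  · have e1 : ∀ y, 0 < crs w.dir (u y) * crs w.dir (u x) → crs w.dir (u y) < 0 := fun y hy => by
      nlinarith
    rcases i with _ | _
    · refine ⟨w.al, 1, ?_, ?_, ?_⟩
      · filter_upwards [hL] with y ⟨s, a1, a2, a3, a4, a5⟩
        have := e1 y a4
        simp only [mpar, Bool.false_eq_true, if_false] at *
        rw [a1, Wall.lab, if_pos (by nlinarith)]
      · filter_upwards [hR] with y ⟨s, a1, a2, a3, a4, a5⟩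
        have := e1 y a4
        simp only [mpar, Bool.false_eq_true, if_false] at *
        rw [a1, Wall.lab, if_neg (by nlinarith), if_neg (by linarith),
          if_pos (by rw [crs_neg_right]; linarith)]
      · rcases hal with g | g <;> simp [Wall.sg, Wall.vlab, g, csg, hq, hq.le]
    · refine ⟨1, w.be, ?_, ?_, ?_⟩
      · filter_upwards [hL] with y ⟨s, a1, a2, a3, a4, a5⟩
        have := e1 y a4
        simp only [mpar, if_true] at *
        rw [a1, Wall.lab, if_neg (by linarith), if_neg (by nlinarith),
          if_pos (by rw [crs_neg_right]; linarith)]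
      · filter_upwards [hR] with y ⟨s, a1, a2, a3, a4, a5⟩
        have := e1 y a4
        simp only [mpar, if_true] at *
        rw [a1, Wall.lab, if_neg (by linarith), if_pos (by nlinarith)]
      · rcases hbe with g | g <;> simp [Wall.sg, Wall.vlab, g, csg, hq, hq.le]
  · have e1 : ∀ y, 0 < crs w.dir (u y) * crs w.dir (u x) → 0 < crs w.dir (u y) := fun y hy => by
      nlinarith
    rcases i with _ | _
    · refine ⟨0, w.al, ?_, ?_, ?_⟩
      · filter_upwards [hL] with y ⟨s, a1, a2, a3, a4, a5⟩
        have := e1 y a4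
        simp only [mpar, Bool.false_eq_true, if_false] at *
        rw [a1, Wall.lab, if_neg (by nlinarith), if_neg (by linarith),
          if_neg (by rw [crs_neg_right]; linarith)]
      · filter_upwards [hR] with y ⟨s, a1, a2, a3, a4, a5⟩
        have := e1 y a4
        simp only [mpar, Bool.false_eq_true, if_false] at *
        rw [a1, Wall.lab, if_pos (by nlinarith)]
      · rcases hal with g | g <;> simp [Wall.sg, Wall.vlab, g, csg, hq, hq.le]
    · refine ⟨w.be, 0, ?_, ?_, ?_⟩
      · filter_upwards [hL] with y ⟨s, a1, a2, a3, a4, a5⟩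
        have := e1 y a4
        simp only [mpar, if_true] at *
        rw [a1, Wall.lab, if_neg (by linarith), if_pos (by nlinarith)]
      · filter_upwards [hR] with y ⟨s, a1, a2, a3, a4, a5⟩
        have := e1 y a4
        simp only [mpar, if_true] at *
        rw [a1, Wall.lab, if_neg (by linarith), if_neg (by nlinarith),
          if_neg (by rw [crs_neg_right]; linarith)]
      · rcases hbe with g | g <;> simp [Wall.sg, Wall.vlab, g, csg, hq, hq.le]

/-- The segments `ab` and `cd` intersect. -/
def SegX (a b c d : Pt) : Prop :=
  ∃ t s : ℝ, 0 ≤ t ∧ t ≤ 1 ∧ 0 ≤ s ∧ s ≤ 1 ∧ a + t • (b - a) = c + s • (d - c)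

lemma segX_of_mem {a b c d x : Pt} (h1 : x ∈ segment ℝ a b) (h2 : x ∈ segment ℝ c d) :
    SegX a b c d := by
  rw [segment_eq_image'] at h1 h2
  obtain ⟨t, ⟨t0, t1⟩, ht⟩ := h1
  obtain ⟨s, ⟨s0, s1⟩, hs⟩ := h2
  exact ⟨t, s, t0, t1, s0, s1, ht.trans hs.symm⟩

/-- Three points are not collinear. -/
def NC (a b c : Pt) : Prop := crs (b - a) (c - a) ≠ 0

lemma SegX.proper {a b c d : Pt} (h : SegX a b c d) (h1 : NC a b c) (h2 : NC a b d) (h3 : NC c d a)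
    (h4 : NC c d b) : crs (b - a) (d - c) ≠ 0 ∧ ∃ t s : ℝ, 0 < t ∧ t < 1 ∧ 0 < s ∧ s < 1 ∧
      a + t • (b - a) = c + s • (d - c) := by
  obtain ⟨t, s, t0, t1, s0, s1, h⟩ := h
  have e1 : crs (b - a) (c - a) = - (s * crs (b - a) (d - c)) := by
    have : c - a = t • (b - a) - s • (d - c) := by
      rw [sub_eq_sub_iff_add_eq_add, add_comm (t • _), h]
    rw [this, crs_sub_right, crs_smul_right, crs_smul_right, crs_self]; ring
  have e2 : crs (b - a) (d - a) = (1 - s) * crs (b - a) (d - c) := by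
    have : d - a = (c - a) + (d - c) := by abel
    rw [this, crs_add_right, e1]; ring
  have e3 : crs (d - c) (a - c) = t * crs (b - a) (d - c) := by
    have : a - c = s • (d - c) - t • (b - a) := by
      rw [sub_eq_sub_iff_add_eq_add, add_comm (s • _), h]
    rw [this, crs_sub_right, crs_smul_right, crs_smul_right, crs_self, crs_swap (d - c)]; ring
  have e4 : crs (d - c) (b - c) = -(1 - t) * crs (b - a) (d - c) := by
    have : b - c = (a - c) + (b - a) := by abel
    rw [this, crs_add_right, e3, crs_swap (d - c)]; ring
  simp only [NC] at h1 h2 h3 h4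
  rw [e1] at h1; rw [e2] at h2; rw [e3] at h3; rw [e4] at h4
  refine ⟨fun hc => h1 (by rw [hc]; ring), t, s, lt_of_le_of_ne t0 ?_, lt_of_le_of_ne t1 ?_,
    lt_of_le_of_ne s0 ?_, lt_of_le_of_ne s1 ?_, h⟩
  · rintro rfl; exact h3 (by ring)
  · rintro rfl; exact h4 (by ring)
  · rintro rfl; exact h1 (by ring)
  · rintro rfl; exact h2 (by ring)

open Filter in
/-- Proper crossings are stable. -/
lemma SegX.stable {a b c d : Pt} (h : SegX a b c d) (h1 : NC a b c) (h2 : NC a b d)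
    (h3 : NC c d a) (h4 : NC c d b) :
    ∃ δ > 0, ∀ a' b' c' d' : Pt, ‖a' - a‖ < δ → ‖b' - b‖ < δ → ‖c' - c‖ < δ → ‖d' - d‖ < δ →
      SegX a' b' c' d' := by
  obtain ⟨h0, t, s, t0, t1, s0, s1, h⟩ := h.proper h1 h2 h3 h4
  set D : Pt × Pt × Pt × Pt → ℝ := fun z => crs (z.2.1 - z.1) (z.2.2.2 - z.2.2.1) with hD
  set Tn : Pt × Pt × Pt × Pt → ℝ := fun z => crs (z.2.2.1 - z.1) (z.2.2.2 - z.2.2.1) with hTn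
  set Sn : Pt × Pt × Pt × Pt → ℝ := fun z => crs (z.2.2.1 - z.1) (z.2.1 - z.1) with hSn
  have cD : Continuous D := by simp only [hD, crs]; fun_prop
  have cT : Continuous Tn := by simp only [hTn, crs]; fun_prop
  have cS : Continuous Sn := by simp only [hSn, crs]; fun_prop
  set z0 : Pt × Pt × Pt × Pt := (a, b, c, d) with hz0
  have hD0 : D z0 ≠ 0 := h0
  have hca : c - a = t • (b - a) - s • (d - c) := by
    rw [sub_eq_sub_iff_add_eq_add, add_comm (t • _), h]
  have hT0 : Tn z0 / D z0 = t := by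
    rw [div_eq_iff hD0]
    simp only [hTn, hD, hz0]
    rw [hca, crs_sub_left, crs_smul_left, crs_smul_left, crs_self]; ring
  have hS0 : Sn z0 / D z0 = s := by
    rw [div_eq_iff hD0]
    simp only [hSn, hD, hz0]
    rw [hca, crs_sub_left, crs_smul_left, crs_smul_left, crs_self, crs_swap (d - c)]; ring
  have cT' : ContinuousAt (fun z => Tn z / D z) z0 := cT.continuousAt.div cD.continuousAt hD0
  have cS' : ContinuousAt (fun z => Sn z / D z) z0 := cS.continuousAt.div cD.continuousAt hD0
  have e1 := cT'.eventually (Ioo_mem_nhds (a := 0) (b := 1) (t0.trans_eq hT0.symm)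
    (hT0.trans_lt t1))
  have e2 := cS'.eventually (Ioo_mem_nhds (a := 0) (b := 1) (s0.trans_eq hS0.symm)
    (hS0.trans_lt s1))
  have e3 := cD.continuousAt.eventually (isOpen_ne.mem_nhds hD0)
  obtain ⟨δ, hδ, hball⟩ := Metric.eventually_nhds_iff.1 (e1.and (e2.and e3))
  refine ⟨δ, hδ, fun a' b' c' d' ha hb hc hd => ?_⟩
  have hdist : dist ((a', b', c', d') : Pt × Pt × Pt × Pt) z0 < δ := by
    simp only [hz0, Prod.dist_eq (x := (a', b', c', d')), Prod.dist_eq (x := (b', c', d')),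
      Prod.dist_eq (x := (c', d')), dist_eq_norm]
    simp only [max_lt_iff]
    exact ⟨ha, hb, hc, hd⟩
  obtain ⟨g1, g2, g3⟩ := hball hdist
  refine ⟨_, _, g1.1.le, g1.2.le, g2.1.le, g2.2.le, ?_⟩
  have g3' : D (a', b', c', d') ≠ 0 := g3
  have key : D (a', b', c', d') • (c' - a') =
      Tn (a', b', c', d') • (b' - a') - Sn (a', b', c', d') • (d' - c') := by
    simp only [hD, hTn, hSn]
    rw [crs_expand (b' - a') (d' - c') (c' - a'), crs_swap (b' - a') (c' - a')]; module
  have k2 : c' - a' = (Tn (a', b', c', d') / D (a', b', c', d')) • (b' - a') -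
      (Sn (a', b', c', d') / D (a', b', c', d')) • (d' - c') := by
    have : c' - a' = (D (a', b', c', d'))⁻¹ • (D (a', b', c', d') • (c' - a')) := by
      rw [smul_smul, inv_mul_cancel₀ g3', one_smul]
    refine this.trans ?_
    rw [key, div_eq_inv_mul, div_eq_inv_mul]; module
  rw [sub_eq_sub_iff_add_eq_add] at k2
  rw [add_comm, ← k2]

/-- The Euclidean distance. -/
noncomputable def eud (p q : Pt) : ℝ := dist (Complex.mk p.1 p.2) (Complex.mk q.1 q.2)

lemma SegX.swap_lt {a b c d : Pt} (h : SegX a b c d) (h1 : NC a b c) (h2 : NC a b d)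
    (h3 : NC c d a) (h4 : NC c d b) : eud a d + eud c b < eud a b + eud c d := by
  obtain ⟨h0, t, s, t0, t1, s0, s1, h⟩ := h.proper h1 h2 h3 h4
  set J : Pt → ℂ := fun p => Complex.mk p.1 p.2 with hJ
  have hJl : ∀ (x y : Pt) (r : ℝ), J (x + r • (y - x)) = AffineMap.lineMap (J x) (J y) r := by
    intro x y r
    rw [AffineMap.lineMap_apply]
    apply Complex.ext <;> simp [hJ, add_comm]
  have hb1 : ∀ (x y : Pt) (r : ℝ), 0 ≤ r → r ≤ 1 →
      dist (J x) (J (x + r • (y - x))) + dist (J (x + r • (y - x))) (J y) = dist (J x) (J y) := by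
    intro x y r r0 r1
    exact Wbtw.dist_add_dist ⟨r, ⟨r0, r1⟩, (hJl x y r).symm⟩
  set X := a + t • (b - a) with hX
  have k1 := hb1 a b t t0.le t1.le
  have k2 := hb1 c d s s0.le s1.le
  rw [← h] at k2
  rw [← hX] at k1
  have k3 : dist (J a) (J d) < dist (J a) (J X) + dist (J X) (J d) := by
    refine lt_of_le_of_ne (dist_triangle _ _ _) fun hc => ?_
    obtain ⟨r, -, hr⟩ := dist_add_dist_eq_iff.1 hc.symm
    rw [← hJl] at hr
    rw [hX] at hr
    have hr' : a + r • (d - a) = a + t • (b - a) := by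
      have := hr
      apply Prod.ext
      · simpa [hJ] using congrArg Complex.re this
      · simpa [hJ] using congrArg Complex.im this
    have hr2 : r • (d - a) = t • (b - a) := add_left_cancel hr'
    have : t * crs (b - a) (d - a) = 0 := by
      rw [← crs_smul_left, ← hr2, crs_smul_left, crs_self, mul_zero]
    exact h2 ((mul_eq_zero.1 this).resolve_left t0.ne')
  have k4 := dist_triangle (J c) (J X) (J b)
  show dist (J a) (J d) + dist (J c) (J b) < dist (J a) (J b) + dist (J c) (J d)
  linarith

/-- Two colourings with equal fibres are related by a permutation which is minimal for a
lexicographic cost with respect to swaps. -/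
lemma exists_min_perm {ι κ : Type*} [Fintype ι] [DecidableEq ι] (f g : ι → κ)
    (hfg : ∀ c, #{i | f i = c} = #{i | g i = c}) (lr : ι → ι → ℕ) (d : ι → ι → ℝ) :
    ∃ σ : Equiv.Perm ι, (∀ i, f i = g (σ i)) ∧ ∀ i j, i ≠ j → f i = f j →
      lr i (σ i) + lr j (σ j) ≤ lr i (σ j) + lr j (σ i) ∧
      (lr i (σ j) + lr j (σ i) ≤ lr i (σ i) + lr j (σ j) →
        d i (σ i) + d j (σ j) ≤ d i (σ j) + d j (σ i)) := by
  have hne : ({σ : Equiv.Perm ι | ∀ i, f i = g (σ i)} : Finset (Equiv.Perm ι)).Nonempty := by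
    have e : ∀ c, Nonempty ({i // f i = c} ≃ {i // g i = c}) := fun c =>
      Fintype.card_eq.1 (by rw [Fintype.card_subtype, Fintype.card_subtype]; exact hfg c)
    refine ⟨Equiv.ofFiberEquiv fun c => (e c).some, ?_⟩
    simp only [mem_filter, mem_univ, true_and]
    exact fun i => (Equiv.ofFiberEquiv_map _ i).symm
  obtain ⟨σ, hσ, hmin⟩ := exists_min_image _
    (fun σ : Equiv.Perm ι => toLex (∑ i, lr i (σ i), ∑ i, d i (σ i))) hne
  simp only [mem_filter, mem_univ, true_and] at hσ hmin
  refine ⟨σ, hσ, fun i j hij hf => ?_⟩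
  have hτi : (σ * Equiv.swap i j) i = σ j := by simp
  have hτj : (σ * Equiv.swap i j) j = σ i := by simp
  have hτo : ∀ k, k ≠ i → k ≠ j → (σ * Equiv.swap i j) k = σ k := by
    intro k h1 h2; simp [Equiv.swap_apply_of_ne_of_ne h1 h2]
  have h := hmin (σ * Equiv.swap i j) (fun k => by
    by_cases h1 : k = i
    · rw [h1, hτi, hf, hσ]
    by_cases h2 : k = j
    · rw [h2, hτj, ← hf, hσ]
    rw [hτo k h1 h2, hσ])
  have hsum : ∀ {A : Type} [AddCommMonoid A] (F : ι → A),
      ∑ k, F k = F i + F j + ∑ k ∈ (univ.erase i).erase j, F k := by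
    intro A _ F
    rw [← add_sum_erase _ _ (mem_univ i), ← add_sum_erase _ _ (mem_erase.2 ⟨hij.symm, mem_univ j⟩),
      add_assoc]
  have hs : ∀ {A : Type} [AddCommMonoid A] (F : ι → ι → A),
      ∑ k ∈ (univ.erase i).erase j, F k ((σ * Equiv.swap i j) k) =
        ∑ k ∈ (univ.erase i).erase j, F k (σ k) := by
    intro A _ F
    refine sum_congr rfl fun k hk => ?_
    simp only [mem_erase] at hk
    rw [hτo k hk.2.1 hk.1]
  simp only [Prod.Lex.toLex_le_toLex] at h
  rw [hsum (fun k => lr k (σ k)), hsum (fun k => lr k ((σ * Equiv.swap i j) k)),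
    hsum (fun k => d k (σ k)), hsum (fun k => d k ((σ * Equiv.swap i j) k)), hs, hs] at h
  simp only [hτi, hτj] at h
  constructor
  · rcases h with h | h <;> omega
  · intro hle
    rcases h with h | h
    · omega
    · linarith [h.2]

lemma exists_pos_forall {α : Type*} (s : Finset α) (P : α → ℝ → Prop)
    (hP : ∀ i ∈ s, ∃ δ > 0, ∀ δ' ≤ δ, P i δ') : ∃ δ > 0, ∀ i ∈ s, P i δ := by
  suffices ∃ δ > 0, ∀ i ∈ s, ∀ δ' ≤ δ, P i δ' by
    obtain ⟨δ, h, h'⟩ := this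
    exact ⟨δ, h, fun i hi => h' i hi δ le_rfl⟩
  induction s using Finset.induction_on with
  | empty => exact ⟨1, one_pos, by simp⟩
  | insert a s ha ih =>
    obtain ⟨δ, h0, h⟩ := ih fun i hi => hP i (mem_insert_of_mem hi)
    obtain ⟨δ', h0', h'⟩ := hP a (mem_insert_self a s)
    refine ⟨min δ δ', lt_min h0 h0', fun i hi ε hε => ?_⟩
    rcases mem_insert.1 hi with rfl | hi
    · exact h' ε (hε.trans (min_le_right _ _))
    · exact h i hi ε (hε.trans (min_le_left _ _))

/-- The endpoints of a matching. -/
noncomputable def endPts (M : Finset (Pt × Pt)) : Finset Pt := M.image Prod.fst ∪ M.image Prod.snd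

lemma mem_endPts {p : Pt} : p ∈ endPts M ↔ EndP M p := by
  simp only [endPts, mem_union, mem_image, EndP]
  constructor
  · rintro (⟨e, he, rfl⟩ | ⟨e, he, rfl⟩)
    · exact ⟨e, he, Or.inl rfl⟩
    · exact ⟨e, he, Or.inr rfl⟩
  · rintro ⟨e, he, rfl | rfl⟩
    · exact Or.inl ⟨e, he, rfl⟩
    · exact Or.inr ⟨e, he, rfl⟩

lemma exists_dir (S : Finset Pt) (hS : ∀ p ∈ S, p ≠ 0) :
    ∃ e : Pt, e ≠ 0 ∧ ∀ p ∈ S, crs p e ≠ 0 := by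
  obtain ⟨κ, hκ⟩ := Infinite.exists_notMem_finset (S.image fun p => p.2 / p.1)
  refine ⟨(1, κ), by simp [Prod.ext_iff], fun p hp hc => ?_⟩
  simp only [crs, mul_one] at hc
  by_cases h1 : p.1 = 0
  · rw [h1] at hc
    exact hS p hp (Prod.ext h1 (by simpa using hc))
  · exact hκ (mem_image.2 ⟨p, hp, by field_simp; linarith⟩)

lemma Cfg.not_free_endP (h : Cfg M N W) {p : Pt} (hp : EndP M p) : ¬ Free N W p := by
  rintro ⟨-, hF⟩
  obtain ⟨e, he, hpe⟩ := hp
  obtain ⟨w, hw, hb, hr, hA, hB⟩ := h.hasM e he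
  refine hF w hw ?_
  rcases hpe with rfl | rfl
  · exact ⟨0, ⟨hA, by linarith⟩, by rw [w.pt_zero, hb]⟩
  · exact ⟨1, ⟨by linarith, hB⟩, by rw [w.pt_one, hr]⟩

lemma Cfg.exists_hitLab (h : Cfg M N W) (hf : Full W) {o u : Pt} (ho : Free N W o) (hu : u ≠ 0) :
    ∃ l, HitLab N W o u l ∧ (l = 0 ∨ l = 1) := by
  obtain ⟨τ, w, s, hh⟩ := h.exists_hit ho hu (Or.inl hf)
  exact ⟨_, ⟨τ, w, s, hh, rfl⟩, Wall.lab_zero_one (h.al01 w hh.mem) (h.be01 w hh.mem) _ _⟩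

lemma Cfg.half_abs (hM : PM M) (h : Cfg M N W) (hf : Full W) {o e : Pt} (ho : Free N W o)
    (he : e ≠ 0) (hnP : ∀ t : ℝ, ¬ EndP M (o + t • e)) :
    |∑ v ∈ VW W with Mem N W v o ∧ 0 < crs (vpt v - o) e, csg v.2| ≤ 1 := by
  obtain ⟨lp, hp, hp'⟩ := h.exists_hitLab hf ho he
  obtain ⟨lm, hm, hm'⟩ := h.exists_hitLab hf ho (neg_ne_zero.2 he)
  rw [← h.half_sum hM hf ho he hnP hp hm]
  rcases hp' with rfl | rfl <;> rcases hm' with rfl | rfl <;> simp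

lemma Cfg.balance (hM : PM M) (h : Cfg M N W) (hf : Full W) {o : Pt} (ho : Free N W o) :
    ∑ v ∈ VW W with Mem N W v o, csg v.2 = 0 := by
  obtain ⟨e, he, hne⟩ := exists_dir ((endPts M).image fun p => p - o) (by
    intro p hp
    obtain ⟨q, hq, rfl⟩ := mem_image.1 hp
    intro h0
    rw [sub_eq_zero] at h0
    exact h.not_free_endP (mem_endPts.1 hq) (h0 ▸ ho))
  have hne' : ∀ p, EndP M p → crs (p - o) e ≠ 0 := fun p hp =>
    hne _ (mem_image_of_mem _ (mem_endPts.2 hp))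
  have hnP : ∀ t : ℝ, ¬ EndP M (o + t • e) := fun t ht => hne' _ ht (by
    rw [add_sub_cancel_left, crs_smul_left, crs_self, mul_zero])
  have hnP' : ∀ t : ℝ, ¬ EndP M (o + t • -e) := fun t ht => hnP (-t) (by simpa using ht)
  obtain ⟨lp, hp, -⟩ := h.exists_hitLab hf ho he
  obtain ⟨lm, hm, -⟩ := h.exists_hitLab hf ho (neg_ne_zero.2 he)
  have k1 := h.half_sum hM hf ho he hnP hp hm
  have k2 := h.half_sum hM hf ho (neg_ne_zero.2 he) hnP' hm (by rwa [neg_neg])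
  have k3 : ∑ v ∈ VW W with Mem N W v o, csg v.2 =
      ∑ v ∈ VW W with Mem N W v o ∧ 0 < crs (vpt v - o) e, csg v.2 +
      ∑ v ∈ VW W with Mem N W v o ∧ 0 < crs (vpt v - o) (-e), csg v.2 := by
    simp only [sum_filter]
    rw [← sum_add_distrib]
    refine sum_congr rfl fun v hv => ?_
    have := hne' _ (h.vertex hf hv).2.2.2
    rw [crs_neg_right]
    by_cases hm : Mem N W v o
    · rcases lt_or_gt_of_ne this with h1 | h1
      · simp [hm, h1, h1.le]
      · simp [hm, h1, h1.le]
    · simp [hm]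
  rw [k3, ← k1, ← k2]; ring

lemma Vis.sub {x y : Pt} (h : Vis N W x y) {t : ℝ} (h0 : 0 ≤ t) (h1 : t ≤ 1) :
    Vis N W x (x + t • (y - x)) := by
  intro s s0 s1
  have := h (s * t) (by positivity) (by nlinarith)
  convert this using 1
  module

/-- The walls through edges of the matching. -/
noncomputable abbrev EW (W : Finset Wall) : Finset Wall := {w ∈ W | 1 ≤ w.B}

lemma sum_csg (P : Wall × Bool → Prop) [DecidablePred P] : ∑ v ∈ VW W with P v, csg v.2 =
    ∑ i : EW W, ((if P (i.1, false) then 1 else 0) - (if P (i.1, true) then 1 else 0) : ℤ) := by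
  rw [sum_filter, VW, sum_product, ← sum_coe_sort]
  refine sum_congr rfl fun i _ => ?_
  rw [Fintype.sum_bool]
  by_cases h1 : P (i.1, false) <;> by_cases h2 : P (i.1, true) <;> simp [h1, h2, csg]

lemma vpt_false (w : Wall) : vpt (w, false) = w.b := by simp [vpt, mpar, w.pt_zero]
lemma vpt_true (w : Wall) : vpt (w, true) = w.r := by simp [vpt, mpar, w.pt_one]

lemma Cfg.exists_hats (hM : PM M) (h : Cfg M N W) (hf : Full W) (hN : ∀ p, EndP M p → ‖p‖ < N)
    {δ : ℝ} (hδ : 0 < δ) : ∃ hv : Wall × Bool → Pt, ∀ v ∈ VW W, Free N W (hv v) ∧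
      ‖hv v - vpt v‖ < δ ∧ ∀ o, Free N W o → (Mem N W v o ↔ Vis N W o (hv v)) := by
  have : ∀ v ∈ VW W, ∃ x, Free N W x ∧
      ‖x - vpt v‖ < δ ∧ ∀ o, Free N W o → (Mem N W v o ↔ Vis N W o x) := by
    intro v hv
    obtain ⟨-, hA, hB, hP⟩ := h.vertex hf hv
    exact h.exists_hat hM hf (mem_VW.1 hv).1 hA hB hP (hN _ hP)
      (by unfold Wall.sg; split_ifs <;> norm_num) hδ
  choose! hv h' using this
  exact ⟨hv, h'⟩

/-- The convex cell of a point. -/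
def cell (N : ℝ) (W : Finset Wall) (x : Pt) : Set Pt := {o | Vis N W o x}

lemma Cfg.cell_eq_iff (h : Cfg M N W) (hf : Full W) {x y : Pt} (hx : Free N W x) :
    cell N W x = cell N W y ↔ Vis N W x y := by
  constructor
  · intro he
    have : x ∈ cell N W x := Vis.refl hx
    rw [he] at this
    exact this
  · intro hv
    ext o
    exact ⟨fun ho => h.vis_trans hf ho hv, fun ho => h.vis_trans hf ho hv.symm⟩

lemma mem_VW_coe (i : EW W) (t : Bool) : (i.1, t) ∈ VW W := mem_VW.2 (mem_filter.1 i.2)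

lemma Cfg.fiber_card (hM : PM M) (h : Cfg M N W) (hf : Full W) {hv : Wall × Bool → Pt}
    (hhv : ∀ v ∈ VW W, Free N W (hv v) ∧ ∀ o, Free N W o → (Mem N W v o ↔ Vis N W o (hv v)))
    (c : Set Pt) : #{i : EW W | cell N W (hv (i.1, false)) = c} =
      #{i : EW W | cell N W (hv (i.1, true)) = c} := by
  by_cases hc : ∃ x, Free N W x ∧ cell N W x = c
  · obtain ⟨x, hx, rfl⟩ := hc
    have e : ∀ v ∈ VW W, (cell N W (hv v) = cell N W x ↔ Mem N W v x) := fun v hv => by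
      rw [eq_comm, h.cell_eq_iff hf hx, (hhv v hv).2 x hx]
    have := h.balance hM hf hx
    rw [sum_csg, sum_sub_distrib, sum_boole, sum_boole, sub_eq_zero, Nat.cast_inj] at this
    simp only [e _ (mem_VW_coe _ _)]
    exact this
  · push Not at hc
    rw [filter_false_of_mem, filter_false_of_mem]
    · exact fun i _ => hc _ (hhv _ (mem_VW_coe i _)).1
    · exact fun i _ => hc _ (hhv _ (mem_VW_coe i _)).1

lemma PM.nc (hM : PM M) {a b c : Pt} (ha : EndP M a) (hb : EndP M b) (hc : EndP M c) (hab : a ≠ b)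
    (hac : a ≠ c) (hbc : b ≠ c) : NC a b c := hM.gp a b c ha hb hc hab hac hbc

/-- Segments with a common endpoint and no three collinear endpoints meet only there. -/
lemma NC.inter_subset {a b c x : Pt} (h : NC a b c) (h1 : x ∈ segment ℝ a b)
    (h2 : x ∈ segment ℝ a c) : x = a := by
  rw [segment_eq_image'] at h1 h2
  obtain ⟨t, -, rfl⟩ := h1
  obtain ⟨s, -, hs⟩ := h2
  have hs : s • (c - a) = t • (b - a) := add_left_cancel hs
  have : t * crs (b - a) (c - a) = 0 := by
    rw [← crs_smul_left, ← hs, crs_smul_left, crs_self, mul_zero]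
  rw [(mul_eq_zero.1 this).resolve_right h]
  simp

/-- The side of the line `crs x e = c`. -/
def Lft (e : Pt) (c : ℝ) (p : Pt) : Prop := crs p e < c

lemma lft_of_mem_segment {e : Pt} {c : ℝ} {a b x : Pt} (ha : Lft e c a) (hb : Lft e c b)
    (hx : x ∈ segment ℝ a b) : Lft e c x := by
  obtain ⟨s, t, s0, t0, hst, rfl⟩ := hx
  simp only [Lft, crs_add_left, crs_smul_left] at *
  rcases s0.eq_or_lt with rfl | hs
  · have : t = 1 := by linarith
    subst this; simpa using hb
  · have hs' : s = 1 - t := by linarith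
    subst hs'
    nlinarith

lemma rgt_of_mem_segment {e : Pt} {c : ℝ} {a b x : Pt} (ha : c < crs a e) (hb : c < crs b e)
    (hx : x ∈ segment ℝ a b) : c < crs x e := by
  have ha' : Lft (-e) (-c) a := by simp only [Lft, crs_neg_right]; linarith
  have hb' : Lft (-e) (-c) b := by simp only [Lft, crs_neg_right]; linarith
  have := lft_of_mem_segment ha' hb' hx
  simp only [Lft, crs_neg_right] at this
  linarith

lemma stable_side (e : Pt) (c : ℝ) {p : Pt} (hp : crs p e ≠ c) :
    ∃ δ > 0, ∀ p' : Pt, ‖p' - p‖ < δ → crs p' e ≠ c ∧ (Lft e c p' ↔ Lft e c p) := by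
  have hc := (continuous_crs_left e).continuousAt (x := p)
  rcases lt_or_gt_of_ne hp with h | h
  · obtain ⟨δ, hδ, H⟩ := Metric.eventually_nhds_iff.1 (hc.eventually (gt_mem_nhds h))
    exact ⟨δ, hδ, fun p' hp' => ⟨(H (by rwa [dist_eq_norm])).ne,
      iff_of_true (H (by rwa [dist_eq_norm])) h⟩⟩
  · obtain ⟨δ, hδ, H⟩ := Metric.eventually_nhds_iff.1 (hc.eventually (lt_mem_nhds h))
    exact ⟨δ, hδ, fun p' hp' => ⟨(H (by rwa [dist_eq_norm])).ne',
      iff_of_false (H (by rwa [dist_eq_norm])).not_gt h.not_gt⟩⟩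

/-- A tolerance that preserves all sides and proper crossings of the matched points. -/
lemma exists_tol (e : Pt) (c : ℝ) (hside : ∀ p, EndP M p → crs p e ≠ c) :
    ∃ δ > 0, (∀ p, EndP M p → ∀ p' : Pt, ‖p' - p‖ < δ →
      crs p' e ≠ c ∧ (Lft e c p' ↔ Lft e c p)) ∧
      ∀ p q r s, EndP M p → EndP M q → EndP M r → EndP M s → NC p q r → NC p q s → NC r s p →
        NC r s q → SegX p q r s → ∀ p' q' r' s' : Pt, ‖p' - p‖ < δ → ‖q' - q‖ < δ → ‖r' - r‖ < δ →
        ‖s' - s‖ < δ → SegX p' q' r' s' := by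
  obtain ⟨δ1, h1, H1⟩ := exists_pos_forall (endPts M) (fun p δ => ∀ p' : Pt, ‖p' - p‖ < δ →
      crs p' e ≠ c ∧ (Lft e c p' ↔ Lft e c p)) (fun p hp => by
    obtain ⟨δ, hδ, H⟩ := stable_side e c (hside p (mem_endPts.1 hp))
    exact ⟨δ, hδ, fun δ' hle p' hp' => H p' (hp'.trans_le hle)⟩)
  obtain ⟨δ2, h2, H2⟩ := exists_pos_forall (endPts M ×ˢ endPts M ×ˢ endPts M ×ˢ endPts M)
    (fun z δ => NC z.1 z.2.1 z.2.2.1 → NC z.1 z.2.1 z.2.2.2 → NC z.2.2.1 z.2.2.2 z.1 →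
        NC z.2.2.1 z.2.2.2 z.2.1 → SegX z.1 z.2.1 z.2.2.1 z.2.2.2 → ∀ p' q' r' s' : Pt,
        ‖p' - z.1‖ < δ → ‖q' - z.2.1‖ < δ → ‖r' - z.2.2.1‖ < δ →
        ‖s' - z.2.2.2‖ < δ → SegX p' q' r' s') (fun z _ => by
    by_cases hz : NC z.1 z.2.1 z.2.2.1 ∧ NC z.1 z.2.1 z.2.2.2 ∧ NC z.2.2.1 z.2.2.2 z.1 ∧
        NC z.2.2.1 z.2.2.2 z.2.1 ∧ SegX z.1 z.2.1 z.2.2.1 z.2.2.2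
    · obtain ⟨a1, a2, a3, a4, a5⟩ := hz
      obtain ⟨δ, hδ, H⟩ := a5.stable a1 a2 a3 a4
      exact ⟨δ, hδ, fun δ' hle _ _ _ _ _ p q r s b1 b2 b3 b4 => H _ _ _ _ (b1.trans_le hle)
        (b2.trans_le hle) (b3.trans_le hle) (b4.trans_le hle)⟩
    · exact ⟨1, one_pos, fun δ' _ a1 a2 a3 a4 a5 => absurd ⟨a1, a2, a3, a4, a5⟩ hz⟩)
  refine ⟨min δ1 δ2, lt_min h1 h2, fun p hp p' hp' => H1 p (mem_endPts.2 hp) p'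
    (hp'.trans_le (min_le_left _ _)), fun p q r s hp hq hr hs a1 a2 a3 a4 a5 p' q' r' s' b1 b2 b3 b4
    => ?_⟩
  exact H2 (p, q, r, s) (by simp only [mem_product, mem_endPts]; exact ⟨hp, hq, hr, hs⟩) a1 a2 a3 a4
    a5 p' q' r' s' (b1.trans_le (min_le_right _ _)) (b2.trans_le (min_le_right _ _))
    (b3.trans_le (min_le_right _ _)) (b4.trans_le (min_le_right _ _))

lemma exists_cross {e x y : Pt} {c : ℝ} (hx : crs x e ≠ c)
    (hxy : ¬ (Lft e c x ↔ Lft e c y)) :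
    ∃ t : ℝ, 0 ≤ t ∧ t ≤ 1 ∧ crs (x + t • (y - x)) e = c := by
  simp only [Lft] at hxy
  simp only [crs_add_left, crs_smul_left, crs_sub_left]
  have hne : crs y e - crs x e ≠ 0 := by
    intro h0; apply hxy; rw [sub_eq_zero.1 h0]
  refine ⟨(c - crs x e) / (crs y e - crs x e), ?_, ?_, by field_simp; ring⟩
  · rcases lt_or_gt_of_ne hx with h | h
    · have : ¬ crs y e < c := fun h' => hxy (iff_of_true h h')
      exact div_nonneg (by linarith) (by linarith)
    · have : crs y e < c := by
        by_contra h'; exact hxy (iff_of_false h.not_gt h')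
      exact div_nonneg_of_nonpos (by linarith) (by linarith)
  · rcases lt_or_gt_of_ne hx with h | h
    · have : ¬ crs y e < c := fun h' => hxy (iff_of_true h h')
      rw [div_le_one (by linarith)]; linarith
    · have : crs y e < c := by
        by_contra h'; exact hxy (iff_of_false h.not_gt h')
      rw [div_le_one_of_neg (by linarith)]; linarith

lemma two_le_sum {ι : Type*} [Fintype ι] (G : ι → ℤ) (h0 : ∀ k, 0 ≤ G k) {i j : ι} (hij : i ≠ j)
    (hi : 1 ≤ G i) (hj : 1 ≤ G j) : 2 ≤ ∑ k, G k := by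
  have h1 : ∑ k ∈ {i, j}, G k ≤ ∑ k, G k :=
    sum_le_sum_of_subset_of_nonneg (subset_univ _) fun k _ _ => h0 k
  rw [sum_pair hij] at h1
  linarith

lemma iff_of_not_iff {a b c d : Prop} (h1 : ¬ (a ↔ b)) (h2 : ¬ (c ↔ d)) (h3 : ¬ (c ↔ a)) :
    (a ↔ d) ∧ (c ↔ b) := by tauto

lemma not_abs_sum_le_one {ι : Type*} [Fintype ι] {C p q : ι → Prop} {i j : ι} (hij : ¬ i = j)
    (htyp : ∀ k, k ≠ i → C k → ¬ (p k ↔ q k) → (p k ↔ p i)) (hCi : C i) (hCj : C j)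
    (hi : ¬ (p i ↔ q i)) (hj : ¬ (p j ↔ q j))
    (habs : |∑ k, ((if C k ∧ ¬ p k then 1 else 0) - (if C k ∧ ¬ q k then 1 else 0) : ℤ)| ≤ 1) :
    False := by
  have hjt := htyp j (Ne.symm hij) hCj hj
  rw [abs_le] at habs
  by_cases hiL : p i
  · have hiq : ¬ q i := by tauto
    have hjp : p j := by tauto
    have hjq : ¬ q j := by tauto
    have := two_le_sum (fun k =>
      (-((if C k ∧ ¬ p k then 1 else 0) - (if C k ∧ ¬ q k then 1 else 0)) : ℤ)) ?_ hij ?_ ?_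
    · rw [sum_neg_distrib] at this
      linarith [habs.1]
    · intro k
      by_cases hki : k = i
      · subst hki; simp [hiL, hiq]; split_ifs; all_goals norm_num
      by_cases hk : C k
      · have := htyp k hki hk
        by_cases h1 : p k <;> by_cases h2 : q k <;> simp_all
      · simp [hk]
    · simp [hiL, hiq, hCi]
    · simp [hjp, hjq, hCj]
  · have hiq : q i := by tauto
    have hjp : ¬ p j := by tauto
    have hjq : q j := by tauto
    have := two_le_sum (fun k =>
      ((if C k ∧ ¬ p k then 1 else 0) - (if C k ∧ ¬ q k then 1 else 0) : ℤ)) ?_ hij ?_ ?_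
    · linarith [habs.2]
    · intro k
      by_cases hki : k = i
      · subst hki; simp [hiL, hiq]; split_ifs; all_goals norm_num
      by_cases hk : C k
      · have := htyp k hki hk
        by_cases h1 : p k <;> by_cases h2 : q k <;> simp_all
      · simp [hk]
    · simp [hiL, hiq, hCi]
    · simp [hjp, hjq, hCj]

set_option maxHeartbeats 1000000 in
/-- A full configuration yields a compatible matching with few edges crossing a line. -/
lemma Cfg.exists_matching (hM : PM M) (h : Cfg M N W) (hf : Full W) {B R : Finset Pt}
    (hBR : IsBRMatching B R M) (hN : ∀ p, EndP M p → ‖p‖ < N) {e : Pt} {c : ℝ} (he : e ≠ 0)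
    (hside : ∀ p, EndP M p → crs p e ≠ c) {f : Pt → ℕ} {S : Finset ℕ}
    (hfS : ∀ x, Free N W x → crs x e = c → f x ∈ S)
    (hfV : ∀ x y, Free N W x → Free N W y → crs x e = c → crs y e = c → f x = f y → Vis N W x y) :
    ∃ M', IsBRMatching B R M' ∧ Compatible M M' ∧
      #{a ∈ M' | ¬ (Lft e c a.1 ↔ Lft e c a.2)} ≤ #S := by
  obtain ⟨δ, hδ, hδs, hδx⟩ := exists_tol e c hside
  obtain ⟨hv, hhv⟩ := h.exists_hats hM hf hN hδ
  have hfree : ∀ i : EW W, ∀ t, Free N W (hv (i.1, t)) := fun i t => (hhv _ (mem_VW_coe i t)).1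
  have hmem : ∀ (i : EW W) t o, Free N W o → (Mem N W (i.1, t) o ↔ Vis N W o (hv (i.1, t))) :=
    fun i t => (hhv _ (mem_VW_coe i t)).2.2
  have hnb : ∀ i : EW W, ‖hv (i.1, false) - i.1.b‖ < δ := fun i => by
    rw [← vpt_false]; exact (hhv _ (mem_VW_coe i _)).2.1
  have hnr : ∀ i : EW W, ‖hv (i.1, true) - i.1.r‖ < δ := fun i => by
    rw [← vpt_true]; exact (hhv _ (mem_VW_coe i _)).2.1
  have hiM : ∀ i : EW W, (i.1.b, i.1.r) ∈ M := fun i => (h.vertex hf (mem_VW_coe i true)).1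
  have hA : ∀ i : EW W, i.1.A ≤ 0 := fun i => by
    have := (h.vertex hf (mem_VW_coe i false)).2.1
    simp only [mpar] at this; exact this.le
  have hB : ∀ i : EW W, 1 ≤ i.1.B := fun i => (mem_filter.1 i.2).2
  have hE0 : ∀ i : EW W, EndP M i.1.b := fun i => ⟨_, hiM i, Or.inl rfl⟩
  have hE1 : ∀ i : EW W, EndP M i.1.r := fun i => ⟨_, hiM i, Or.inr rfl⟩
  have hbr : ∀ i j : EW W, i.1.b ≠ j.1.r := fun i j => hM.ne _ (hiM i) _ (hiM j)
  have hinj : ∀ i j : EW W, i.1.b = j.1.b → i = j := fun i j hb => by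
    have := hM.inj1 _ (hiM i) _ (hiM j) hb
    exact Subtype.ext (h.eq_of_edge (mem_filter.1 i.2).1 (mem_filter.1 j.2).1 (hA i) (hB i)
      (hA j) (hB j) hb (congrArg Prod.snd this))
  have hinjr : ∀ i j : EW W, i.1.r = j.1.r → i = j := fun i j hr => by
    have := hM.inj2 _ (hiM i) _ (hiM j) hr
    exact hinj i j (congrArg Prod.fst this)
  have hex : ∀ a ∈ M, ∃ i : EW W, i.1.b = a.1 ∧ i.1.r = a.2 := fun a ha => by
    obtain ⟨w, hw, h1, h2, -, h4⟩ := h.hasM a ha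
    exact ⟨⟨w, mem_filter.2 ⟨hw, h4⟩⟩, h1, h2⟩
  obtain ⟨σ, hσ, hmin⟩ := exists_min_perm (fun i : EW W => cell N W (hv (i.1, false)))
    (fun i : EW W => cell N W (hv (i.1, true)))
    (h.fiber_card hM hf fun v hv' => ⟨(hhv v hv').1, (hhv v hv').2.2⟩)
    (fun i j => if Lft e c i.1.b ↔ Lft e c j.1.r then 0 else 1) (fun i j => eud i.1.b j.1.r)
  have hvis : ∀ i, Vis N W (hv (i.1, false)) (hv ((σ i).1, true)) := fun i =>
    (h.cell_eq_iff hf (hfree i _)).1 (hσ i)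
  have hcell : ∀ i j : EW W, Vis N W (hv (i.1, false)) (hv (j.1, false)) →
      cell N W (hv (i.1, false)) = cell N W (hv (j.1, false)) := fun i j hv =>
    (h.cell_eq_iff hf (hfree i _)).2 hv
  -- distinct edges of the new matching do not meet
  have hdisj : ∀ i j, i ≠ j → ∀ x, x ∈ segment ℝ i.1.b (σ i).1.r →
      x ∉ segment ℝ j.1.b (σ j).1.r := by
    intro i j hij x hx1 hx2
    have hs := segX_of_mem hx1 hx2
    have n1 := hM.nc (hE0 i) (hE1 (σ i)) (hE0 j) (hbr _ _) (fun h => hij (hinj _ _ h))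
      (hbr _ _).symm
    have n2 := hM.nc (hE0 i) (hE1 (σ i)) (hE1 (σ j)) (hbr _ _) (hbr _ _)
      (fun h => hij (σ.injective (hinjr _ _ h)))
    have n3 := hM.nc (hE0 j) (hE1 (σ j)) (hE0 i) (hbr _ _) (fun h => hij (hinj _ _ h).symm)
      (hbr _ _).symm
    have n4 := hM.nc (hE0 j) (hE1 (σ j)) (hE1 (σ i)) (hbr _ _) (hbr _ _)
      (fun h => hij (σ.injective (hinjr _ _ h)).symm)
    obtain ⟨t, s, t0, t1, s0, s1, hts⟩ := hδx _ _ _ _ (hE0 i) (hE1 (σ i)) (hE0 j) (hE1 (σ j)) n1 n2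
      n3 n4 hs _ _ _ _ (hnb i) (hnr (σ i)) (hnb j) (hnr (σ j))
    have hv1 := (hvis i).sub t0 t1
    have hv2 := (hvis j).sub s0 s1
    rw [← hts] at hv2
    obtain ⟨m1, m2⟩ := hmin i j hij (hcell i j (h.vis_trans hf hv1 hv2.symm))
    have hlt := hs.swap_lt n1 n2 n3 n4
    refine absurd (m2 ?_) (by linarith)
    by_cases p1 : Lft e c i.1.b <;> by_cases p2 : Lft e c (σ i).1.r <;>
      by_cases p3 : Lft e c j.1.b <;> by_cases p4 : Lft e c (σ j).1.r <;>
      simp only [p1, p2, p3, p4, if_true, if_false, iff_true, iff_false, not_true,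
        le_refl, zero_le, Nat.add_zero, Nat.zero_add] <;> first | omega | exfalso
    · exact p3 (absurd (lft_of_mem_segment p1 p2 hx1) (rgt_of_mem_segment
        (lt_of_le_of_ne (not_lt.1 p3) (hside _ (hE0 j)).symm)
        (lt_of_le_of_ne (not_lt.1 p4) (hside _ (hE1 _)).symm) hx2).not_gt)
    · exact absurd (lft_of_mem_segment p3 p4 hx2) (rgt_of_mem_segment
        (lt_of_le_of_ne (not_lt.1 p1) (hside _ (hE0 i)).symm)
        (lt_of_le_of_ne (not_lt.1 p2) (hside _ (hE1 _)).symm) hx1).not_gt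
  -- new edges meet old edges only in common endpoints
  have hcomp : ∀ i k, σ i ≠ i → ∀ x, x ∈ segment ℝ k.1.b k.1.r → x ∈ segment ℝ i.1.b (σ i).1.r →
      (k = i ∧ x = i.1.b) ∨ (k = σ i ∧ x = k.1.r) := by
    intro i k hne x hx1 hx2
    by_cases k1 : k = i
    · subst k1
      exact Or.inl ⟨rfl, (hM.nc (hE0 k) (hE1 k) (hE1 (σ k)) (hbr _ _) (hbr _ _)
        (fun h => hne (hinjr _ _ h).symm)).inter_subset hx1 hx2⟩
    by_cases k2 : k = σ i
    · subst k2
      rw [segment_symm] at hx1 hx2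
      exact Or.inr ⟨rfl, (hM.nc (hE1 (σ i)) (hE0 (σ i)) (hE0 i) (hbr _ _).symm (hbr _ _).symm
        (fun h => hne (hinj _ _ h))).inter_subset hx1 hx2⟩
    exfalso
    have n1 := hM.nc (hE0 i) (hE1 (σ i)) (hE0 k) (hbr _ _) (fun h => k1 (hinj _ _ h).symm)
      (hbr _ _).symm
    have n2 := hM.nc (hE0 i) (hE1 (σ i)) (hE1 k) (hbr _ _) (hbr _ _)
      (fun h => k2 (hinjr _ _ h).symm)
    have n3 := hM.nc (hE0 k) (hE1 k) (hE0 i) (hbr _ _) (fun h => k1 (hinj _ _ h))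
      (hbr _ _).symm
    have n4 := hM.nc (hE0 k) (hE1 k) (hE1 (σ i)) (hbr _ _) (hbr _ _)
      (fun h => k2 (hinjr _ _ h))
    obtain ⟨t, s, t0, t1, s0, s1, hts⟩ := hδx _ _ _ _ (hE0 i) (hE1 (σ i)) (hE0 k) (hE1 k) n1 n2
      n3 n4 (segX_of_mem hx2 hx1) _ _ k.1.b k.1.r (hnb i) (hnr (σ i)) (by simpa using hδ)
      (by simpa using hδ)
    have hF := (hvis i) t t0 t1
    rw [hts] at hF
    exact hF.2 k.1 (mem_filter.1 k.2).1 ⟨s, ⟨(hA k).trans s0, s1.trans (hB k)⟩, rfl⟩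
  refine ⟨univ.image fun i : EW W => (i.1.b, (σ i).1.r), ⟨?_, ?_, ?_, ?_⟩, ?_, ?_⟩
  · intro a ha
    obtain ⟨i, -, rfl⟩ := mem_image.1 ha
    exact ⟨(hBR.1 _ (hiM i)).1, (hBR.1 _ (hiM (σ i))).2⟩
  · intro b hb
    obtain ⟨a, ⟨ha, rfl⟩, -⟩ := hBR.2.1 b hb
    obtain ⟨i, hi, -⟩ := hex a ha
    refine ⟨(i.1.b, (σ i).1.r), ⟨mem_image_of_mem _ (mem_univ i), hi⟩, ?_⟩
    rintro a' ⟨ha', hb'⟩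
    obtain ⟨j, -, rfl⟩ := mem_image.1 ha'
    rw [hinj j i (hb'.trans hi.symm)]
  · intro r hr
    obtain ⟨a, ⟨ha, rfl⟩, -⟩ := hBR.2.2.1 r hr
    obtain ⟨i, -, hi⟩ := hex a ha
    obtain ⟨k, rfl⟩ := σ.surjective i
    refine ⟨(k.1.b, (σ k).1.r), ⟨mem_image_of_mem _ (mem_univ k), hi⟩, ?_⟩
    rintro a' ⟨ha', hb'⟩
    obtain ⟨j, -, rfl⟩ := mem_image.1 ha'
    rw [σ.injective (hinjr (σ j) (σ k) (hb'.trans hi.symm))]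
  · intro a ha a' ha' hne
    obtain ⟨i, -, rfl⟩ := mem_image.1 ha
    obtain ⟨j, -, rfl⟩ := mem_image.1 ha'
    have hij : i ≠ j := by rintro rfl; exact hne rfl
    exact Set.eq_empty_of_forall_notMem fun x hx => hdisj i j hij x hx.1 hx.2
  · intro a ha a' ha'
    obtain ⟨i, -, rfl⟩ := mem_image.1 ha'
    obtain ⟨k, hk1, hk2⟩ := hex a ha
    have hak : a = (k.1.b, k.1.r) := Prod.ext hk1.symm hk2.symm
    subst hak
    by_cases hne : σ i = i
    · by_cases hki : k = i
      · left; rw [hne, hki]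
      · right
        rintro x ⟨hx1, hx2⟩
        simp only [hne] at hx2
        have := hM.disj _ (hiM k) _ (hiM i) (fun hh => hki (hinj _ _ (congrArg Prod.fst hh)))
        have hx : x ∈ segment ℝ k.1.b k.1.r ∩ segment ℝ i.1.b i.1.r := ⟨hx1, hx2⟩
        rw [this] at hx
        exact hx.elim
    · right
      rintro x ⟨hx1, hx2⟩
      rcases hcomp i k hne x hx1 hx2 with ⟨rfl, rfl⟩ | ⟨rfl, rfl⟩
      · exact ⟨Or.inl rfl, Or.inl rfl⟩
      · exact ⟨Or.inr rfl, Or.inr rfl⟩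
  -- few edges cross the line
  have hsb : ∀ i : EW W, crs (hv (i.1, false)) e ≠ c ∧
      (Lft e c (hv (i.1, false)) ↔ Lft e c i.1.b) := fun i => hδs _ (hE0 i) _ (hnb i)
  have hsr : ∀ i : EW W, crs (hv (i.1, true)) e ≠ c ∧
      (Lft e c (hv (i.1, true)) ↔ Lft e c i.1.r) := fun i => hδs _ (hE1 i) _ (hnr i)
  have hq : ∀ i : EW W, ∃ q, ¬ (Lft e c i.1.b ↔ Lft e c (σ i).1.r) →
      crs q e = c ∧ Vis N W (hv (i.1, false)) q := by
    intro i
    by_cases hi : Lft e c i.1.b ↔ Lft e c (σ i).1.r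
    · exact ⟨0, fun h => absurd hi h⟩
    · obtain ⟨t, t0, t1, ht⟩ := exists_cross (y := hv ((σ i).1, true)) (hsb i).1 (by
        rwa [(hsb i).2, (hsr (σ i)).2])
      exact ⟨_, fun _ => ⟨ht, (hvis i).sub t0 t1⟩⟩
  choose q hq using hq
  have hL : ({a ∈ univ.image fun i : EW W => (i.1.b, (σ i).1.r) | ¬ (Lft e c a.1 ↔ Lft e c a.2)}) ⊆
      ({i : EW W | ¬ (Lft e c i.1.b ↔ Lft e c (σ i).1.r)} : Finset (EW W)).image
        fun i => (i.1.b, (σ i).1.r) := by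
    intro a ha
    obtain ⟨ha, ha'⟩ := mem_filter.1 ha
    obtain ⟨i, -, rfl⟩ := mem_image.1 ha
    exact mem_image_of_mem _ (mem_filter.2 ⟨mem_univ i, ha'⟩)
  refine (card_le_card hL).trans (card_image_le.trans
    (card_le_card_of_injOn (fun i => f (q i)) ?_ ?_))
  · intro i hi
    obtain ⟨h1, h2⟩ := hq i (mem_filter.1 hi).2
    exact hfS _ h2.free_right h1
  intro i hi j hj hfij
  have hi := (mem_filter.1 hi).2
  have hj := (mem_filter.1 hj).2
  by_contra hij
  obtain ⟨qi1, qi2⟩ := hq i hi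
  obtain ⟨qj1, qj2⟩ := hq j hj
  have hV := hfV _ _ qi2.free_right qj2.free_right qi1 qj1 hfij
  have hcij := hcell i j (h.vis_trans hf qi2 (h.vis_trans hf hV qj2.symm))
  -- all crossing edges in the cell have the same type
  have htyp : ∀ k, k ≠ i → cell N W (hv (i.1, false)) = cell N W (hv (k.1, false)) →
      ¬ (Lft e c k.1.b ↔ Lft e c (σ k).1.r) → (Lft e c k.1.b ↔ Lft e c i.1.b) := by
    intro k hki hk hLR
    have m1 := (hmin i k (Ne.symm hki) hk).1
    by_contra hcon
    obtain ⟨g1, g2⟩ := iff_of_not_iff hi hLR hcon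
    rw [if_neg hi, if_neg hLR, if_pos g1, if_pos g2] at m1
    omega
  have hnP : ∀ t : ℝ, ¬ EndP M (q i + t • e) := fun t ht => hside _ ht (by
    rw [crs_add_left, crs_smul_left, crs_self, qi1]; ring)
  have habs := h.half_abs hM hf qi2.free_right he hnP
  have hpos : ∀ p, EndP M p → (0 < crs (p - q i) e ↔ ¬ Lft e c p) := fun p hp => by
    rw [crs_sub_left, qi1, sub_pos, Lft, not_lt]
    exact ⟨le_of_lt, fun h => lt_of_le_of_ne h (hside _ hp).symm⟩
  rw [sum_csg (fun v => Mem N W v (q i) ∧ 0 < crs (vpt v - q i) e), sum_sub_distrib,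
    ← Equiv.sum_comp σ (fun k : EW W =>
    (if Mem N W (k.1, true) (q i) ∧ 0 < crs (vpt (k.1, true) - q i) e then 1 else 0 : ℤ)),
    ← sum_sub_distrib] at habs
  have hm1 : ∀ k : EW W, Mem N W (k.1, false) (q i) ↔
      cell N W (hv (i.1, false)) = cell N W (hv (k.1, false)) := fun k => by
    rw [hmem _ _ _ qi2.free_right, h.cell_eq_iff hf (hfree i _)]
    exact ⟨fun h' => h.vis_trans hf qi2 h', fun h' => h.vis_trans hf qi2.symm h'⟩
  have hm2 : ∀ k : EW W, Mem N W ((σ k).1, true) (q i) ↔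
      cell N W (hv (i.1, false)) = cell N W (hv (k.1, false)) := fun k => by
    have := hσ k
    rw [hmem _ _ _ qi2.free_right, this, h.cell_eq_iff hf (hfree i _)]
    exact ⟨fun h' => h.vis_trans hf qi2 h', fun h' => h.vis_trans hf qi2.symm h'⟩
  refine not_abs_sum_le_one
    (C := fun k : EW W => cell N W (hv (i.1, false)) = cell N W (hv (k.1, false)))
    (p := fun k => Lft e c k.1.b) (q := fun k => Lft e c (σ k).1.r)
    hij htyp rfl hcij hi hj (le_of_eq_of_le (congrArg abs (sum_congr rfl fun k _ => ?_)) habs)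
  refine congrArg₂ _ (if_congr ?_ rfl rfl) (if_congr ?_ rfl rfl)
  · have : 0 < crs (vpt (k.1, false) - q i) e ↔ ¬ Lft e c k.1.b := by
      rw [vpt_false]; exact hpos _ (hE0 k)
    exact (and_congr (hm1 k) this).symm
  · have : 0 < crs (vpt ((σ k).1, true) - q i) e ↔ ¬ Lft e c (σ k).1.r := by
      rw [vpt_true]; exact hpos _ (hE1 (σ k))
    exact (and_congr (hm2 k) this).symm

/-- The wall along the segment from `z₁` to `z₂` with constant label `g`. -/
def cw (z1 z2 : Pt) (g : ℤ) : Wall where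
  b := z2 + (z2 - z1)
  r := z2 + (2 : ℝ) • (z2 - z1)
  A := -2
  B := -1
  al := g
  be := g

lemma cw_dir (z1 z2 : Pt) (g : ℤ) : (cw z1 z2 g).dir = z2 - z1 := by
  simp only [cw, Wall.dir]; module
lemma cw_pt (z1 z2 : Pt) (g : ℤ) (s : ℝ) : (cw z1 z2 g).pt s = z1 + (s + 2) • (z2 - z1) := by
  rw [Wall.pt, cw_dir]; simp only [cw]; module
lemma mem_cw_cl {z1 z2 : Pt} {g : ℤ} {x : Pt} :
    x ∈ (cw z1 z2 g).cl ↔ ∃ t : ℝ, 0 ≤ t ∧ t ≤ 1 ∧ x = z1 + t • (z2 - z1) := by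
  constructor
  · rintro ⟨s, ⟨h1, h2⟩, rfl⟩
    simp only [cw] at h1 h2
    exact ⟨s + 2, by linarith, by linarith, cw_pt _ _ _ _⟩
  · rintro ⟨t, h0, h1, rfl⟩
    exact ⟨t - 2, ⟨by simp only [cw]; linarith, by simp only [cw]; linarith⟩, by
      rw [cw_pt, sub_add_cancel]⟩
lemma mem_cw_op {z1 z2 : Pt} {g : ℤ} {x : Pt} :
    x ∈ (cw z1 z2 g).op ↔ ∃ t : ℝ, 0 < t ∧ t < 1 ∧ x = z1 + t • (z2 - z1) := by
  constructor
  · rintro ⟨s, ⟨h1, h2⟩, rfl⟩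
    simp only [cw] at h1 h2
    exact ⟨s + 2, by linarith, by linarith, cw_pt _ _ _ _⟩
  · rintro ⟨t, h0, h1, rfl⟩
    exact ⟨t - 2, ⟨by simp only [cw]; linarith, by simp only [cw]; linarith⟩, by
      rw [cw_pt, sub_add_cancel]⟩
lemma cw_lab (z1 z2 : Pt) (g : ℤ) (u : Pt) {s : ℝ} (hs : s < 0) : (cw z1 z2 g).lab u s = g := by
  simp only [Wall.lab, if_pos hs]; rfl

lemma TJ.mono {W' : Finset Wall} (hW : W ⊆ W') {e u : Pt} {g : ℤ} (h : TJ W e u g) :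
    TJ W' e u g := by
  obtain ⟨k, hk, h⟩ := h
  exact ⟨k, hW hk, h⟩

lemma Cfg.not_endP_of_TJ (h : Cfg M N W) {e u : Pt} {g : ℤ} (ht : TJ W e u g) : ¬ EndP M e := by
  obtain ⟨k, hk, s, h1, h2, h3, h4, h5, -⟩ := ht
  intro hE
  rcases h.mark e hE k hk s h1.le h2.le h5 with h | h
  · exact h3 h
  · exact h4 h

lemma free_insert {w : Wall} {x : Pt} : Free N (insert w W) x ↔ Free N W x ∧ x ∉ w.cl := by
  simp only [Free, mem_insert, forall_eq_or_imp]
  tauto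

/-- Inserting a wall across a cell, joining two points with the same label. -/
lemma Cfg.insert_cw (h : Cfg M N W) {z1 z2 : Pt} {g : ℤ} (hz : z1 ≠ z2) (hg : g = 0 ∨ g = 1)
    (hfree : ∀ t : ℝ, 0 < t → t < 1 → Free N W (z1 + t • (z2 - z1)))
    (hA : TJ W z1 (z2 - z1) g) (hB : TJ W z2 (-(z2 - z1)) g) : Cfg M N (insert (cw z1 z2 g) W) where
  ne := by
    intro w hw
    rcases mem_insert.1 hw with rfl | hw
    · intro h0
      have : (cw z1 z2 g).dir = 0 := by rw [Wall.dir, h0, sub_self]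
      rw [cw_dir, sub_eq_zero] at this
      exact hz this.symm
    · exact h.ne w hw
  lt := by
    intro w hw
    rcases mem_insert.1 hw with rfl | hw
    · simp only [cw]; norm_num
    · exact h.lt w hw
  al01 := by
    intro w hw
    rcases mem_insert.1 hw with rfl | hw
    · exact hg
    · exact h.al01 w hw
  be01 := by
    intro w hw
    rcases mem_insert.1 hw with rfl | hw
    · exact hg
    · exact h.be01 w hw
  typ := by
    intro w hw
    rcases mem_insert.1 hw with rfl | hw
    · right; simp only [cw]; norm_num
    · exact h.typ w hw
  opd := by
    have key : ∀ w ∈ W, ∀ x, x ∈ (cw z1 z2 g).op → x ∉ w.op := by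
      intro w hw x hx hxw
      obtain ⟨t, t0, t1, rfl⟩ := mem_cw_op.1 hx
      exact (hfree t t0 t1).2 w hw (w.op_subset_cl hxw)
    intro w hw k hk x hxw hxk
    rcases mem_insert.1 hw with rfl | hw <;> rcases mem_insert.1 hk with rfl | hk
    · rfl
    · exact absurd hxk (key _ hk _ hxw)
    · exact absurd hxw (key _ hw _ hxk)
    · exact h.opd w hw k hk x hxw hxk
  endA := by
    intro w hw
    rcases mem_insert.1 hw with rfl | hw
    · right; right
      rw [cw_pt, cw_dir]
      simpa [cw] using hA.mono (subset_insert _ _)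
    · exact (h.endA w hw).imp id (Or.imp id (TJ.mono (subset_insert _ _)))
  endB := by
    intro w hw
    rcases mem_insert.1 hw with rfl | hw
    · right; right
      rw [cw_pt, cw_dir]
      have : z1 + ((cw z1 z2 g).B + 2) • (z2 - z1) = z2 := by simp only [cw]; module
      rw [this]
      exact hB.mono (subset_insert _ _)
    · exact (h.endB w hw).imp id (Or.imp id (TJ.mono (subset_insert _ _)))
  mark := by
    intro p hp w hw s h1 h2 hs
    rcases mem_insert.1 hw with rfl | hw
    · exfalso
      obtain ⟨t, t0, t1, ht⟩ := mem_cw_cl.1 (⟨s, ⟨h1, h2⟩, hs⟩ : p ∈ (cw z1 z2 g).cl)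
      rcases t0.eq_or_lt with rfl | t0
      · exact h.not_endP_of_TJ hA (by simpa [ht] using hp)
      rcases t1.eq_or_lt with rfl | t1
      · exact h.not_endP_of_TJ hB (by simpa [ht] using hp)
      · exact h.not_free_endP hp (ht ▸ hfree t t0 t1)
    · exact h.mark p hp w hw s h1 h2 hs
  hasM := by
    intro a ha
    obtain ⟨w, hw, h'⟩ := h.hasM a ha
    exact ⟨w, mem_insert_of_mem hw, h'⟩
  encl := by
    intro x hx
    obtain ⟨w, hw, h'⟩ := h.encl x hx
    exact ⟨w, mem_insert_of_mem hw, h'⟩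

/-- The free part of the line `crs x e = c` is coloured with `n` colours, so that points of the
same colour see each other. -/
def Cov (N : ℝ) (W : Finset Wall) (e : Pt) (c : ℝ) (n : ℕ) : Prop :=
  ∃ (f : Pt → ℕ) (S : Finset ℕ), #S ≤ n ∧ (∀ x, Free N W x → crs x e = c → f x ∈ S) ∧
    ∀ x y, Free N W x → Free N W y → crs x e = c → crs y e = c → f x = f y → Vis N W x y

lemma Cov.mono {e : Pt} {c : ℝ} {n m : ℕ} (h : Cov N W e c n) (hnm : n ≤ m) : Cov N W e c m := by
  obtain ⟨f, S, h1, h2⟩ := h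
  exact ⟨f, S, h1.trans hnm, h2⟩

lemma exists_eq_add_smul {e x y : Pt} (he : e ≠ 0) (h : crs x e = crs y e) :
    ∃ t : ℝ, y = x + t • e := by
  obtain ⟨t, ht⟩ := exists_smul_of_crs_eq_zero (u := e) (v := y - x) he (by
    rw [crs_swap, crs_sub_left, h]; ring)
  exact ⟨t, by rw [← ht]; abel⟩

lemma HitAt.not_free {o u : Pt} {τ s : ℝ} {w : Wall} (h : HitAt N W o u τ w s) :
    ¬ Free N W (o + τ • u) := fun hF =>
  hF.2 w h.mem (by rw [h.eq]; exact ⟨s, ⟨h.hA.le, h.hB.le⟩, rfl⟩)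

lemma crs_line {o e : Pt} (t : ℝ) : crs (o + t • e) e = crs o e := by
  rw [crs_add_left, crs_smul_left, crs_self]; ring

lemma HitAt.TJ (h : Cfg M N W) {o u : Pt} {τ s : ℝ} {w : Wall} (hh : HitAt N W o u τ w s)
    (hE : ¬ EndP M (o + τ • u)) {a : ℝ} (ha : 0 < a) :
    TJ W (o + τ • u) (a • -u) (w.lab (-u) s) := by
  have hm : ¬ (s = 0 ∨ s = 1) := fun hs => hE (by
    rw [hh.eq]; exact (h.endP_of_mark hh.mem hh.hA.le hh.hB.le hs).1)
  push Not at hm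
  refine ⟨w, hh.mem, s, hh.hA, hh.hB, hm.1, hm.2, hh.eq.symm, ?_, w.lab_smul _ _ ha⟩
  rw [crs_smul_right, crs_neg_right]
  exact mul_ne_zero ha.ne' (neg_ne_zero.2 (hh.transversal (h.ne w hh.mem)))

/-- A gap of the line between two equal labels can be filled by a wall. -/
lemma Cfg.close (h : Cfg M N W) {e o : Pt} {c : ℝ} (he : e ≠ 0) (hoe : crs o e = c)
    (hside : ∀ p, EndP M p → crs p e ≠ c) {l : ℤ} (h1 : HitLab N W o e l)
    (h2 : HitLab N W o (-e) l) (ho : Free N W o) :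
    ∃ z1 z2, Cfg M N (insert (cw z1 z2 l) W) ∧
      (∀ n, Cov N W e c n → 0 < n ∧ Cov N (insert (cw z1 z2 l) W) e c (n - 1)) ∧
      ∀ o', crs o' e = c → Free N W o' → ¬ Vis N W o o' → Free N (insert (cw z1 z2 l) W) o' ∧
        ∀ u l', (u = e ∨ u = -e) → HitLab N W o' u l' →
          HitLab N (insert (cw z1 z2 l) W) o' u l' := by
  obtain ⟨τ1, w1, s1, H1, L1⟩ := h1
  obtain ⟨τ2, w2, s2, H2, L2⟩ := h2
  have p1 := H1.pos
  have p2 := H2.pos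
  have n1 := H1.not_free
  have n2 := H2.not_free
  have hl : l = 0 ∨ l = 1 := L1 ▸ Wall.lab_zero_one (h.al01 _ H1.mem) (h.be01 _ H1.mem) _ _
  have E1 : ¬ EndP M (o + τ1 • e) := fun hE => hside _ hE (by rw [crs_line, hoe])
  have E2 : ¬ EndP M (o + τ2 • -e) := fun hE => hside _ hE (by
    rw [smul_neg, ← neg_smul, crs_line, hoe])
  have T1 := H1.TJ h E1 (add_pos p1 p2)
  have T2 := H2.TJ h E2 (add_pos p1 p2)
  rw [L1] at T1
  rw [L2] at T2
  set z1 := o + τ2 • -e with hz1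
  set z2 := o + τ1 • e with hz2
  have hz : z2 - z1 = (τ1 + τ2) • e := by rw [hz1, hz2]; module
  have hline : ∀ t : ℝ, z1 + t • (z2 - z1) = o + (t * (τ1 + τ2) - τ2) • e := fun t => by
    rw [hz, hz1]; module
  have hfr : ∀ r : ℝ, -τ2 < r → r < τ1 → Free N W (o + r • e) := by
    intro r r1 r2
    rcases le_or_gt 0 r with hr | hr
    · exact H1.free r hr r2
    · have := H2.free (-r) (by linarith) (by linarith)
      rwa [smul_neg, neg_smul, neg_neg] at this
  -- the wall consists of the points visible from `o`
  have I1 : ∀ x, Free N W x → x ∈ (cw z1 z2 l).cl → Vis N W o x := by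
    intro x hx hxc
    obtain ⟨t, t0, t1, rfl⟩ := mem_cw_cl.1 hxc
    rw [hline] at hx ⊢
    set r := t * (τ1 + τ2) - τ2
    have hr1 : -τ2 < r := by
      refine lt_of_le_of_ne (by simp only [r]; nlinarith) fun h0 => n2 ?_
      rw [hz1, smul_neg, ← neg_smul, h0]; exact hx
    have hr2 : r < τ1 := by
      refine lt_of_le_of_ne (by simp only [r]; nlinarith) fun h0 => n1 ?_
      rw [hz2, ← h0]; exact hx
    intro s s0 s1
    have hb : -τ2 < s * r ∧ s * r < τ1 := by
      rcases le_total 0 r with hr | hr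
      · have q1 := mul_nonneg s0 hr
        have q2 := mul_le_of_le_one_left hr s1
        exact ⟨by linarith, by linarith⟩
      · have q1 := mul_nonpos_of_nonneg_of_nonpos s0 hr
        have q2 : r ≤ s * r := by nlinarith
        exact ⟨by linarith, by linarith⟩
    have := hfr (s * r) hb.1 hb.2
    convert this using 1
    module
  have I2 : ∀ x, crs x e = c → Vis N W o x → x ∈ (cw z1 z2 l).cl := by
    intro x hx hv
    obtain ⟨r, rfl⟩ := exists_eq_add_smul he (hoe.trans hx.symm)
    have hr1 : -τ2 ≤ r := by
      by_contra hlt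
      have hr : r < 0 := by linarith
      refine n2 ?_
      have := hv (-τ2 / r) (div_nonneg_of_nonpos (by linarith) hr.le)
        ((div_le_one_of_neg hr).2 (by linarith))
      convert this using 1
      rw [hz1, add_sub_cancel_left, smul_smul, div_mul_cancel₀ _ hr.ne]; module
    have hr2 : r ≤ τ1 := by
      by_contra hlt
      have hr : 0 < r := by linarith
      refine n1 ?_
      have := hv (τ1 / r) (div_nonneg p1.le hr.le) ((div_le_one hr).2 (by linarith))
      convert this using 1
      rw [hz2, add_sub_cancel_left, smul_smul, div_mul_cancel₀ _ hr.ne']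
    refine mem_cw_cl.2 ⟨(r + τ2) / (τ1 + τ2), div_nonneg (by linarith) (by linarith),
      (div_le_one (by linarith)).2 (by linarith), ?_⟩
    rw [hline, div_mul_cancel₀ _ (by linarith)]; congr 2; ring
  have hcol : ∀ x y z : Pt, crs x e = c → crs y e = c → crs z e = c → crs (y - x) (z - y) = 0 := by
    intro x y z hx hy hz
    obtain ⟨r, rfl⟩ := exists_eq_add_smul he (hx.trans hy.symm)
    obtain ⟨s, rfl⟩ := exists_eq_add_smul he (hy.trans hz.symm)
    rw [add_sub_cancel_left, add_sub_cancel_left, crs_smul_left, crs_smul_right, crs_self]; ring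
  have hseg : ∀ x y : Pt, ∀ t : ℝ, crs x e = c → crs y e = c → crs (x + t • (y - x)) e = c := by
    intro x y t hx hy
    rw [crs_add_left, crs_smul_left, crs_sub_left, hx, hy]; ring
  refine ⟨z1, z2, h.insert_cw ?_ hl ?_ ?_ ?_, ?_, ?_⟩
  · intro h0
    rw [← h0, sub_self] at hz
    exact (smul_ne_zero (by linarith) he) hz.symm
  · intro t t0 t1
    rw [hline]
    exact hfr _ (by nlinarith) (by nlinarith)
  · rw [hz]; rwa [neg_neg] at T2
  · rw [hz, ← smul_neg]; exact T1
  · rintro n ⟨f, S, hS, hf1, hf2⟩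
    have hoS := hf1 o ho hoe
    refine ⟨lt_of_lt_of_le (card_pos.2 ⟨_, hoS⟩) hS, f, S.erase (f o), ?_, ?_, ?_⟩
    · rw [card_erase_of_mem hoS]; omega
    · intro x hx hxe
      obtain ⟨hx, hxc⟩ := free_insert.1 hx
      exact mem_erase.2 ⟨fun hxo => hxc (I2 x hxe (hf2 o x ho hx hoe hxe hxo.symm)), hf1 x hx hxe⟩
    · intro x y hx hy hxe hye hxy
      obtain ⟨hx, hxc⟩ := free_insert.1 hx
      obtain ⟨hy, hyc⟩ := free_insert.1 hy
      have hv := hf2 x y hx hy hxe hye hxy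
      intro t t0 t1
      refine free_insert.2 ⟨hv t t0 t1, fun hc => hxc (I2 x hxe ?_)⟩
      exact (I1 _ (hv t t0 t1) hc).trans_of_collinear (hcol _ _ _ hoe (hseg _ _ _ hxe hye) hxe)
        (hv.sub t0 t1).symm
  · intro o' ho'e ho' hnv
    refine ⟨free_insert.2 ⟨ho', fun hc => hnv (I1 _ ho' hc)⟩, ?_⟩
    rintro u l' hu ⟨τ, k, s, H, L⟩
    have hue : crs u e = 0 := by
      rcases hu with rfl | rfl
      · exact crs_self _
      · rw [crs_neg_left, crs_self, neg_zero]
    refine ⟨τ, k, s, ⟨H.pos, mem_insert_of_mem H.mem, H.hA, H.hB, H.eq, fun t t0 t1 => ?_⟩, L⟩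
    refine free_insert.2 ⟨H.free t t0 t1, fun hc => hnv ?_⟩
    have hxe : crs (o' + t • u) e = c := by rw [crs_add_left, crs_smul_left, hue, ho'e]; ring
    refine (I1 _ (H.free t t0 t1) hc).trans_of_collinear (hcol _ _ _ hoe hxe ho'e) ?_
    refine Vis.symm fun r r0 r1 => ?_
    have := H.free (r * t) (by positivity) (by nlinarith)
    convert this using 1
    module

/-- No gap of the line has the same label at both ends. -/
def NoCons (N : ℝ) (W : Finset Wall) (e : Pt) (c : ℝ) : Prop :=
  ∀ o, Free N W o → crs o e = c → ∀ l l', HitLab N W o e l → HitLab N W o (-e) l' → l ≠ l'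

/-- The number of open ends of a wall. -/
noncomputable def openEnds (w : Wall) : ℕ := (if w.A = 0 then 1 else 0) + if w.B = 1 then 1 else 0

lemma openEnds_cw (z1 z2 : Pt) (g : ℤ) : openEnds (cw z1 z2 g) = 0 := by
  simp [openEnds, cw]; norm_num

lemma sum_insert_le_add {f : Wall → ℕ} (w : Wall) :
    ∑ k ∈ insert w W, f k ≤ f w + ∑ k ∈ W, f k := by
  by_cases hw : w ∈ W
  · rw [insert_eq_of_mem hw]; omega
  · rw [sum_insert hw]

lemma Cov.neg {e : Pt} {c : ℝ} {n : ℕ} (h : Cov N W e c n) : Cov N W (-e) (-c) n := by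
  obtain ⟨f, S, h1, h2, h3⟩ := h
  have key : ∀ x : Pt, crs x (-e) = -c ↔ crs x e = c := fun x => by rw [crs_neg_right, neg_inj]
  refine ⟨f, S, h1, fun x hx hc => h2 x hx ((key x).1 hc), fun x y hx hy hc hc' =>
    h3 x y hx hy ((key x).1 hc) ((key y).1 hc')⟩

lemma Cfg.exists_noCons {e : Pt} {c : ℝ} (he : e ≠ 0) (hside : ∀ p, EndP M p → crs p e ≠ c)
    (n : ℕ) :
    ∀ W : Finset Wall, Cfg M N W → Cov N W e c n → ∃ W', Cfg M N W' ∧ Cov N W' e c n ∧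
      NoCons N W' e c ∧ ∑ w ∈ W', openEnds w ≤ ∑ w ∈ W, openEnds w := by
  induction n using Nat.strong_induction_on with
  | _ n ih =>
    intro W h hcov
    by_cases hn : NoCons N W e c
    · exact ⟨W, h, hcov, hn, le_rfl⟩
    · simp only [NoCons, not_forall, not_not] at hn
      obtain ⟨o, ho, hoe, l, l', h1, h2, rfl⟩ := hn
      obtain ⟨z1, z2, h', hc', -⟩ := h.close he hoe hside h1 h2 ho
      obtain ⟨hn0, hcov'⟩ := hc' n hcov
      obtain ⟨W', hW', hC, hN, hu⟩ := ih (n - 1) (by omega) _ h' hcov'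
      refine ⟨W', hW', hC.mono (by omega), hN, hu.trans ?_⟩
      refine (sum_insert_le_add _).trans ?_
      rw [openEnds_cw, zero_add]

lemma Cfg.pt_ne (hM : PM M) {w : Wall} (hw : (w.b, w.r) ∈ M) {t : ℝ} (h0 : t ≠ 0) (h1 : t ≠ 1) :
    ¬ EndP M (w.pt t) := by
  intro hp
  have hne : w.b ≠ w.r := hM.ne _ hw _ hw
  refine hM.gp w.b w.r (w.pt t) ⟨_, hw, Or.inl rfl⟩ ⟨_, hw, Or.inr rfl⟩ hp hne
    (fun hc => h0 ?_) (fun hc => h1 ?_) ?_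
  · exact Wall.pt_inj hne (hc.symm.trans w.pt_zero.symm)
  · exact Wall.pt_inj hne (hc.symm.trans w.pt_one.symm)
  · have : w.pt t - w.b = t • w.dir := by rw [Wall.pt]; abel
    rw [this, crs_smul_right]
    change t * crs w.dir w.dir = 0
    rw [crs_self, mul_zero]

/-- Extending a wall beyond a matched point until it meets another wall. -/
lemma Cfg.exists_ray (hM : PM M) (h : Cfg M N W) (hN : ∀ p, EndP M p → ‖p‖ < N) {w : Wall}
    (hw : w ∈ W) {s0 σ : ℝ} (hs : (s0 = 0 ∧ w.A = 0 ∧ σ = -1) ∨ (s0 = 1 ∧ w.B = 1 ∧ σ = 1)) :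
    (w.b, w.r) ∈ M ∧ w.A ≤ 0 ∧ 1 ≤ w.B ∧ ∃ τ : ℝ, 0 < τ ∧
      (∀ t, 0 < t → t < τ → Free N W (w.pt (s0 + σ * t))) ∧
      ∃ k ∈ W, ∃ s, k.A < s ∧ s < k.B ∧ s ≠ 0 ∧ s ≠ 1 ∧ k.pt s = w.pt (s0 + σ * τ) ∧
        crs k.dir w.dir ≠ 0 := by
  have hlt := h.lt w hw
  have hmem : w.A ≤ s0 ∧ s0 ≤ w.B := by
    rcases hs with ⟨rfl, h1, -⟩ | ⟨rfl, h1, -⟩ <;> constructor <;> linarith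
  have h01 : s0 = 0 ∨ s0 = 1 := hs.imp (·.1) (·.1)
  obtain ⟨hE, hwM⟩ := h.endP_of_mark hw hmem.1 hmem.2 h01
  have htyp : w.A ≤ 0 ∧ 1 ≤ w.B := by
    rcases h.typ w hw with ⟨_, a, b⟩ | ⟨a, _⟩
    · exact ⟨a, b⟩
    · rcases h01 with rfl | rfl <;> linarith
  have hσ : σ ≠ 0 := by rcases hs with ⟨-, -, rfl⟩ | ⟨-, -, rfl⟩ <;> norm_num
  have hout : ∀ t, 0 < t → ¬ (w.A ≤ s0 + σ * t ∧ s0 + σ * t ≤ w.B) := by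
    rintro t ht ⟨a, b⟩
    rcases hs with ⟨rfl, h1, rfl⟩ | ⟨rfl, h1, rfl⟩ <;> linarith
  have hnE : ∀ t, 0 < t → ¬ EndP M (w.pt (s0 + σ * t)) := fun t ht =>
    pt_ne hM hwM (fun h0 => hout t ht (by rw [h0]; exact ⟨htyp.1, by linarith⟩))
      (fun h0 => hout t ht (by rw [h0]; exact ⟨by linarith, htyp.2⟩))
  refine ⟨hwM, htyp.1, htyp.2, ?_⟩
  -- a small piece is free
  have hopen : IsOpen {x : Pt | Free N (W.erase w) x} := isOpen_free _ _
  have hp : Free N (W.erase w) (w.pt s0) := ⟨hN _ hE, fun k hk hpk => (mem_erase.1 hk).1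
    (h.eq_of_endP hM hE hw (mem_erase.1 hk).2 ⟨s0, hmem, rfl⟩ hpk).symm⟩
  have hcont : Continuous fun t : ℝ => w.pt (s0 + σ * t) := w.continuous_pt.comp (by fun_prop)
  obtain ⟨δ, hδ, hball⟩ := Metric.isOpen_iff.1 (hopen.preimage hcont) 0 (by
    simpa using hp)
  have hfr : ∀ t, 0 < t → t < δ → Free N W (w.pt (s0 + σ * t)) := by
    intro t ht0 ht1
    have hf : Free N (W.erase w) (w.pt (s0 + σ * t)) := hball (by
      rw [Metric.mem_ball, dist_zero_right, Real.norm_of_nonneg ht0.le]; exact ht1)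
    refine ⟨hf.1, fun k hk hkc => ?_⟩
    by_cases hkw : k = w
    · subst hkw
      obtain ⟨s, hsI, hsE⟩ := hkc
      have := Wall.pt_inj (h.ne k hk) hsE
      exact hout t ht0 (this ▸ hsI)
    · exact hf.2 k (mem_erase.2 ⟨hkw, hk⟩) hkc
  have hpt : ∀ t, w.pt (s0 + σ * (δ / 2)) + t • (σ • w.dir) = w.pt (s0 + σ * (δ / 2 + t)) := by
    intro t
    rw [smul_smul, ← Wall.pt_add]; congr 1; ring
  have hd := Wall.dir_ne (h.ne w hw)
  have hsd : σ • w.dir ≠ 0 := smul_ne_zero hσ hd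
  obtain ⟨τ, h0, h1, h2, k', hk', h3⟩ := h.first_hit (hfr (δ / 2) (by linarith) (by linarith)) hsd
  obtain ⟨k, hk, s, ⟨ha, hb⟩, hks⟩ := h.mem_op h2 hk' h3 (Or.inr (by
    rw [hpt]; exact hnE _ (by linarith)))
  have hit : HitAt N W (w.pt (s0 + σ * (δ / 2))) (σ • w.dir) τ k s := ⟨h0, hk, ha, hb, hks.symm, h1⟩
  rw [hpt] at hks
  refine ⟨δ / 2 + τ, by linarith, ?_, k, hk, s, ha, hb, ?_, ?_, hks, ?_⟩
  · intro t t0 t1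
    by_cases htd : t < δ
    · exact hfr t t0 htd
    · have := h1 (t - δ / 2) (by linarith) (by linarith)
      rw [hpt] at this
      convert this using 4
      ring
  · rintro rfl
    exact hnE _ (by linarith) (hks ▸ (h.endP_of_mark hk ha.le hb.le (Or.inl rfl)).1)
  · rintro rfl
    exact hnE _ (by linarith) (hks ▸ (h.endP_of_mark hk ha.le hb.le (Or.inr rfl)).1)
  · have := hit.transversal (h.ne k hk)
    rw [crs_smul_right] at this
    exact right_ne_zero_of_mul this

lemma Cfg.eq_param (h : Cfg M N W) {w : Wall} (hw : w ∈ W) {s t : ℝ} (hst : w.pt s = w.pt t) :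
    s = t := Wall.pt_inj (h.ne w hw) hst

/-- `w'` extends the wall `w` beyond its open ends. -/
structure Extends (W : Finset Wall) (N : ℝ) (w w' : Wall) : Prop where
  b : w'.b = w.b
  r : w'.r = w.r
  fA : (w'.A = w.A ∧ w'.al = w.al) ∨ (w.A = 0 ∧ w'.A < 0 ∧ TJ W (w.pt w'.A) w.dir w'.al)
  fB : (w'.B = w.B ∧ w'.be = w.be) ∨ (w.B = 1 ∧ 1 < w'.B ∧ TJ W (w.pt w'.B) (-w.dir) w'.be)
  free : ∀ t, (w'.A < t ∧ t < w.A) ∨ (w.B < t ∧ t < w'.B) → Free N W (w.pt t)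

namespace Extends

variable {w w' : Wall}

lemma leA (hx : Extends W N w w') : w'.A ≤ w.A := by
  rcases hx.fA with ⟨h, -⟩ | ⟨h, h', -⟩ <;> linarith
lemma leB (hx : Extends W N w w') : w.B ≤ w'.B := by
  rcases hx.fB with ⟨h, -⟩ | ⟨h, h', -⟩ <;> linarith
lemma dir (hx : Extends W N w w') : w'.dir = w.dir := by rw [Wall.dir, Wall.dir, hx.b, hx.r]
lemma pt (hx : Extends W N w w') (s : ℝ) : w'.pt s = w.pt s := by
  rw [Wall.pt, Wall.pt, hx.b, hx.dir]
lemma cl_subset (hx : Extends W N w w') : w.cl ⊆ w'.cl := by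
  rintro _ ⟨s, ⟨h1, h2⟩, rfl⟩
  exact ⟨s, ⟨hx.leA.trans h1, h2.trans hx.leB⟩, hx.pt s⟩
lemma op_subset (hx : Extends W N w w') : w.op ⊆ w'.op := by
  rintro _ ⟨s, ⟨h1, h2⟩, rfl⟩
  exact ⟨s, ⟨hx.leA.trans_lt h1, h2.trans_le hx.leB⟩, hx.pt s⟩
lemma lab (hx : Extends W N w w') {u : Pt} {s : ℝ} (h1 : w.A < s) (h2 : s < w.B) :
    w'.lab u s = w.lab u s := by
  unfold Wall.lab
  rw [hx.dir]
  split_ifs with h3 h4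
  · rcases hx.fA with ⟨-, h⟩ | ⟨h, -⟩
    · exact h
    · linarith
  · rcases hx.fB with ⟨-, h⟩ | ⟨h, -⟩
    · exact h
    · linarith
  · rfl
  · rfl

/-- Every old wall is part of a new one. -/
lemma map (hx : Extends W N w w') {k : Wall} (hk : k ∈ W) : ∃ k' ∈ insert w' (W.erase w),
    k'.A ≤ k.A ∧ k.B ≤ k'.B ∧ k'.dir = k.dir ∧ (∀ s, k'.pt s = k.pt s) ∧
      ∀ u s, k.A < s → s < k.B → k'.lab u s = k.lab u s := by
  by_cases hkw : k = w
  · subst hkw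
    exact ⟨w', mem_insert_self _ _, hx.leA, hx.leB, hx.dir, hx.pt, fun u s => hx.lab⟩
  · exact ⟨k, mem_insert_of_mem (mem_erase.2 ⟨hkw, hk⟩), le_rfl, le_rfl, rfl, fun _ => rfl,
      fun _ _ _ _ => rfl⟩

lemma tj (hx : Extends W N w w') {p u : Pt} {g : ℤ} (h : TJ W p u g) :
    TJ (insert w' (W.erase w)) p u g := by
  obtain ⟨k, hk, s, h1, h2, h3, h4, h5, h6, h7⟩ := h
  obtain ⟨k', hk', e1, e2, e3, e4, e5⟩ := hx.map hk
  exact ⟨k', hk', s, e1.trans_lt h1, h2.trans_le e2, h3, h4, by rw [e4, h5], by rw [e3]; exact h6,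
    by rw [e5 _ _ h1 h2, h7]⟩

lemma free_iff (hx : Extends W N w w') {x : Pt} :
    Free N (insert w' (W.erase w)) x ↔ Free N W x ∧ x ∉ w'.cl := by
  rw [free_insert]
  constructor
  · rintro ⟨⟨h1, h2⟩, h3⟩
    refine ⟨⟨h1, fun k hk hxk => ?_⟩, h3⟩
    by_cases hkw : k = w
    · subst hkw; exact h3 (hx.cl_subset hxk)
    · exact h2 k (mem_erase.2 ⟨hkw, hk⟩) hxk
  · rintro ⟨⟨h1, h2⟩, h3⟩
    exact ⟨⟨h1, fun k hk => h2 k (mem_of_mem_erase hk)⟩, h3⟩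

/-- The points of the extension. -/
lemma mem_cl (h : Cfg M N W) (hx : Extends W N w w') {x : Pt} (hxc : x ∈ w'.cl) :
    x ∈ w.cl ∨ (∃ t, ((w'.A < t ∧ t < w.A) ∨ (w.B < t ∧ t < w'.B)) ∧ x = w.pt t) ∨
      ¬ EndP M x ∧ ∃ k ∈ W, x ∈ k.op := by
  obtain ⟨t, ⟨h1, h2⟩, rfl⟩ := hxc
  have key : ∀ {p u : Pt} {g : ℤ}, TJ W p u g → ¬ EndP M p ∧ ∃ k ∈ W, p ∈ k.op := by
    intro p u g ht
    refine ⟨h.not_endP_of_TJ ht, ?_⟩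
    obtain ⟨k, hk, s, a, b, -, -, c, -⟩ := ht
    exact ⟨k, hk, s, ⟨a, b⟩, c⟩
  rw [hx.pt]
  by_cases h3 : t < w.A
  · rcases h1.eq_or_lt with rfl | h1
    · rcases hx.fA with ⟨h4, -⟩ | ⟨-, -, h4⟩
      · linarith
      · exact Or.inr (Or.inr (key h4))
    · exact Or.inr (Or.inl ⟨t, Or.inl ⟨h1, h3⟩, rfl⟩)
  by_cases h4 : w.B < t
  · rcases h2.eq_or_lt with rfl | h2
    · rcases hx.fB with ⟨h5, -⟩ | ⟨-, -, h5⟩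
      · linarith
      · exact Or.inr (Or.inr (key h5))
    · exact Or.inr (Or.inl ⟨t, Or.inr ⟨h4, h2⟩, rfl⟩)
  exact Or.inl ⟨t, ⟨not_lt.1 h3, not_lt.1 h4⟩, rfl⟩

lemma cfg (hM : PM M) (h : Cfg M N W) (hw : w ∈ W) (hedge : (w.b, w.r) ∈ M) (hA0 : w.A ≤ 0)
    (hB0 : 1 ≤ w.B) (hx : Extends W N w w') : Cfg M N (insert w' (W.erase w)) where
  ne := by
    intro k hk
    rcases mem_insert.1 hk with rfl | hk
    · rw [hx.b, hx.r]; exact h.ne w hw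
    · exact h.ne k (mem_of_mem_erase hk)
  lt := by
    intro k hk
    rcases mem_insert.1 hk with rfl | hk
    · exact hx.leA.trans_lt ((h.lt w hw).trans_le hx.leB)
    · exact h.lt k (mem_of_mem_erase hk)
  al01 := by
    intro k hk
    rcases mem_insert.1 hk with rfl | hk
    · rcases hx.fA with ⟨-, h1⟩ | ⟨-, -, k', hk', s, -, -, -, -, -, -, h1⟩
      · rw [h1]; exact h.al01 w hw
      · rw [← h1]; exact Wall.lab_zero_one (h.al01 _ hk') (h.be01 _ hk') _ _
    · exact h.al01 k (mem_of_mem_erase hk)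
  be01 := by
    intro k hk
    rcases mem_insert.1 hk with rfl | hk
    · rcases hx.fB with ⟨-, h1⟩ | ⟨-, -, k', hk', s, -, -, -, -, -, -, h1⟩
      · rw [h1]; exact h.be01 w hw
      · rw [← h1]; exact Wall.lab_zero_one (h.al01 _ hk') (h.be01 _ hk') _ _
    · exact h.be01 k (mem_of_mem_erase hk)
  typ := by
    intro k hk
    rcases mem_insert.1 hk with rfl | hk
    · left; rw [hx.b, hx.r]; exact ⟨hedge, hx.leA.trans hA0, hB0.trans hx.leB⟩
    · exact h.typ k (mem_of_mem_erase hk)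
  opd := by
    have key : ∀ k ∈ W, k ≠ w → ∀ x, x ∈ w'.op → x ∉ k.op := by
      rintro k hk hkw _ ⟨t, ⟨h1, h2⟩, rfl⟩ hxk
      rw [hx.pt] at hxk
      by_cases hc : (w'.A < t ∧ t < w.A) ∨ (w.B < t ∧ t < w'.B)
      · exact (hx.free t hc).2 k hk (k.op_subset_cl hxk)
      by_cases ho : w.A < t ∧ t < w.B
      · exact hkw (h.opd k hk w hw _ hxk ⟨t, ho, rfl⟩)
      have hcl : w.pt t ∈ w.cl := ⟨t, ⟨by
        by_contra hlt; exact hc (Or.inl ⟨h1, not_le.1 hlt⟩), by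
        by_contra hlt; exact hc (Or.inr ⟨not_le.1 hlt, h2⟩)⟩, rfl⟩
      have ht : t = 0 ∨ t = 1 := by
        by_cases h3 : w.A < t
        · right
          have h4 : w.B ≤ t := by by_contra h4; exact ho ⟨h3, not_le.1 h4⟩
          rcases hx.fB with ⟨h5, -⟩ | ⟨h5, -⟩
          · linarith
          · have : t ≤ w.B := by by_contra hlt; exact hc (Or.inr ⟨not_le.1 hlt, h2⟩)
            linarith
        · left
          rcases hx.fA with ⟨h5, -⟩ | ⟨h5, -⟩
          · linarith
          · have : w.A ≤ t := by by_contra hlt; exact hc (Or.inl ⟨h1, not_le.1 hlt⟩)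
            linarith
      have hE : EndP M (w.pt t) := by
        refine ⟨_, hedge, ?_⟩
        rcases ht with rfl | rfl
        · left; exact w.pt_zero
        · right; exact w.pt_one
      exact hkw (h.eq_of_endP hM hE hk hw (k.op_subset_cl hxk) hcl)
    intro a ha k hk x hxa hxk
    rcases mem_insert.1 ha with ea | ha1 <;> rcases mem_insert.1 hk with ek | hk1
    · rw [ea, ek]
    · exact absurd hxk (key k (mem_of_mem_erase hk1) (ne_of_mem_erase hk1) x (ea ▸ hxa))
    · exact absurd hxa (key a (mem_of_mem_erase ha1) (ne_of_mem_erase ha1) x (ek ▸ hxk))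
    · exact h.opd a (mem_of_mem_erase ha1) k (mem_of_mem_erase hk1) x hxa hxk
  endA := by
    intro k hk
    rcases mem_insert.1 hk with rfl | hk
    · rw [hx.pt, hx.dir]
      rcases hx.fA with ⟨h1, h2⟩ | ⟨-, -, h1⟩
      · rw [h1, h2]; exact (h.endA w hw).imp id (Or.imp id hx.tj)
      · exact Or.inr (Or.inr (hx.tj h1))
    · exact (h.endA k (mem_of_mem_erase hk)).imp id (Or.imp id hx.tj)
  endB := by
    intro k hk
    rcases mem_insert.1 hk with rfl | hk
    · rw [hx.pt, hx.dir]
      rcases hx.fB with ⟨h1, h2⟩ | ⟨-, -, h1⟩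
      · rw [h1, h2]; exact (h.endB w hw).imp id (Or.imp id hx.tj)
      · exact Or.inr (Or.inr (hx.tj h1))
    · exact (h.endB k (mem_of_mem_erase hk)).imp id (Or.imp id hx.tj)
  mark := by
    intro p hp k hk s h1 h2 hs
    rcases mem_insert.1 hk with rfl | hk
    · have hpc : p ∈ k.cl := ⟨s, ⟨h1, h2⟩, hs⟩
      rw [hx.pt] at hs
      rcases mem_cl h hx hpc with ⟨s', h3, h4⟩ | ⟨t, ht, rfl⟩ | ⟨h3, -⟩
      · have := h.eq_param hw (hs.trans h4.symm)
        subst this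
        exact h.mark p hp w hw s h3.1 h3.2 hs
      · exact absurd (hx.free t ht) (h.not_free_endP hp)
      · exact absurd hp h3
    · exact h.mark p hp k (mem_of_mem_erase hk) s h1 h2 hs
  hasM := by
    intro a ha
    obtain ⟨k, hk, h1, h2, h3, h4⟩ := h.hasM a ha
    by_cases hkw : k = w
    · subst hkw
      exact ⟨w', mem_insert_self _ _, by rw [hx.b, h1], by rw [hx.r, h2], hx.leA.trans h3,
        h4.trans hx.leB⟩
    · exact ⟨k, mem_insert_of_mem (mem_erase.2 ⟨hkw, hk⟩), h1, h2, h3, h4⟩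
  encl := by
    intro x hxN
    obtain ⟨k, hk, h1⟩ := h.encl x hxN
    by_cases hkw : k = w
    · subst hkw; exact ⟨w', mem_insert_self _ _, hx.op_subset h1⟩
    · exact ⟨k, mem_insert_of_mem (mem_erase.2 ⟨hkw, hk⟩), h1⟩

lemma hitLab (hx : Extends W N w w') {o u : Pt} {τ s : ℝ} {k : Wall} (hh : HitAt N W o u τ k s)
    (hf : ∀ t, 0 ≤ t → t < τ → o + t • u ∉ w'.cl) :
    HitLab N (insert w' (W.erase w)) o u (k.lab (-u) s) := by
  obtain ⟨k', hk', e1, e2, e3, e4, e5⟩ := hx.map hh.mem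
  refine ⟨τ, k', s, ⟨hh.pos, hk', e1.trans_lt hh.hA, hh.hB.trans_le e2, by rw [e4, hh.eq],
    fun t t0 t1 => hx.free_iff.2 ⟨hh.free t t0 t1, hf t t0 t1⟩⟩, e5 _ _ hh.hA hh.hB⟩

end Extends

lemma sum_openEnds_lt {w w' : Wall} (hw : w ∈ W) (hne : openEnds w' < openEnds w) :
    ∑ k ∈ insert w' (W.erase w), openEnds k < ∑ k ∈ W, openEnds k := by
  refine (sum_insert_le_add w').trans_lt ?_
  rw [← add_sum_erase W openEnds hw]
  omega

lemma crs_seg {e x y : Pt} {c : ℝ} (hx : crs x e = c) (hy : crs y e = c) (t : ℝ) :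
    crs (x + t • (y - x)) e = c := by
  rw [crs_add_left, crs_smul_left, crs_sub_left, hx, hy]; ring

lemma crs_of_line {e x y z : Pt} {c : ℝ} (he : e ≠ 0) (hx : crs x e = c) (hy : crs y e = c)
    (hz : crs z e = c) : crs (y - x) (z - y) = 0 := by
  obtain ⟨r, rfl⟩ := exists_eq_add_smul he (hx.trans hy.symm)
  obtain ⟨s, rfl⟩ := exists_eq_add_smul he (hy.trans hz.symm)
  rw [add_sub_cancel_left, add_sub_cancel_left, crs_smul_left, crs_smul_right, crs_self]; ring

lemma comb_pos {t r r' : ℝ} (t0 : 0 ≤ t) (t1 : t ≤ 1) (hr : 0 < r) (hr' : 0 < r') :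
    0 < (1 - t) * r + t * r' := by
  rcases t0.eq_or_lt with rfl | t0
  · simpa using hr
  · have := mul_nonneg (sub_nonneg.2 t1) hr.le
    have := mul_pos t0 hr'
    linarith

namespace Extends

variable {w w' : Wall}

/-- Cutting the line at one further point costs one colour. -/
lemma cov_succ (hx : Extends W N w w') {e q : Pt} {c : ℝ} (he : e ≠ 0) (hqe : crs q e = c)
    (hJ : ∀ x, Free N W x → crs x e = c → x ∈ w'.cl → x = q) (hqw : q ∈ w'.cl) {n : ℕ}
    (hcov : Cov N W e c n) : Cov N (insert w' (W.erase w)) e c (n + 1) := by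
  obtain ⟨f, S, hS, h1, h2⟩ := hcov
  have hfresh : S.sup id + 1 ∉ S := fun hm => by
    have : S.sup id + 1 ≤ S.sup id := le_sup (f := id) hm
    omega
  set F := S.sup id + 1
  refine ⟨fun x => if Vis N W q x ∧ ∃ r : ℝ, 0 < r ∧ x = q + r • e then F else f x, insert F S,
    (card_insert_le _ _).trans (by omega), ?_, ?_⟩
  · intro x hxf hxe
    dsimp only
    split_ifs
    · exact mem_insert_self _ _
    · exact mem_insert_of_mem (h1 x (hx.free_iff.1 hxf).1 hxe)
  · intro x y hxf hyf hxe hye hxy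
    obtain ⟨hxf, hxw⟩ := hx.free_iff.1 hxf
    obtain ⟨hyf, hyw⟩ := hx.free_iff.1 hyf
    dsimp only at hxy
    have hline := fun t => crs_seg hxe hye t
    split_ifs at hxy with hx1 hy1 hy1
    · obtain ⟨hx1, r, hr, hxr⟩ := hx1
      obtain ⟨hy1, r', hr', hyr⟩ := hy1
      have hv := hx1.symm.trans_of_collinear (crs_of_line he hxe hqe hye) hy1
      intro t t0 t1
      refine hx.free_iff.2 ⟨hv t t0 t1, fun hc => ?_⟩
      have hq := hJ _ (hv t t0 t1) (hline t) hc
      have : ((1 - t) * r + t * r') • e = 0 := by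
        rw [hxr, hyr] at hq
        have h3 : q + r • e + t • (q + r' • e - (q + r • e)) = q + ((1 - t) * r + t * r') • e := by
          module
        rwa [h3, add_eq_left] at hq
      have h4 := (smul_eq_zero.1 this).resolve_right he
      exact (comb_pos t0 t1 hr hr').ne' h4
    · exact absurd (hxy ▸ h1 y hyf hye) hfresh
    · exact absurd (hxy.symm ▸ h1 x hxf hxe) hfresh
    · have hv := h2 x y hxf hyf hxe hye hxy
      intro t t0 t1
      refine hx.free_iff.2 ⟨hv t t0 t1, fun hc => ?_⟩
      have hq := hJ _ (hv t t0 t1) (hline t) hc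
      have v1 : Vis N W q x := by rw [← hq]; exact (hv.sub t0 t1).symm
      have v2 : Vis N W q y := by
        have := hv.symm.sub (t := 1 - t) (by linarith) (by linarith)
        have h3 : y + (1 - t) • (x - y) = q := by rw [← hq]; module
        rw [h3] at this
        exact this.symm
      obtain ⟨r, hr⟩ := exists_eq_add_smul he (hqe.trans hxe.symm)
      obtain ⟨r', hr'⟩ := exists_eq_add_smul he (hqe.trans hye.symm)
      have hr0 : ¬ 0 < r := fun h0 => hx1 ⟨v1, r, h0, hr⟩
      have hr0' : ¬ 0 < r' := fun h0 => hy1 ⟨v2, r', h0, hr'⟩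
      have hrn : r ≠ 0 := by rintro rfl; apply hxw; rw [hr]; simpa using hqw
      have hrn' : r' ≠ 0 := by rintro rfl; apply hyw; rw [hr']; simpa using hqw
      have : ((1 - t) * r + t * r') • e = 0 := by
        rw [hr, hr'] at hq
        have h3 : q + r • e + t • (q + r' • e - (q + r • e)) = q + ((1 - t) * r + t * r') • e := by
          module
        rwa [h3, add_eq_left] at hq
      have h4 := (smul_eq_zero.1 this).resolve_right he
      have h5 : r < 0 := lt_of_le_of_ne (not_lt.1 hr0) hrn
      have h6 : r' < 0 := lt_of_le_of_ne (not_lt.1 hr0') hrn'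
      have := comb_pos t0 t1 (neg_pos.2 h5) (neg_pos.2 h6)
      linarith

lemma cov_of_disjoint (hx : Extends W N w w') {e : Pt} {c : ℝ}
    (hJ : ∀ x, Free N W x → crs x e = c → x ∉ w'.cl) {n : ℕ}
    (hcov : Cov N W e c n) : Cov N (insert w' (W.erase w)) e c n := by
  obtain ⟨f, S, hS, h1, h2⟩ := hcov
  refine ⟨f, S, hS, fun x hxf => h1 x (hx.free_iff.1 hxf).1, fun x y hxf hyf hxe hye hxy => ?_⟩
  have hv := h2 x y (hx.free_iff.1 hxf).1 (hx.free_iff.1 hyf).1 hxe hye hxy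
  exact fun t t0 t1 => hx.free_iff.2 ⟨hv t t0 t1, hJ _ (hv t t0 t1) (crs_seg hxe hye t)⟩

lemma close_at (h' : Cfg M N (insert w' (W.erase w))) (hx : Extends W N w w')
    {e q : Pt} {c : ℝ} (he : e ≠ 0) (hside : ∀ p, EndP M p → crs p e ≠ c) (hqe : crs q e = c)
    (hJ : ∀ x, Free N W x → crs x e = c → x ∈ w'.cl → x = q) {g : ℤ} {s : ℝ} (hqs : q = w'.pt s)
    (hsA : w'.A < s) (hsB : s < w'.B) (hg : ∀ u, w'.lab u s = g)
    (hlab : HitLab N W q e g) {n : ℕ} (hcov : Cov N W e c n) :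
    ∃ z1 z2, Cfg M N (insert (cw z1 z2 g) (insert w' (W.erase w))) ∧
      Cov N (insert (cw z1 z2 g) (insert w' (W.erase w))) e c n := by
  have hqw : q ∈ w'.cl := ⟨s, ⟨hsA.le, hsB.le⟩, hqs.symm⟩
  obtain ⟨τ, k, s1, H, L⟩ := hlab
  have p0 := H.pos
  set o := q + (τ / 2) • e with ho
  have hoe : crs o e = c := by rw [ho, crs_line, hqe]
  have hpt : ∀ t : ℝ, o + t • e = q + (τ / 2 + t) • e := fun t => by rw [ho]; module
  have hpt' : ∀ t : ℝ, o + t • -e = q + (τ / 2 - t) • e := fun t => by rw [ho]; module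
  have hne : ∀ t : ℝ, 0 < t → t < τ → q + t • e ∉ w'.cl := fun t t0 t1 hc => by
    have := hJ _ (H.free t t0.le t1) (by rw [crs_line, hqe]) hc
    rw [add_eq_left] at this
    exact smul_ne_zero t0.ne' he this
  have hof : Free N W o := H.free _ (by linarith) (by linarith)
  have a1 : HitLab N (insert w' (W.erase w)) o e g := by
    have H' : HitAt N W o e (τ / 2) k s1 := ⟨by linarith, H.mem, H.hA, H.hB, by
      rw [hpt, ← H.eq]; congr 2; ring, fun t t0 t1 => by
      rw [hpt]; exact H.free _ (by linarith) (by linarith)⟩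
    have := hx.hitLab H' fun t t0 t1 => by rw [hpt]; exact hne _ (by linarith) (by linarith)
    rwa [L] at this
  have a2 : HitLab N (insert w' (W.erase w)) o (-e) g :=
    ⟨τ / 2, w', s, ⟨by linarith, mem_insert_self _ _, hsA, hsB, by
      rw [hpt', sub_self, zero_smul, add_zero, hqs], fun t t0 t1 => by
      rw [hpt']
      exact hx.free_iff.2 ⟨H.free _ (by linarith) (by linarith), hne _ (by linarith)
        (by linarith)⟩⟩,
      hg _⟩
  obtain ⟨z1, z2, b1, b2, -⟩ := h'.close he hoe hside a1 a2
    (hx.free_iff.2 ⟨hof, hne _ (by linarith) (by linarith)⟩)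
  exact ⟨z1, z2, b1, (b2 _ (hx.cov_succ he hqe hJ hqw hcov)).2⟩

lemma exists_close (h : Cfg M N W) (h' : Cfg M N (insert w' (W.erase w))) (hx : Extends W N w w')
    {e : Pt} {c : ℝ} (he : e ≠ 0) (hside : ∀ p, EndP M p → crs p e ≠ c) (hnc : NoCons N W e c)
    {n : ℕ} (hcov : Cov N W e c n) {s0 σ τ : ℝ} {g : ℤ} (hg : g = 0 ∨ g = 1)
    (hs0 : EndP M (w.pt s0))
    (hJ : ∀ x, Free N W x → x ∈ w'.cl → ∃ t, 0 < t ∧ t < τ ∧ x = w.pt (s0 + σ * t))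
    (hI : ∀ t, 0 < t → t < τ → w'.A < s0 + σ * t ∧ s0 + σ * t < w'.B ∧
      Free N W (w.pt (s0 + σ * t)) ∧ ∀ u, w'.lab u (s0 + σ * t) = g) :
    ∃ W'', Cfg M N W'' ∧ Cov N W'' e c n ∧
      ∑ k ∈ W'', openEnds k ≤ ∑ k ∈ insert w' (W.erase w), openEnds k := by
  by_cases hq : ∃ t, 0 < t ∧ t < τ ∧ crs (w.pt (s0 + σ * t)) e = c
  · obtain ⟨t, t0, t1, hqe⟩ := hq
    obtain ⟨i1, i2, i3, i4⟩ := hI t t0 t1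
    have hd : ∀ r, crs (w.pt (s0 + σ * r)) e = crs (w.pt s0) e + r * (σ * crs w.dir e) := by
      intro r
      rw [Wall.pt_add, crs_add_left, crs_smul_left]; ring
    have hne : σ * crs w.dir e ≠ 0 := by
      intro h0
      rw [hd, h0, mul_zero, add_zero] at hqe
      exact hside _ hs0 hqe
    have huniq : ∀ x, Free N W x → crs x e = c → x ∈ w'.cl → x = w.pt (s0 + σ * t) := by
      intro x hxf hxe hxc
      obtain ⟨r, -, -, rfl⟩ := hJ x hxf hxc
      have : r * (σ * crs w.dir e) = t * (σ * crs w.dir e) := by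
        have h1 := hd r; have h2 := hd t; linarith
      rw [mul_right_cancel₀ hne this]
    have hnE : ∀ u : Pt, crs u e = 0 → ∀ r : ℝ, ¬ EndP M (w.pt (s0 + σ * t) + r • u) := by
      intro u hu r hE
      refine hside _ hE ?_
      rw [crs_add_left, crs_smul_left, hu, mul_zero, add_zero, hqe]
    obtain ⟨τ1, k1, s1, H1⟩ := h.exists_hit i3 he (Or.inr (hnE e (crs_self e)))
    obtain ⟨τ2, k2, s2, H2⟩ := h.exists_hit i3 (neg_ne_zero.2 he) (Or.inr (hnE (-e) (by
      rw [crs_neg_left, crs_self, neg_zero])))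
    have l1 := Wall.lab_zero_one (h.al01 _ H1.mem) (h.be01 _ H1.mem) (-e) s1
    have l2 := Wall.lab_zero_one (h.al01 _ H2.mem) (h.be01 _ H2.mem) (- -e) s2
    have hl := hnc _ i3 hqe _ _ ⟨τ1, k1, s1, H1, rfl⟩ ⟨τ2, k2, s2, H2, rfl⟩
    have hcase : k1.lab (-e) s1 = g ∨ k2.lab (- -e) s2 = g := by omega
    rcases hcase with hc | hc
    · obtain ⟨z1, z2, c1, c2⟩ := close_at h' hx he hside hqe huniq (hx.pt _).symm i1 i2 i4
        ⟨τ1, k1, s1, H1, hc⟩ hcov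
      refine ⟨_, c1, c2, (sum_insert_le_add _).trans ?_⟩
      rw [openEnds_cw, zero_add]
    · have key : ∀ x : Pt, crs x (-e) = -c ↔ crs x e = c := fun x => by
        rw [crs_neg_right, neg_inj]
      obtain ⟨z1, z2, c1, c2⟩ := close_at h' hx (neg_ne_zero.2 he) (c := -c)
        (fun p hp hc' => hside p hp ((key p).1 hc')) ((key _).2 hqe)
        (fun x hxf hxe => huniq x hxf ((key x).1 hxe)) (hx.pt _).symm i1 i2 i4
        ⟨τ2, k2, s2, H2, hc⟩ hcov.neg
      refine ⟨_, c1, by simpa using c2.neg, (sum_insert_le_add _).trans ?_⟩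
      rw [openEnds_cw, zero_add]
  · refine ⟨_, h', hx.cov_of_disjoint (fun x hxf hxe hxc => ?_) hcov, le_rfl⟩
    obtain ⟨t, t0, t1, rfl⟩ := hJ x hxf hxc
    exact hq ⟨t, t0, t1, hxe⟩

end Extends

lemma Cfg.extend_step (hM : PM M) (h : Cfg M N W) (hN : ∀ p, EndP M p → ‖p‖ < N) {e : Pt} {c : ℝ}
    (he : e ≠ 0) (hside : ∀ p, EndP M p → crs p e ≠ c) (hnc : NoCons N W e c)
    {n : ℕ} (hcov : Cov N W e c n) (hfull : ¬ Full W) :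
    ∃ W'', Cfg M N W'' ∧ Cov N W'' e c n ∧ ∑ k ∈ W'', openEnds k < ∑ k ∈ W, openEnds k := by
  simp only [Full, not_forall] at hfull
  obtain ⟨w, hw, hopen⟩ := hfull
  have hlt := h.lt w hw
  by_cases hA : w.A = 0
  · obtain ⟨hedge, hA0, hB0, τ, hτ, hfr, k, hk, s, k1, k2, k3, k4, k5, k6⟩ :=
      h.exists_ray hM hN hw (s0 := 0) (σ := -1) (Or.inl ⟨rfl, hA, rfl⟩)
    have hpr : ∀ t : ℝ, 0 + -1 * t = -t := fun t => by ring
    simp only [hpr] at hfr k5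
    set w' : Wall := ⟨w.b, w.r, -τ, w.B, k.lab w.dir s, w.be⟩ with hw'
    have hx : Extends W N w w' := ⟨rfl, rfl, Or.inr ⟨hA, by simp only [hw']; linarith,
      k, hk, s, k1, k2, k3, k4, k5, k6, rfl⟩, Or.inl ⟨rfl, rfl⟩, by
        rintro t (⟨t0, t1⟩ | ⟨t0, t1⟩)
        · have := hfr (-t) (by linarith) (by simp only [hw'] at t0; linarith)
          rwa [neg_neg] at this
        · simp only [hw'] at t1; linarith⟩
    have h' := hx.cfg hM h hw hedge hA0 hB0
    have hJ : ∀ x, Free N W x → x ∈ w'.cl → ∃ t, 0 < t ∧ t < τ ∧ x = w.pt (0 + -1 * t) := by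
      intro x hxf hxc
      rcases hx.mem_cl h hxc with h1 | ⟨t, ht, rfl⟩ | ⟨-, k', hk', h1⟩
      · exact absurd h1 (hxf.2 w hw)
      · rcases ht with ⟨t0, t1⟩ | ⟨t0, t1⟩
        · refine ⟨-t, by linarith, by simp only [hw'] at t0; linarith, ?_⟩
          congr 1; ring
        · simp only [hw'] at t1; linarith
      · exact absurd (k'.op_subset_cl h1) (hxf.2 k' hk')
    have hI : ∀ t, 0 < t → t < τ → w'.A < 0 + -1 * t ∧ 0 + -1 * t < w'.B ∧
        Free N W (w.pt (0 + -1 * t)) ∧ ∀ u, w'.lab u (0 + -1 * t) = k.lab w.dir s := by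
      intro t t0 t1
      rw [hpr]
      refine ⟨by simp only [hw']; linarith, by simp only [hw']; linarith, hfr t t0 t1, fun u => ?_⟩
      simp only [Wall.lab, hw']
      rw [if_pos (by linarith)]
    obtain ⟨W'', c1, c2, c3⟩ := hx.exists_close h h' he hside hnc hcov (s0 := 0) (σ := -1) (τ := τ)
      (g := k.lab w.dir s) (Wall.lab_zero_one (h.al01 _ hk) (h.be01 _ hk) _ _)
      ⟨_, hedge, Or.inl w.pt_zero⟩ hJ hI
    refine ⟨W'', c1, c2, c3.trans_lt (sum_openEnds_lt hw ?_)⟩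
    have : -τ ≠ 0 := by linarith
    simp only [openEnds, hw', hA, this, if_true, if_false]
    omega
  · have hB : w.B = 1 := by
      by_contra hB; exact hopen ⟨hA, hB⟩
    obtain ⟨hedge, hA0, hB0, τ, hτ, hfr, k, hk, s, k1, k2, k3, k4, k5, k6⟩ :=
      h.exists_ray hM hN hw (s0 := 1) (σ := 1) (Or.inr ⟨rfl, hB, rfl⟩)
    have hpr : ∀ t : ℝ, 1 + 1 * t = 1 + t := fun t => by ring
    simp only [hpr] at hfr k5
    set w' : Wall := ⟨w.b, w.r, w.A, 1 + τ, w.al, k.lab (-w.dir) s⟩ with hw'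
    have hx : Extends W N w w' := ⟨rfl, rfl, Or.inl ⟨rfl, rfl⟩, Or.inr ⟨hB, by
      simp only [hw']; linarith, k, hk, s, k1, k2, k3, k4, k5, by
        rw [crs_neg_right]; exact neg_ne_zero.2 k6, rfl⟩, by
        rintro t (⟨t0, t1⟩ | ⟨t0, t1⟩)
        · simp only [hw'] at t0; linarith
        · have := hfr (t - 1) (by linarith) (by simp only [hw'] at t1; linarith)
          rwa [add_sub_cancel] at this⟩
    have h' := hx.cfg hM h hw hedge hA0 hB0
    have hJ : ∀ x, Free N W x → x ∈ w'.cl → ∃ t, 0 < t ∧ t < τ ∧ x = w.pt (1 + 1 * t) := by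
      intro x hxf hxc
      rcases hx.mem_cl h hxc with h1 | ⟨t, ht, rfl⟩ | ⟨-, k', hk', h1⟩
      · exact absurd h1 (hxf.2 w hw)
      · rcases ht with ⟨t0, t1⟩ | ⟨t0, t1⟩
        · simp only [hw'] at t0; linarith
        · refine ⟨t - 1, by linarith, by simp only [hw'] at t1; linarith, ?_⟩
          congr 1; ring
      · exact absurd (k'.op_subset_cl h1) (hxf.2 k' hk')
    have hI : ∀ t, 0 < t → t < τ → w'.A < 1 + 1 * t ∧ 1 + 1 * t < w'.B ∧
        Free N W (w.pt (1 + 1 * t)) ∧ ∀ u, w'.lab u (1 + 1 * t) = k.lab (-w.dir) s := by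
      intro t t0 t1
      rw [hpr]
      refine ⟨by simp only [hw']; linarith, by simp only [hw']; linarith, hfr t t0 t1, fun u => ?_⟩
      simp only [Wall.lab, hw']
      rw [if_neg (by linarith), if_pos (by linarith)]
    obtain ⟨W'', c1, c2, c3⟩ := hx.exists_close h h' he hside hnc hcov (s0 := 1) (σ := 1) (τ := τ)
      (g := k.lab (-w.dir) s) (Wall.lab_zero_one (h.al01 _ hk) (h.be01 _ hk) _ _)
      ⟨_, hedge, Or.inr w.pt_one⟩ hJ hI
    refine ⟨W'', c1, c2, c3.trans_lt (sum_openEnds_lt hw ?_)⟩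
    have : 1 + τ ≠ 1 := by linarith
    simp only [openEnds, hw', hB, this, if_true, if_false]
    omega

/-- All walls can be extended without increasing the number of colours. -/
lemma Cfg.exists_full (hM : PM M) (hN : ∀ p, EndP M p → ‖p‖ < N) {e : Pt} {c : ℝ}
    (he : e ≠ 0) (hside : ∀ p, EndP M p → crs p e ≠ c) {n : ℕ} (m : ℕ) :
    ∀ W : Finset Wall, ∑ k ∈ W, openEnds k = m → Cfg M N W → Cov N W e c n →
      ∃ W', Cfg M N W' ∧ Cov N W' e c n ∧ Full W' := by
  induction m using Nat.strong_induction_on with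
  | _ m ih =>
    intro W hm h hcov
    obtain ⟨W1, h1, hcov1, hnc, hle⟩ := Cfg.exists_noCons he hside n W h hcov
    by_cases hf : Full W1
    · exact ⟨W1, h1, hcov1, hf⟩
    · obtain ⟨W2, h2, hcov2, hlt⟩ := h1.extend_step hM hN he hside hnc hcov1 hf
      exact ih _ (by omega) W2 rfl h2 hcov2

lemma TJ_of_mem_op {z1 z2 x u : Pt} {g : ℤ} (hw : cw z1 z2 g ∈ W) (hx : x ∈ (cw z1 z2 g).op)
    (hu : crs (z2 - z1) u ≠ 0) : TJ W x u g := by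
  obtain ⟨s, ⟨h1, h2⟩, rfl⟩ := hx
  have hs : s < 0 := by simp only [cw] at h2; linarith
  exact ⟨_, hw, s, h1, h2, hs.ne, by linarith, rfl, by rwa [cw_dir], cw_lab _ _ _ _ hs⟩

/-- The four sides of the bounding box, arranged as a pinwheel. -/
noncomputable def boxWalls (N : ℝ) (g : ℤ) : Finset Wall :=
  {cw (-N, N) (N + 1, N) g, cw (N, N) (N, -N - 1) g, cw (N, -N) (-N - 1, -N) g,
    cw (-N, -N) (-N, N + 1) g}

lemma mem_horiz_op {p q y : ℝ} {g : ℤ} (hpq : p < q) {x : Pt} :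
    x ∈ (cw (p, y) (q, y) g).op ↔ x.2 = y ∧ p < x.1 ∧ x.1 < q := by
  rw [mem_cw_op]
  have hd : 0 < q - p := by linarith
  constructor
  · rintro ⟨t, t0, t1, rfl⟩
    simp only [Prod.mk_sub_mk, Prod.smul_mk, Prod.mk_add_mk, smul_eq_mul]
    refine ⟨by ring, ?_, ?_⟩ <;> nlinarith
  · rintro ⟨h1, h2, h3⟩
    refine ⟨(x.1 - p) / (q - p), div_pos (by linarith) hd, (div_lt_one hd).2 (by linarith), ?_⟩
    ext
    · simp; field_simp; ring
    · simp [h1]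

lemma mem_vert_op {p q y : ℝ} {g : ℤ} (hpq : p < q) {x : Pt} :
    x ∈ (cw (y, p) (y, q) g).op ↔ x.1 = y ∧ p < x.2 ∧ x.2 < q := by
  rw [mem_cw_op]
  have hd : 0 < q - p := by linarith
  constructor
  · rintro ⟨t, t0, t1, rfl⟩
    simp only [Prod.mk_sub_mk, Prod.smul_mk, Prod.mk_add_mk, smul_eq_mul]
    refine ⟨by ring, ?_, ?_⟩ <;> nlinarith
  · rintro ⟨h1, h2, h3⟩
    refine ⟨(x.2 - p) / (q - p), div_pos (by linarith) hd, (div_lt_one hd).2 (by linarith), ?_⟩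
    ext
    · simp [h1]
    · simp; field_simp; ring

lemma cw_op_comm {z1 z2 x : Pt} {g : ℤ} : x ∈ (cw z1 z2 g).op ↔ x ∈ (cw z2 z1 g).op := by
  simp only [mem_cw_op]
  constructor <;> rintro ⟨t, t0, t1, rfl⟩ <;>
    exact ⟨1 - t, by linarith, by linarith, by module⟩

lemma box_cases {g : ℤ} {w : Wall} (hN : 0 < N) (hw : w ∈ boxWalls N g) : ∃ z1 z2, w = cw z1 z2 g ∧
    z1 ≠ z2 ∧ (∀ x ∈ w.cl, N ≤ ‖x‖) ∧ TJ (boxWalls N g) z1 (z2 - z1) g ∧ N < ‖z2‖ := by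
  have hn1 : ∀ x : Pt, |x.1| ≤ ‖x‖ := fun x => norm_fst_le x
  have hn2 : ∀ x : Pt, |x.2| ≤ ‖x‖ := fun x => norm_snd_le x
  have b1 : cw (-N, N) (N + 1, N) g ∈ boxWalls N g := by simp [boxWalls]
  have b2 : cw (N, N) (N, -N - 1) g ∈ boxWalls N g := by simp [boxWalls]
  have b3 : cw (N, -N) (-N - 1, -N) g ∈ boxWalls N g := by simp [boxWalls]
  have b4 : cw (-N, -N) (-N, N + 1) g ∈ boxWalls N g := by simp [boxWalls]
  simp only [boxWalls, mem_insert, mem_singleton] at hw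
  rcases hw with rfl | rfl | rfl | rfl
  · refine ⟨_, _, rfl, ?_, ?_, TJ_of_mem_op b4 ?_ ?_, ?_⟩
    · intro h; have := congrArg Prod.fst h; simp only at this; linarith
    · intro x hx
      obtain ⟨t, -, -, rfl⟩ := mem_cw_cl.1 hx
      refine le_trans ?_ (hn2 _)
      simp [le_abs_self]
    · rw [mem_vert_op (by linarith)]; simp only [true_and]; constructor <;> linarith
    · simp only [crs, Prod.mk_sub_mk]; nlinarith
    · refine lt_of_lt_of_le ?_ (hn1 _)
      exact lt_of_lt_of_le (by linarith) (le_abs_self _)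
  · refine ⟨_, _, rfl, ?_, ?_, TJ_of_mem_op b1 ?_ ?_, ?_⟩
    · intro h; have := congrArg Prod.snd h; simp only at this; linarith
    · intro x hx
      obtain ⟨t, -, -, rfl⟩ := mem_cw_cl.1 hx
      refine le_trans ?_ (hn1 _)
      simp [le_abs_self]
    · rw [mem_horiz_op (by linarith)]; simp only [true_and]; constructor <;> linarith
    · simp only [crs, Prod.mk_sub_mk]; nlinarith
    · refine lt_of_lt_of_le ?_ (hn2 _)
      exact lt_of_lt_of_le (by simp only; linarith) (neg_le_abs _)
  · refine ⟨_, _, rfl, ?_, ?_, TJ_of_mem_op b2 ?_ ?_, ?_⟩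
    · intro h; have := congrArg Prod.fst h; simp only at this; linarith
    · intro x hx
      obtain ⟨t, -, -, rfl⟩ := mem_cw_cl.1 hx
      refine le_trans ?_ (hn2 _)
      simp [le_abs_self]
    · rw [cw_op_comm, mem_vert_op (by linarith)]; simp only [true_and]; constructor <;> linarith
    · simp only [crs, Prod.mk_sub_mk]; nlinarith
    · refine lt_of_lt_of_le ?_ (hn1 _)
      exact lt_of_lt_of_le (by simp only; linarith) (neg_le_abs _)
  · refine ⟨_, _, rfl, ?_, ?_, TJ_of_mem_op b3 ?_ ?_, ?_⟩
    · intro h; have := congrArg Prod.snd h; simp only at this; linarith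
    · intro x hx
      obtain ⟨t, -, -, rfl⟩ := mem_cw_cl.1 hx
      refine le_trans ?_ (hn1 _)
      simp [le_abs_self]
    · rw [cw_op_comm, mem_horiz_op (by linarith)]; simp only [true_and]; constructor <;> linarith
    · simp only [crs, Prod.mk_sub_mk]; nlinarith
    · refine lt_of_lt_of_le ?_ (hn2 _)
      exact lt_of_lt_of_le (by linarith) (le_abs_self _)

lemma mem_box_op {g : ℤ} (hN : 0 < N) {x : Pt} :
    (x ∈ (cw (-N, N) (N + 1, N) g).op ↔ x.2 = N ∧ -N < x.1 ∧ x.1 < N + 1) ∧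
    (x ∈ (cw (N, N) (N, -N - 1) g).op ↔ x.1 = N ∧ -N - 1 < x.2 ∧ x.2 < N) ∧
    (x ∈ (cw (N, -N) (-N - 1, -N) g).op ↔ x.2 = -N ∧ -N - 1 < x.1 ∧ x.1 < N) ∧
    (x ∈ (cw (-N, -N) (-N, N + 1) g).op ↔ x.1 = -N ∧ -N < x.2 ∧ x.2 < N + 1) :=
  ⟨mem_horiz_op (by linarith), by rw [cw_op_comm]; exact mem_vert_op (by linarith),
    by rw [cw_op_comm]; exact mem_horiz_op (by linarith), mem_vert_op (by linarith)⟩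

lemma box_disjoint {g : ℤ} {w k : Wall} (hN : 0 < N) (hw : w ∈ boxWalls N g)
    (hk : k ∈ boxWalls N g) {x : Pt}
    (hxw : x ∈ w.op) (hxk : x ∈ k.op) : w = k := by
  obtain ⟨h1, h2, h3, h4⟩ := mem_box_op (g := g) hN (x := x)
  simp only [boxWalls, mem_insert, mem_singleton] at hw hk
  rcases hw with rfl | rfl | rfl | rfl <;> rcases hk with rfl | rfl | rfl | rfl <;>
    first
    | rfl
    | (exfalso
       simp only [h1, h2, h3, h4] at hxw hxk
       obtain ⟨p1, p2, p3⟩ := hxw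
       obtain ⟨q1, q2, q3⟩ := hxk
       linarith)

lemma box_encl {g : ℤ} (hN : 0 < N) {x : Pt} (hx : ‖x‖ = N) : ∃ w ∈ boxWalls N g, x ∈ w.op := by
  obtain ⟨h1, h2, h3, h4⟩ := mem_box_op (g := g) hN (x := x)
  simp only [boxWalls, mem_insert, mem_singleton, exists_eq_or_imp, exists_eq_left, h1, h2, h3, h4]
  have a1 := abs_le.1 ((norm_fst_le x).trans hx.le)
  have a2 := abs_le.1 ((norm_snd_le x).trans hx.le)
  have hm : |x.1| = N ∨ |x.2| = N := by
    rw [Prod.norm_def, Real.norm_eq_abs, Real.norm_eq_abs] at hx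
    rcases max_choice |x.1| |x.2| with h | h
    · left; rw [← h, hx]
    · right; rw [← h, hx]
  have c1 : x.1 = N ∨ x.1 = -N ∨ x.2 = N ∨ x.2 = -N := by
    rcases hm with h | h
    · rcases (abs_eq hN.le).1 h with h | h <;> simp [h]
    · rcases (abs_eq hN.le).1 h with h | h <;> simp [h]
  rcases lt_or_eq_of_le a2.2 with d1 | d1
  · rcases lt_or_eq_of_le a2.1 with d2 | d2
    · rcases c1 with c | c | c | c
      · right; left; exact ⟨c, by linarith, d1⟩
      · right; right; right; exact ⟨c, d2, by linarith⟩
      · linarith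
      · linarith
    · rcases lt_or_eq_of_le a1.2 with d3 | d3
      · right; right; left; exact ⟨d2.symm, by linarith, d3⟩
      · right; left; exact ⟨d3, by linarith, d1⟩
  · rcases lt_or_eq_of_le a1.1 with d3 | d3
    · left; exact ⟨d1, d3, by linarith⟩
    · right; right; right; exact ⟨d3.symm, by linarith, by linarith⟩

/-- The wall of an edge. -/
def ew (a : Pt × Pt) : Wall := ⟨a.1, a.2, 0, 1, 0, 0⟩

lemma ew_cl (a : Pt × Pt) : (ew a).cl = segment ℝ a.1 a.2 := by
  rw [segment_eq_image']; rfl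

/-- The initial walls: the edges and the box. -/
noncomputable def W0 (M : Finset (Pt × Pt)) (N : ℝ) (g : ℤ) : Finset Wall :=
  M.image ew ∪ boxWalls N g

lemma norm_lt_of_mem_segment {p q x : Pt} (hp : ‖p‖ < N) (hq : ‖q‖ < N) (hx : x ∈ segment ℝ p q) :
    ‖x‖ < N := by
  have := (convex_ball (0 : Pt) N).segment_subset (mem_ball_zero_iff.2 hp) (mem_ball_zero_iff.2 hq)
    hx
  exact mem_ball_zero_iff.1 this

lemma cfg_W0 (hM : PM M) (hN0 : 0 < N) (hN : ∀ p, EndP M p → ‖p‖ < N) {g : ℤ} (hg : g = 0 ∨ g = 1) :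
    Cfg M N (W0 M N g) := by
  have hedge : ∀ a ∈ M, ∀ x ∈ (ew a).cl, ‖x‖ < N := fun a ha x hx =>
    norm_lt_of_mem_segment (hN _ ⟨a, ha, Or.inl rfl⟩) (hN _ ⟨a, ha, Or.inr rfl⟩) (ew_cl a ▸ hx)
  have hcase : ∀ w ∈ W0 M N g, (∃ a ∈ M, w = ew a) ∨ w ∈ boxWalls N g := by
    intro w hw
    rcases mem_union.1 hw with h | h
    · obtain ⟨a, ha, rfl⟩ := mem_image.1 h; exact Or.inl ⟨a, ha, rfl⟩
    · exact Or.inr h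
  have hsub : boxWalls N g ⊆ W0 M N g := subset_union_right
  constructor
  · intro w hw
    rcases hcase w hw with ⟨a, ha, rfl⟩ | hw
    · exact hM.ne a ha a ha
    · obtain ⟨z1, z2, rfl, hz, -⟩ := box_cases hN0 hw
      intro h0
      have : (cw z1 z2 g).dir = 0 := by rw [Wall.dir, h0, sub_self]
      rw [cw_dir, sub_eq_zero] at this
      exact hz this.symm
  · intro w hw
    rcases hcase w hw with ⟨a, ha, rfl⟩ | hw
    · simp [ew]
    · obtain ⟨z1, z2, rfl, -⟩ := box_cases hN0 hw
      simp [cw]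
  · intro w hw
    rcases hcase w hw with ⟨a, ha, rfl⟩ | hw
    · simp [ew]
    · obtain ⟨z1, z2, rfl, -⟩ := box_cases hN0 hw
      exact hg
  · intro w hw
    rcases hcase w hw with ⟨a, ha, rfl⟩ | hw
    · simp [ew]
    · obtain ⟨z1, z2, rfl, -⟩ := box_cases hN0 hw
      exact hg
  · intro w hw
    rcases hcase w hw with ⟨a, ha, rfl⟩ | hw
    · left; exact ⟨ha, le_rfl, le_rfl⟩
    · obtain ⟨z1, z2, rfl, -⟩ := box_cases hN0 hw
      right; simp [cw]
  · intro w hw k hk x hxw hxk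
    rcases hcase w hw with ⟨a, ha, rfl⟩ | hw <;> rcases hcase k hk with ⟨a', ha', rfl⟩ | hk
    · by_contra hne
      have hne : a ≠ a' := fun h => hne (by rw [h])
      have := hM.disj a ha a' ha' hne
      rw [← ew_cl, ← ew_cl] at this
      exact (Set.eq_empty_iff_forall_notMem.1 this) x
        ⟨Wall.op_subset_cl _ hxw, Wall.op_subset_cl _ hxk⟩
    · obtain ⟨z1, z2, -, -, h, -⟩ := box_cases hN0 hk
      have := hedge a ha x (Wall.op_subset_cl _ hxw)
      have := h x (Wall.op_subset_cl _ hxk)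
      linarith
    · obtain ⟨z1, z2, -, -, h, -⟩ := box_cases hN0 hw
      have := hedge a' ha' x (Wall.op_subset_cl _ hxk)
      have := h x (Wall.op_subset_cl _ hxw)
      linarith
    · exact box_disjoint hN0 hw hk hxw hxk
  · intro w hw
    rcases hcase w hw with ⟨a, ha, rfl⟩ | hw
    · left; rfl
    · obtain ⟨z1, z2, rfl, -, -, h, -⟩ := box_cases hN0 hw
      right; right
      rw [cw_pt, cw_dir]
      simpa [cw] using h.mono hsub
  · intro w hw
    rcases hcase w hw with ⟨a, ha, rfl⟩ | hw
    · left; rfl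
    · obtain ⟨z1, z2, rfl, -, -, -, h⟩ := box_cases hN0 hw
      right; left
      rw [cw_pt]
      convert h using 2
      simp only [cw]; module
  · intro p hp w hw s h0 h1 hs
    have hpc : p ∈ w.cl := ⟨s, ⟨h0, h1⟩, hs⟩
    rcases hcase w hw with ⟨a, ha, rfl⟩ | hw
    · rw [ew_cl] at hpc
      obtain ⟨f, hf, hpf⟩ := hp
      have hpf' : p ∈ segment ℝ f.1 f.2 := by
        rcases hpf with rfl | rfl
        · exact left_mem_segment _ _ _
        · exact right_mem_segment _ _ _
      have haf : a = f := by
        by_contra hne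
        exact (Set.eq_empty_iff_forall_notMem.1 (hM.disj a ha f hf hne)) p ⟨hpc, hpf'⟩
      subst haf
      have hne : (ew a).b ≠ (ew a).r := hM.ne a ha a ha
      rcases hpf with h | h
      · left; exact Wall.pt_inj hne (hs.trans (h.trans (ew a).pt_zero.symm))
      · right; exact Wall.pt_inj hne (hs.trans (h.trans (ew a).pt_one.symm))
    · obtain ⟨z1, z2, -, -, h, -⟩ := box_cases hN0 hw
      have := h p hpc
      have := hN p hp
      linarith
  · intro a ha
    exact ⟨ew a, mem_union_left _ (mem_image_of_mem _ ha), rfl, rfl, le_rfl, le_rfl⟩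
  · intro x hx
    obtain ⟨w, hw, h⟩ := box_encl (g := g) hN0 hx
    exact ⟨w, hsub hw, h⟩

lemma free_W0 (hN0 : 0 < N) {g : ℤ} {x : Pt} :
    Free N (W0 M N g) x ↔ ‖x‖ < N ∧ ∀ a ∈ M, x ∉ segment ℝ a.1 a.2 := by
  constructor
  · rintro ⟨h1, h2⟩
    exact ⟨h1, fun a ha => by
      rw [← ew_cl]; exact h2 _ (mem_union_left _ (mem_image_of_mem _ ha))⟩
  · rintro ⟨h1, h2⟩
    refine ⟨h1, fun w hw hxw => ?_⟩
    rcases mem_union.1 hw with h | h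
    · obtain ⟨a, ha, rfl⟩ := mem_image.1 h
      exact h2 a ha (ew_cl a ▸ hxw)
    · obtain ⟨z1, z2, -, -, h, -⟩ := box_cases hN0 h
      exact absurd (h x hxw) (not_le.2 h1)

/-- The edges crossing the line. -/
noncomputable def crossings (M : Finset (Pt × Pt)) (e : Pt) (c : ℝ) : Finset (Pt × Pt) :=
  {a ∈ M | ¬(Lft e c a.1 ↔ Lft e c a.2)}

lemma crs_ew_pt (a : Pt × Pt) (e : Pt) (s : ℝ) :
    crs ((ew a).pt s) e = crs a.1 e + s * (crs a.2 e - crs a.1 e) := by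
  rw [Wall.pt, crs_add_left, crs_smul_left, Wall.dir, crs_sub_left]; rfl

lemma exists_cross_pt {a : Pt × Pt} {e : Pt} {c : ℝ} (h1 : crs a.1 e ≠ c) (h2 : crs a.2 e ≠ c)
    (h : ¬(Lft e c a.1 ↔ Lft e c a.2)) : ∃ s, 0 < s ∧ s < 1 ∧ crs ((ew a).pt s) e = c := by
  have key : (crs a.1 e < c ∧ c < crs a.2 e) ∨ (c < crs a.1 e ∧ crs a.2 e < c) := by
    unfold Lft at h
    rcases lt_or_gt_of_ne h1 with h3 | h3 <;> rcases lt_or_gt_of_ne h2 with h4 | h4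
    · exact absurd ⟨fun _ => h4, fun _ => h3⟩ h
    · exact Or.inl ⟨h3, h4⟩
    · exact Or.inr ⟨h3, h4⟩
    · exact absurd ⟨fun h' => absurd h' h3.not_gt, fun h' => absurd h' h4.not_gt⟩ h
  have hd : crs a.2 e - crs a.1 e ≠ 0 := by
    rcases key with ⟨h3, h4⟩ | ⟨h3, h4⟩
    · exact (by linarith : 0 < crs a.2 e - crs a.1 e).ne'
    · exact (by linarith : crs a.2 e - crs a.1 e < 0).ne
  refine ⟨(c - crs a.1 e) / (crs a.2 e - crs a.1 e), ?_, ?_, ?_⟩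
  · rcases key with ⟨h3, h4⟩ | ⟨h3, h4⟩
    · exact div_pos (by linarith) (by linarith)
    · exact div_pos_of_neg_of_neg (by linarith) (by linarith)
  · rcases key with ⟨h3, h4⟩ | ⟨h3, h4⟩
    · rw [div_lt_one (by linarith)]; linarith
    · rw [div_lt_one_of_neg (by linarith)]; linarith
  · rw [crs_ew_pt, div_mul_cancel₀ _ hd]; ring

/-- The crossings of the matching with the line `o + ℝ e`, in coordinates. -/
structure LineData (M : Finset (Pt × Pt)) (e : Pt) (c : ℝ) (o : Pt) (T σ : Pt × Pt → ℝ) : Prop where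
  he : e ≠ 0
  ho : crs o e = c
  pt : ∀ a ∈ crossings M e c, 0 < σ a ∧ σ a < 1 ∧ (ew a).pt (σ a) = o + T a • e
  uniq : ∀ a ∈ M, ∀ t : ℝ, o + t • e ∈ segment ℝ a.1 a.2 → a ∈ crossings M e c ∧ t = T a
  inj : ∀ a ∈ crossings M e c, ∀ a' ∈ crossings M e c, T a = T a' → a = a'

lemma line_inj {o e : Pt} (he : e ≠ 0) {t t' : ℝ} (h : o + t • e = o + t' • e) : t = t' := by
  have : (t - t') • e = 0 := by rw [sub_smul, add_left_cancel h, sub_self]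
  exact sub_eq_zero.1 ((smul_eq_zero.1 this).resolve_right he)

lemma exists_lineData (hM : PM M) {e : Pt} {c : ℝ} (he : e ≠ 0)
    (hside : ∀ p, EndP M p → crs p e ≠ c)
    {o : Pt} (ho : crs o e = c) : ∃ T σ, LineData M e c o T σ := by
  have hside' : ∀ a ∈ M, crs a.1 e ≠ c ∧ crs a.2 e ≠ c := fun a ha =>
    ⟨hside _ ⟨a, ha, Or.inl rfl⟩, hside _ ⟨a, ha, Or.inr rfl⟩⟩
  have h1 : ∀ a ∈ crossings M e c, ∃ t s : ℝ, 0 < s ∧ s < 1 ∧ (ew a).pt s = o + t • e := by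
    intro a ha
    obtain ⟨haM, hac⟩ := mem_filter.1 ha
    obtain ⟨s, s0, s1, hs⟩ := exists_cross_pt (hside' a haM).1 (hside' a haM).2 hac
    obtain ⟨t, ht⟩ := exists_eq_add_smul he (ho.trans hs.symm)
    exact ⟨t, s, s0, s1, ht⟩
  choose! T σ hT using h1
  have hseg : ∀ a ∈ crossings M e c, o + T a • e ∈ segment ℝ a.1 a.2 := by
    intro a ha
    obtain ⟨s0, s1, hs⟩ := hT a ha
    rw [← hs, ← ew_cl]
    exact ⟨σ a, ⟨s0.le, s1.le⟩, rfl⟩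
  refine ⟨T, σ, he, ho, hT, ?_, ?_⟩
  · intro a ha t ht
    have hte : crs (o + t • e) e = c := by rw [crs_line, ho]
    have hc : a ∈ crossings M e c := by
      refine mem_filter.2 ⟨ha, fun hiff => ?_⟩
      by_cases h1 : Lft e c a.1
      · have := lft_of_mem_segment h1 (hiff.1 h1) ht
        exact absurd hte (ne_of_lt this)
      · have h2 : ¬ Lft e c a.2 := fun h2 => h1 (hiff.2 h2)
        have h3 : c < crs a.1 e := lt_of_le_of_ne (not_lt.1 h1) (hside' a ha).1.symm
        have h4 : c < crs a.2 e := lt_of_le_of_ne (not_lt.1 h2) (hside' a ha).2.symm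
        have := rgt_of_mem_segment h3 h4 ht
        exact absurd hte (ne_of_gt this)
    refine ⟨hc, ?_⟩
    rw [← ew_cl] at ht
    obtain ⟨s, -, hs⟩ := ht
    obtain ⟨-, -, hs'⟩ := hT a hc
    have hd : crs a.2 e - crs a.1 e ≠ 0 := by
      intro h0
      refine (mem_filter.1 hc).2 ?_
      unfold Lft
      rw [sub_eq_zero.1 h0]
    have e1 := crs_ew_pt a e s
    have e2 := crs_ew_pt a e (σ a)
    rw [hs, hte] at e1
    rw [hs', crs_line, ho] at e2
    have : s = σ a := mul_right_cancel₀ hd (by linarith)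
    subst this
    exact line_inj he (hs.symm.trans hs')
  · intro a ha a' ha' h
    by_contra hne
    refine (Set.eq_empty_iff_forall_notMem.1 (hM.disj a (mem_filter.1 ha).1 a' (mem_filter.1 ha').1
      hne)) (o + T a • e) ⟨hseg a ha, ?_⟩
    rw [h]; exact hseg a' ha'

namespace LineData

variable {e o : Pt} {c : ℝ} {T σ : Pt × Pt → ℝ}

lemma norm_lt (hL : LineData M e c o T σ) (hN : ∀ p, EndP M p → ‖p‖ < N) {a : Pt × Pt}
    (ha : a ∈ crossings M e c) : ‖o + T a • e‖ < N := by
  obtain ⟨s0, s1, hs⟩ := hL.pt a ha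
  have haM := (mem_filter.1 ha).1
  refine norm_lt_of_mem_segment (hN _ ⟨a, haM, Or.inl rfl⟩) (hN _ ⟨a, haM, Or.inr rfl⟩) ?_
  rw [← hs, ← ew_cl]
  exact ⟨σ a, ⟨s0.le, s1.le⟩, rfl⟩

lemma norm_between {r s t : ℝ} (hr : ‖o + r • e‖ < N) (ht : ‖o + t • e‖ < N) (h1 : r ≤ s)
    (h2 : s ≤ t) : ‖o + s • e‖ < N := by
  refine norm_lt_of_mem_segment hr ht ?_
  rcases h1.eq_or_lt with rfl | h1
  · exact left_mem_segment _ _ _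
  have hd : 0 < t - r := by linarith
  rw [segment_eq_image']
  refine ⟨(s - r) / (t - r), ⟨div_nonneg (by linarith) hd.le, (div_le_one hd).2 (by linarith)⟩, ?_⟩
  have : o + t • e - (o + r • e) = (t - r) • e := by module
  simp only [this, smul_smul]
  rw [div_mul_cancel₀ _ hd.ne']
  module

lemma free (hL : LineData M e c o T σ) (hN0 : 0 < N) {g : ℤ} {t : ℝ} :
    Free N (W0 M N g) (o + t • e) ↔ ‖o + t • e‖ < N ∧ ∀ a ∈ crossings M e c, t ≠ T a := by
  rw [free_W0 hN0]
  refine and_congr_right fun _ => ⟨fun h a ha hta => ?_, fun h a ha hx => ?_⟩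
  · obtain ⟨s0, s1, hs⟩ := hL.pt a ha
    refine h a (mem_filter.1 ha).1 ?_
    rw [hta, ← hs, ← ew_cl]
    exact ⟨σ a, ⟨s0.le, s1.le⟩, rfl⟩
  · obtain ⟨h1, h2⟩ := hL.uniq a ha t hx
    exact h a h1 h2

lemma cov (hL : LineData M e c o T σ) (hN0 : 0 < N) {g : ℤ} :
    Cov N (W0 M N g) e c (#(crossings M e c) + 1) := by
  set K := crossings M e c with hK
  refine ⟨fun x => #{a ∈ K | ∃ t, x = o + t • e ∧ T a < t}, range (#K + 1), by simp, ?_, ?_⟩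
  · intro x _ _
    rw [mem_range]
    exact Nat.lt_succ_of_le (card_filter_le _ _)
  have hval : ∀ r : ℝ, {a ∈ K | ∃ t, o + r • e = o + t • e ∧ T a < t} = {a ∈ K | T a < r} := by
    intro r
    refine filter_congr fun a _ => ⟨?_, fun h => ⟨r, rfl, h⟩⟩
    rintro ⟨t, h1, h2⟩
    rwa [line_inj hL.he h1]
  have main : ∀ r s : ℝ, r ≤ s → Free N (W0 M N g) (o + r • e) → Free N (W0 M N g) (o + s • e) →
      #{a ∈ K | T a < r} = #{a ∈ K | T a < s} → Vis N (W0 M N g) (o + r • e) (o + s • e) := by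
    intro r s hrs hr hs hcard t t0 t1
    have hsub : {a ∈ K | T a < r} ⊆ {a ∈ K | T a < s} := fun a ha => by
      obtain ⟨h1, h2⟩ := mem_filter.1 ha
      exact mem_filter.2 ⟨h1, h2.trans_le hrs⟩
    have heq := eq_of_subset_of_card_le hsub hcard.ge
    have hp : o + r • e + t • (o + s • e - (o + r • e)) = o + (r + t * (s - r)) • e := by module
    have hd : 0 ≤ s - r := by linarith
    have hu1 : r ≤ r + t * (s - r) := by nlinarith
    have hu2 : r + t * (s - r) ≤ s := by nlinarith
    rw [hp, hL.free hN0]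
    rw [hL.free hN0] at hr hs
    refine ⟨norm_between hr.1 hs.1 hu1 hu2, fun a ha hta => ?_⟩
    rw [hta] at hu1 hu2
    have h1 : a ∈ ({a ∈ K | T a < s} : Finset _) :=
      mem_filter.2 ⟨ha, lt_of_le_of_ne hu2 (hs.2 a ha).symm⟩
    rw [← heq] at h1
    linarith [(mem_filter.1 h1).2]
  intro x y hx hy hxe hye hxy
  obtain ⟨r, rfl⟩ := exists_eq_add_smul hL.he (hL.ho.trans hxe.symm)
  obtain ⟨s, rfl⟩ := exists_eq_add_smul hL.he (hL.ho.trans hye.symm)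
  simp only [hval] at hxy
  rcases le_total r s with h | h
  · exact main r s h hx hy hxy
  · exact (main s r h hy hx hxy.symm).symm

/-- The label of a crossing edge seen along the line. -/
lemma lab (hL : LineData M e c o T σ) (hside : ∀ p, EndP M p → crs p e ≠ c) {a : Pt × Pt}
    (ha : a ∈ crossings M e c) : (ew a).lab (- -e) (σ a) = (if Lft e c a.1 then 1 else 0) ∧
      (ew a).lab (-e) (σ a) = (if Lft e c a.1 then 0 else 1) := by
  obtain ⟨s0, s1, -⟩ := hL.pt a ha
  obtain ⟨haM, hc⟩ := mem_filter.1 ha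
  have h1 := hside _ ⟨a, haM, Or.inl rfl⟩
  have h2 := hside _ ⟨a, haM, Or.inr rfl⟩
  have hd : crs (ew a).dir e = crs a.2 e - crs a.1 e := by rw [Wall.dir, crs_sub_left]; rfl
  unfold Wall.lab
  rw [if_neg s0.not_gt, if_neg s1.not_gt, if_neg s0.not_gt, if_neg s1.not_gt, neg_neg,
    crs_neg_right,
    hd]
  unfold Lft at hc ⊢
  by_cases h3 : crs a.1 e < c
  · have h4 : ¬ crs a.2 e < c := fun h4 => hc ⟨fun _ => h4, fun _ => h3⟩
    rw [if_pos h3, if_pos h3, if_pos (by linarith [not_lt.1 h4]),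
      if_neg (by linarith [not_lt.1 h4])]
    exact ⟨rfl, rfl⟩
  · have h4 : crs a.2 e < c := by
      by_contra h4; exact hc ⟨fun h => absurd h h3, fun h => absurd h h4⟩
    rw [if_neg h3, if_neg h3, if_neg (by linarith [not_lt.1 h3]),
      if_pos (by linarith [not_lt.1 h3])]
    exact ⟨rfl, rfl⟩

lemma hit_down (hL : LineData M e c o T σ) (hside : ∀ p, EndP M p → crs p e ≠ c) (hN0 : 0 < N)
    (hN : ∀ p, EndP M p → ‖p‖ < N) {g : ℤ} {a : Pt × Pt} (ha : a ∈ crossings M e c) {t : ℝ}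
    (hat : T a < t) (ht : ‖o + t • e‖ < N) (hgap : ∀ a' ∈ crossings M e c, T a < T a' → t < T a') :
    HitLab N (W0 M N g) (o + t • e) (-e) (if Lft e c a.1 then 1 else 0) := by
  obtain ⟨s0, s1, hs⟩ := hL.pt a ha
  refine ⟨t - T a, ew a, σ a, ⟨by linarith, mem_union_left _
    (mem_image_of_mem _ (mem_filter.1 ha).1), s0, s1, by rw [hs]; module, fun r r0 r1 => ?_⟩,
    (hL.lab hside ha).1⟩
  have : o + t • e + r • -e = o + (t - r) • e := by module
  rw [this, hL.free hN0]
  refine ⟨norm_between (hL.norm_lt hN ha) ht (by linarith) (by linarith), fun a' ha' h => ?_⟩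
  have := hgap a' ha' (by linarith)
  linarith

lemma hit_up (hL : LineData M e c o T σ) (hside : ∀ p, EndP M p → crs p e ≠ c) (hN0 : 0 < N)
    (hN : ∀ p, EndP M p → ‖p‖ < N) {g : ℤ} {a : Pt × Pt} (ha : a ∈ crossings M e c) {t : ℝ}
    (hat : t < T a) (ht : ‖o + t • e‖ < N) (hgap : ∀ a' ∈ crossings M e c, T a' < T a → T a' < t) :
    HitLab N (W0 M N g) (o + t • e) e (if Lft e c a.1 then 0 else 1) := by
  obtain ⟨s0, s1, hs⟩ := hL.pt a ha
  refine ⟨T a - t, ew a, σ a, ⟨by linarith, mem_union_left _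
    (mem_image_of_mem _ (mem_filter.1 ha).1), s0, s1, by rw [hs]; module, fun r r0 r1 => ?_⟩,
    (hL.lab hside ha).2⟩
  have : o + t • e + r • e = o + (t + r) • e := by module
  rw [this, hL.free hN0]
  refine ⟨norm_between ht (hL.norm_lt hN ha) (by linarith) (by linarith), fun a' ha' h => ?_⟩
  have := hgap a' ha' (by linarith)
  linarith

lemma hit_box (hL : LineData M e c o T σ) (hN0 : 0 < N) {g : ℤ} (h : Cfg M N (W0 M N g))
    (hside : ∀ p, EndP M p → crs p e ≠ c) {t : ℝ}
    (ht : ‖o + t • e‖ < N) (htop : ∀ a ∈ crossings M e c, T a < t) :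
    HitLab N (W0 M N g) (o + t • e) e g := by
  have hf : Free N (W0 M N g) (o + t • e) := (hL.free hN0).2 ⟨ht, fun a ha => (htop a ha).ne'⟩
  obtain ⟨τ, w, s, H⟩ := h.exists_hit hf hL.he (Or.inr fun r hE => hside _ hE (by
    rw [crs_line, crs_line, hL.ho]))
  refine ⟨τ, w, s, H, ?_⟩
  rcases mem_union.1 H.mem with hw | hw
  · exfalso
    obtain ⟨a, ha, rfl⟩ := mem_image.1 hw
    have h1 : o + (t + τ) • e ∈ segment ℝ a.1 a.2 := by
      rw [← ew_cl]
      refine ⟨s, ⟨H.hA.le, H.hB.le⟩, ?_⟩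
      rw [← H.eq]; module
    obtain ⟨h2, h3⟩ := hL.uniq a ha _ h1
    linarith [htop a h2, H.pos]
  · obtain ⟨z1, z2, rfl, -⟩ := box_cases hN0 hw
    exact cw_lab _ _ _ _ (by have := H.hB; simp only [cw] at this; linarith)

end LineData

/-- Every matching crossed by a line in both senses admits a full configuration with few colours. -/
lemma exists_full_cov (hM : PM M) {e : Pt} {c : ℝ} (he : e ≠ 0)
    (hside : ∀ p, EndP M p → crs p e ≠ c) {a b : Pt × Pt} (ha : a ∈ crossings M e c)
    (hb : b ∈ crossings M e c) (hab : ¬(Lft e c a.1 ↔ Lft e c b.1)) :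
    ∃ N W, (∀ p, EndP M p → ‖p‖ < N) ∧ Cfg M N W ∧ Full W ∧
      Cov N W e c (#(crossings M e c) - 1) := by
  set K := crossings M e c with hK
  obtain ⟨N, hN0, hN⟩ : ∃ N : ℝ, 0 < N ∧ ∀ p, EndP M p → ‖p‖ < N := by
    refine ⟨∑ p ∈ endPts M, ‖p‖ + 1, ?_, fun p hp => ?_⟩
    · have := sum_nonneg fun p (_ : p ∈ endPts M) => norm_nonneg p
      linarith
    · have := single_le_sum (fun p _ => norm_nonneg p) (mem_endPts.2 hp)
      linarith
  obtain ⟨o, ho⟩ : ∃ o, crs o e = c := by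
    obtain ⟨haM, hac⟩ := mem_filter.1 ha
    obtain ⟨s, -, -, hs⟩ := exists_cross_pt (hside _ ⟨a, haM, Or.inl rfl⟩)
      (hside _ ⟨a, haM, Or.inr rfl⟩) hac
    exact ⟨_, hs⟩
  obtain ⟨T, σ, hL⟩ := exists_lineData hM he hside ho
  obtain ⟨m, hm, hmax⟩ := exists_max_image K T ⟨a, ha⟩
  set g : ℤ := if Lft e c m.1 then 1 else 0 with hg
  have h0 : Cfg M N (W0 M N g) := cfg_W0 hM hN0 hN (by rw [hg]; split_ifs <;> simp)
  have hcov := hL.cov hN0 (g := g)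
  -- a point above the topmost edge
  obtain ⟨t1, ht1, hn1⟩ : ∃ t, T m < t ∧ ‖o + t • e‖ < N := by
    have hc : Continuous fun t : ℝ => ‖o + t • e‖ := by fun_prop
    have h1 := hc.continuousAt.eventually (gt_mem_nhds (hL.norm_lt hN hm))
    obtain ⟨t, h2, h3⟩ := ((h1.filter_mono nhdsWithin_le_nhds).and
      (self_mem_nhdsWithin (s := Set.Ioi (T m)))).exists
    exact ⟨t, h3, h2⟩
  have htop : ∀ a ∈ K, T a < t1 := fun a ha => (hmax a ha).trans_lt ht1
  have hf1 : Free N (W0 M N g) (o + t1 • e) := (hL.free hN0).2 ⟨hn1, fun a ha => (htop a ha).ne'⟩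
  have hu1 := hL.hit_box hN0 h0 hside hn1 htop
  have hd1 := hL.hit_down hside hN0 hN (g := g) hm ht1 hn1
    fun a' ha' h => absurd h (not_lt.2 (hmax a' ha'))
  -- a gap between edges crossing in opposite senses
  obtain ⟨a, b, haK, hbK, hlt, hop, hmin⟩ : ∃ a b, a ∈ K ∧ b ∈ K ∧ T a < T b ∧
      ¬(Lft e c a.1 ↔ Lft e c b.1) ∧ ∀ d ∈ K, T d ≤ T a ∨ T b ≤ T d := by
    set S := {q ∈ K ×ˢ K | T q.1 < T q.2 ∧ ¬(Lft e c q.1.1 ↔ Lft e c q.2.1)} with hS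
    have hSne : S.Nonempty := by
      rcases lt_trichotomy (T a) (T b) with h | h | h
      · exact ⟨(a, b), mem_filter.2 ⟨mem_product.2 ⟨ha, hb⟩, h, hab⟩⟩
      · exact absurd (by rw [hL.inj a ha b hb h]) hab
      · exact ⟨(b, a), mem_filter.2 ⟨mem_product.2 ⟨hb, ha⟩, h, fun h' => hab h'.symm⟩⟩
    obtain ⟨⟨a, b⟩, hq, hmin⟩ := exists_min_image S (fun q => T q.2 - T q.1) hSne
    obtain ⟨h1, h2, h3⟩ := mem_filter.1 hq
    obtain ⟨haK, hbK⟩ := mem_product.1 h1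
    refine ⟨a, b, haK, hbK, h2, h3, fun d hd => ?_⟩
    by_contra hcon
    push Not at hcon
    by_cases hda : Lft e c d.1 ↔ Lft e c a.1
    · have := hmin (d, b) (mem_filter.2 ⟨mem_product.2 ⟨hd, hbK⟩, hcon.2, fun h' => h3
      (hda.symm.trans h')⟩)
      simp only at this; linarith
    · have := hmin (a, d) (mem_filter.2 ⟨mem_product.2 ⟨haK, hd⟩, hcon.1, fun h' => hda h'.symm⟩)
      simp only at this; linarith
  set t2 := (T a + T b) / 2 with ht2
  have hn2 : ‖o + t2 • e‖ < N := LineData.norm_between (hL.norm_lt hN haK) (hL.norm_lt hN hbK)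
    (by rw [ht2]; linarith) (by rw [ht2]; linarith)
  have hf2 : Free N (W0 M N g) (o + t2 • e) := (hL.free hN0).2 ⟨hn2, fun d hd h => by
    rcases hmin d hd with h' | h' <;> rw [← h, ht2] at h' <;> linarith⟩
  have hd2 := hL.hit_down hside hN0 hN (g := g) haK (t := t2) (by rw [ht2]; linarith) hn2
    fun d hd h => by rcases hmin d hd with h' | h' <;> rw [ht2] <;> linarith
  have hu2 := hL.hit_up hside hN0 hN (g := g) hbK (t := t2) (by rw [ht2]; linarith) hn2
    fun d hd h => by rcases hmin d hd with h' | h' <;> rw [ht2] <;> linarith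
  have hlab : (if Lft e c b.1 then 0 else 1 : ℤ) = if Lft e c a.1 then 1 else 0 := by
    by_cases h1 : Lft e c a.1 <;> by_cases h2 : Lft e c b.1 <;> simp_all
  rw [hlab] at hu2
  have hnv : ¬ Vis N (W0 M N g) (o + t1 • e) (o + t2 • e) := by
    intro hv
    have hb1 := htop b hbK
    have hb2 : t2 < T b := by rw [ht2]; linarith
    have := hv ((t1 - T b) / (t1 - t2)) (div_nonneg (by linarith) (by linarith))
      ((div_le_one (by linarith)).2 (by linarith))
    have hp : o + t1 • e + ((t1 - T b) / (t1 - t2)) • (o + t2 • e - (o + t1 • e)) =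
        o + T b • e := by
      have h1 : o + t2 • e - (o + t1 • e) = -((t1 - t2) • e) := by module
      rw [h1, smul_neg, smul_smul, div_mul_cancel₀ _ (by linarith)]
      module
    rw [hp, hL.free hN0] at this
    exact this.2 b hbK rfl
  obtain ⟨z1, z2, c1, c2, c3⟩ := h0.close he (by rw [crs_line, ho]) hside hu1 hd1 hf1
  obtain ⟨hf2', hlabs⟩ := c3 (o + t2 • e) (by rw [crs_line, ho]) hf2 hnv
  obtain ⟨y1, y2, d1, d2, -⟩ := c1.close he (by rw [crs_line, ho]) hside
    (hlabs e _ (Or.inl rfl) hu2) (hlabs (-e) _ (Or.inr rfl) hd2) hf2'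
  have hcov' := (d2 _ (c2 _ hcov).2).2
  obtain ⟨W, f1, f2, f3⟩ := Cfg.exists_full hM hN he hside _ _ rfl d1 hcov'
  exact ⟨N, W, hN, f1, f3, f2.mono (by rw [← hK]; omega)⟩

lemma collinear_of_crs_eq_zero {p q r : Pt} (hpq : p ≠ q) (h : crs (q - p) (r - p) = 0) :
    Collinear ℝ ({p, q, r} : Set Pt) := by
  obtain ⟨a, ha⟩ := exists_smul_of_crs_eq_zero (sub_ne_zero.2 hpq.symm) h
  rw [collinear_iff_of_mem (p₀ := p) (by simp)]
  refine ⟨q - p, ?_⟩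
  rintro x (rfl | rfl | rfl)
  · exact ⟨0, by simp⟩
  · exact ⟨1, by simp⟩
  · exact ⟨a, by rw [← ha]; simp⟩

lemma exists_injective_slope (P : Finset Pt) :
    ∃ κ : ℝ, ∀ x ∈ P, ∀ y ∈ P, x ≠ y → x.1 + κ * x.2 ≠ y.1 + κ * y.2 := by
  obtain ⟨κ, hκ⟩ := Infinite.exists_notMem_finset
    ((P ×ˢ P).image fun a : Pt × Pt => -((a.1.1 - a.2.1) / (a.1.2 - a.2.2)))
  refine ⟨κ, fun x hx y hy hxy h => ?_⟩
  by_cases h2 : x.2 = y.2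
  · rw [h2] at h
    exact hxy (Prod.ext (by linarith) h2)
  · refine hκ (mem_image.2 ⟨(x, y), mem_product.2 ⟨hx, hy⟩, ?_⟩)
    have h3 : x.2 - y.2 ≠ 0 := sub_ne_zero.2 h2
    field_simp
    linarith

/-- A set with weights `±1` of total weight zero has a proper nonempty part of weight zero
that is cut off by a line. -/
lemma exists_balanced_part {P : Finset Pt} (hgen : GenPos P) {w : Pt → ℤ}
    (hw : ∀ q ∈ P, w q = 1 ∨ w q = -1) (hsum : ∑ q ∈ P, w q = 0) (hcard : 2 < #P) :
    ∃ e : Pt, e ≠ 0 ∧ ∃ Y ⊆ P, Y.Nonempty ∧ Y ≠ P ∧ ∑ q ∈ Y, w q = 0 ∧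
      ∀ x ∈ Y, ∀ y ∈ P \ Y, crs x e < crs y e := by
  obtain ⟨κ, hκ⟩ := exists_injective_slope P
  obtain ⟨p, hp, hmin⟩ := P.exists_min_image (fun x => x.1 + κ * x.2) (card_pos.1 (by omega))
  set g : Pt → ℝ := fun x => (x.1 - p.1) + κ * (x.2 - p.2) with hg
  have hgpos : ∀ q ∈ P.erase p, 0 < g q := fun q hq => by
    obtain ⟨h1, h2⟩ := mem_erase.1 hq
    have h3 := lt_of_le_of_ne (hmin q h2) (hκ p hp q h2 h1.symm)
    simp only [hg]; linarith
  set σ : Pt → ℝ := fun q => (q.2 - p.2) / g q with hσ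
  have hinj : ∀ x ∈ P.erase p, ∀ y ∈ P.erase p, σ x = σ y → x = y := fun x hx y hy h => by
    by_contra hne
    have h1 := hgpos x hx
    have h2 := hgpos y hy
    simp only [hσ] at h
    rw [div_eq_div_iff h1.ne' h2.ne'] at h
    obtain ⟨hx1, hx2⟩ := mem_erase.1 hx
    obtain ⟨hy1, hy2⟩ := mem_erase.1 hy
    refine hgen p hp x hx2 y hy2 hx1.symm hy1.symm hne
      (collinear_of_crs_eq_zero hx1.symm ?_)
    simp only [crs, Prod.fst_sub, Prod.snd_sub]
    simp only [hg] at h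
    linarith
  set v : Pt → ℤ := fun q => w p * w q with hv
  have hwp : w p * w p = 1 := by rcases hw p hp with h | h <;> rw [h] <;> rfl
  have hv1 : ∀ q ∈ P, v q = 1 ∨ v q = -1 := fun q hq => by
    rcases hw p hp with h | h <;> rcases hw q hq with h' | h' <;> simp [hv, h, h']
  have hvs : ∀ Y : Finset Pt, ∑ q ∈ Y, v q = 0 → ∑ q ∈ Y, w q = 0 := fun Y h => by
    rw [hv, ← mul_sum] at h
    rcases mul_eq_zero.1 h with h | h
    · rw [h] at hwp; simp at hwp
    · exact h
  have hvQ : ∑ q ∈ P.erase p, v q = -1 := by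
    have h1 : ∑ q ∈ P, v q = 0 := by rw [hv, ← mul_sum, hsum, mul_zero]
    rw [← add_sum_erase _ _ hp] at h1
    have h2 : v p = 1 := hwp
    omega
  set X : Pt → Finset Pt := fun q => {q' ∈ P.erase p | σ q' ≤ σ q} with hX
  have hne : ({q ∈ P.erase p | ∑ q' ∈ X q, v q' ≤ 0}).Nonempty := by
    have hQ : (P.erase p).Nonempty := card_pos.1 (by rw [card_erase_of_mem hp]; omega)
    obtain ⟨q, hq, hmax⟩ := (P.erase p).exists_max_image σ hQ
    refine ⟨q, mem_filter.2 ⟨hq, ?_⟩⟩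
    have : X q = P.erase p := filter_true_of_mem hmax
    rw [this, hvQ]; norm_num
  obtain ⟨q, hq, hqmin⟩ := exists_min_image _ σ hne
  obtain ⟨hqQ, hqs⟩ := mem_filter.1 hq
  obtain ⟨s, hs1, hs2⟩ := Order.exists_between_finsets (lo := {σ q})
    (hi := ((P.erase p) \ X q).image σ) (fun x hx y hy => by
      obtain rfl := mem_singleton.1 hx
      obtain ⟨z, hz, rfl⟩ := mem_image.1 hy
      obtain ⟨hz1, hz2⟩ := mem_sdiff.1 hz
      by_contra hcon
      exact hz2 (mem_filter.2 ⟨hz1, not_lt.1 hcon⟩))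
  have hs1 := hs1 _ (mem_singleton_self _)
  set e : Pt := (s * κ - 1, -s) with he
  have he0 : e ≠ 0 := fun h => by
    have h1 : -s = 0 := congrArg Prod.snd h
    have h2 : s * κ - 1 = 0 := congrArg Prod.fst h
    have : s = 0 := by linarith
    rw [this] at h2; norm_num at h2
  have hcrs : ∀ x ∈ P.erase p, crs x e - crs p e = (σ x - s) * g x := fun x hx => by
    have : σ x * g x = x.2 - p.2 := div_mul_cancel₀ _ (hgpos x hx).ne'
    rw [sub_mul, this]
    simp only [crs, hg, he]; ring
  have hlo : ∀ x ∈ X q, crs x e < crs p e := fun x hx => by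
    obtain ⟨h1, h2⟩ := mem_filter.1 hx
    have := mul_neg_of_neg_of_pos (sub_neg.2 (h2.trans_lt hs1)) (hgpos x h1)
    rw [← hcrs x h1] at this; linarith
  have hhi : ∀ x ∈ P.erase p, x ∉ X q → crs p e < crs x e := fun x hx hx' => by
    have := mul_pos (sub_pos.2 (hs2 _ (mem_image_of_mem _ (mem_sdiff.2 ⟨hx, hx'⟩)))) (hgpos x hx)
    rw [← hcrs x hx] at this; linarith
  have hXP : X q ⊆ P := (filter_subset _ _).trans (erase_subset _ _)
  have hpX : p ∉ X q := fun h => (mem_erase.1 (mem_filter.1 h).1).1 rfl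
  have hqX : q ∈ X q := mem_filter.2 ⟨hqQ, le_rfl⟩
  have hsplit : ∑ q' ∈ X q, v q' = v q + ∑ q' ∈ (X q).erase q, v q' :=
    (add_sum_erase _ _ hqX).symm
  refine ⟨e, he0, ?_⟩
  rcases ((X q).erase q).eq_empty_or_nonempty with hA | hA
  · rw [hA, sum_empty, add_zero] at hsplit
    have hXq : X q = {q} := by
      rw [← insert_erase hqX, hA]; rfl
    have hvq : v q = -1 := by
      rcases hv1 q (hXP hqX) with h | h
      · omega
      · exact h
    refine ⟨insert p (X q), insert_subset hp hXP, ⟨p, mem_insert_self _ _⟩, fun h => ?_,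
      hvs _ ?_, fun x hx y hy => ?_⟩
    · rw [← h, card_insert_of_notMem hpX, hXq, card_singleton] at hcard
      omega
    · rw [sum_insert hpX, hsplit, hvq]
      have h2 : v p = 1 := hwp
      omega
    · obtain ⟨hy1, hy2⟩ := mem_sdiff.1 hy
      rw [mem_insert, not_or] at hy2
      have := hhi y (mem_erase.2 ⟨hy2.1, hy1⟩) hy2.2
      rcases mem_insert.1 hx with rfl | hx
      · exact this
      · exact (hlo x hx).trans this
  · obtain ⟨q1, hq1, hmax⟩ := exists_max_image _ σ hA
    obtain ⟨hq1n, hq1X⟩ := mem_erase.1 hq1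
    obtain ⟨hq1Q, hq1s⟩ := mem_filter.1 hq1X
    have hlt : σ q1 < σ q := lt_of_le_of_ne hq1s fun h => hq1n (hinj _ hq1Q _ hqQ h)
    have hX1 : X q1 = (X q).erase q := by
      ext x
      simp only [hX, mem_filter, mem_erase]
      constructor
      · rintro ⟨h1, h2⟩
        refine ⟨?_, h1, by linarith⟩
        rintro rfl
        linarith
      · rintro ⟨h1, h2, h3⟩
        exact ⟨h2, hmax x (mem_erase.2 ⟨h1, mem_filter.2 ⟨mem_erase.2 h2, h3⟩⟩)⟩
    have h1 : ¬ ∑ q' ∈ X q1, v q' ≤ 0 := fun h =>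
      not_lt.2 (hqmin q1 (mem_filter.2 ⟨hq1Q, h⟩)) hlt
    rw [hX1] at h1
    refine ⟨X q, hXP, ⟨q, hqX⟩, fun h => hpX (h ▸ hp), hvs _ ?_, fun x hx y hy => ?_⟩
    · rcases hv1 q (hXP hqX) with h | h <;> omega
    · obtain ⟨hy1, hy2⟩ := mem_sdiff.1 hy
      by_cases hyp : y = p
      · rw [hyp]; exact hlo x hx
      · exact (hlo x hx).trans (hhi y (mem_erase.2 ⟨hyp, hy1⟩) hy2)

/-- A line avoiding the points and leaving on its left a nontrivial balanced part. -/
lemma exists_balanced_line {n : ℕ} {B R : Finset Pt} (hdisj : B ∩ R = ∅) (hB : #B = n)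
    (hR : #R = n) (hgen : GenPos (B ∪ R)) (hn : 2 ≤ n) :
    ∃ (e : Pt) (c : ℝ), e ≠ 0 ∧ (∀ p ∈ B ∪ R, crs p e ≠ c) ∧
      #{p ∈ B | Lft e c p} = #{p ∈ R | Lft e c p} ∧ 0 < #{p ∈ B | Lft e c p} ∧
      #{p ∈ B | Lft e c p} < n := by
  have hd : Disjoint B R := disjoint_iff_inter_eq_empty.2 hdisj
  have hsum : ∀ Y ⊆ B ∪ R, ∑ q ∈ Y, (if q ∈ B then (1 : ℤ) else -1) =
      #{p ∈ B | p ∈ Y} - #{p ∈ R | p ∈ Y} := fun Y hY => by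
    rw [sum_ite, sum_const, sum_const, filter_mem_eq_inter, inter_comm, ← filter_mem_eq_inter]
    have : ({q ∈ Y | q ∉ B}) = {p ∈ R | p ∈ Y} := by
      ext q
      simp only [mem_filter]
      constructor
      · rintro ⟨h1, h2⟩
        exact ⟨(mem_union.1 (hY h1)).resolve_left h2, h1⟩
      · rintro ⟨h1, h2⟩
        exact ⟨h2, fun h => disjoint_left.1 hd h h1⟩
    rw [this]
    simp [sub_eq_add_neg]
  obtain ⟨e, he, Y, hYP, hYne, hYP', hY0, hsep⟩ := exists_balanced_part hgen
    (w := fun q => if q ∈ B then 1 else -1)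
    (fun q _ => by by_cases h : q ∈ B <;> simp [h])
    (by
      rw [hsum _ subset_rfl, filter_true_of_mem fun x hx => mem_union_left _ hx,
        filter_true_of_mem fun x hx => mem_union_right _ hx, hB, hR, sub_self])
    (by rw [card_union_of_disjoint hd]; omega)
  rw [hsum Y hYP] at hY0
  obtain ⟨c, hc1, hc2⟩ := Order.exists_between_finsets (lo := Y.image fun x => crs x e)
    (hi := ((B ∪ R) \ Y).image fun x => crs x e) (fun s hs t ht => by
      obtain ⟨x, hx, rfl⟩ := mem_image.1 hs
      obtain ⟨y, hy, rfl⟩ := mem_image.1 ht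
      exact hsep x hx y hy)
  have h1 : ∀ x ∈ Y, crs x e < c := fun x hx => hc1 _ (mem_image_of_mem _ hx)
  have h2 : ∀ x ∈ B ∪ R, x ∉ Y → c < crs x e := fun x hx hx' =>
    hc2 _ (mem_image_of_mem (fun x => crs x e) (mem_sdiff.2 ⟨hx, hx'⟩))
  have hiff : ∀ x ∈ B ∪ R, (Lft e c x ↔ x ∈ Y) := fun x hx =>
    ⟨fun h => by_contra fun h' => lt_asymm h (h2 x hx h'), h1 x⟩
  have hBf : ({p ∈ B | Lft e c p}) = {p ∈ B | p ∈ Y} :=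
    filter_congr fun x hx => hiff x (mem_union_left _ hx)
  have hRf : ({p ∈ R | Lft e c p}) = {p ∈ R | p ∈ Y} :=
    filter_congr fun x hx => hiff x (mem_union_right _ hx)
  have hBR : #{p ∈ B | p ∈ Y} = #{p ∈ R | p ∈ Y} := by omega
  refine ⟨e, c, he, fun p hp => ?_, by rw [hBf, hRf, hBR], ?_, ?_⟩
  · by_cases h : p ∈ Y
    · exact (h1 p h).ne
    · exact (h2 p hp h).ne'
  · rw [hBf]
    obtain ⟨y, hy⟩ := hYne
    rcases mem_union.1 (hYP hy) with h | h
    · exact card_pos.2 ⟨y, mem_filter.2 ⟨h, hy⟩⟩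
    · rw [hBR]; exact card_pos.2 ⟨y, mem_filter.2 ⟨h, hy⟩⟩
  · rw [hBf]
    refine lt_of_le_of_ne ((card_filter_le _ _).trans hB.le) fun h => hYP' ?_
    have hB' : ({p ∈ B | p ∈ Y}) = B :=
      eq_of_subset_of_card_le (filter_subset _ _) (by rw [hB, h])
    have hR' : ({p ∈ R | p ∈ Y}) = R :=
      eq_of_subset_of_card_le (filter_subset _ _) (by rw [hR, ← hBR, h])
    exact subset_antisymm hYP (union_subset (filter_eq_self.1 hB') (filter_eq_self.1 hR'))

lemma IsBRMatching.pm {B R : Finset Pt} (hdisj : B ∩ R = ∅) (hgen : GenPos (B ∪ R))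
    (hM : IsBRMatching B R M) : PM M := by
  have hE : ∀ p, EndP M p → p ∈ B ∪ R := by
    rintro p ⟨e, he, rfl | rfl⟩
    · exact mem_union_left _ (hM.1 e he).1
    · exact mem_union_right _ (hM.1 e he).2
  refine ⟨fun e he f hf h => ?_, fun e he f hf h => ?_, fun e he f hf h => ?_,
    fun p q r hp hq hr h1 h2 h3 h => ?_, hM.2.2.2⟩
  · exact disjoint_left.1 (disjoint_iff_inter_eq_empty.2 hdisj) (hM.1 e he).1
      (h ▸ (hM.1 f hf).2)
  · exact (hM.2.1 _ (hM.1 e he).1).unique ⟨he, rfl⟩ ⟨hf, h.symm⟩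
  · exact (hM.2.2.1 _ (hM.1 e he).2).unique ⟨he, rfl⟩ ⟨hf, h.symm⟩
  · exact hgen p (hE p hp) q (hE q hq) r (hE r hr) h1 h2 h3 (collinear_of_crs_eq_zero h1 h)

section counting

variable {B R : Finset Pt} (hM : IsBRMatching B R M) (q : Pt → Prop) [DecidablePred q]
include hM

lemma IsBRMatching.card_filter_fst : #{b ∈ B | q b} = #{a ∈ M | q a.1} := by
  symm
  refine card_bij (fun a _ => a.1) (fun a ha => ?_) (fun a ha a' ha' h => ?_) fun b hb => ?_
  · obtain ⟨h1, h2⟩ := mem_filter.1 ha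
    exact mem_filter.2 ⟨(hM.1 a h1).1, h2⟩
  · have h1 := (mem_filter.1 ha).1
    have h2 := (mem_filter.1 ha').1
    exact (hM.2.1 _ (hM.1 a h1).1).unique ⟨h1, rfl⟩ ⟨h2, h.symm⟩
  · obtain ⟨h1, h2⟩ := mem_filter.1 hb
    obtain ⟨a, ⟨h3, rfl⟩, -⟩ := hM.2.1 b h1
    exact ⟨a, mem_filter.2 ⟨h3, h2⟩, rfl⟩

lemma IsBRMatching.card_filter_snd : #{r ∈ R | q r} = #{a ∈ M | q a.2} := by
  symm
  refine card_bij (fun a _ => a.2) (fun a ha => ?_) (fun a ha a' ha' h => ?_) fun b hb => ?_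
  · obtain ⟨h1, h2⟩ := mem_filter.1 ha
    exact mem_filter.2 ⟨(hM.1 a h1).2, h2⟩
  · have h1 := (mem_filter.1 ha).1
    have h2 := (mem_filter.1 ha').1
    exact (hM.2.2.1 _ (hM.1 a h1).2).unique ⟨h1, rfl⟩ ⟨h2, h.symm⟩
  · obtain ⟨h1, h2⟩ := mem_filter.1 hb
    obtain ⟨a, ⟨h3, rfl⟩, -⟩ := hM.2.2.1 b h1
    exact ⟨a, mem_filter.2 ⟨h3, h2⟩, rfl⟩

/-- For a balanced half-plane, as many edges leave it at a blue point as at a red one. -/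
lemma IsBRMatching.card_crossings {e : Pt} {c : ℝ}
    (hbal : #{p ∈ B | Lft e c p} = #{p ∈ R | Lft e c p}) :
    #{a ∈ M | ¬ Lft e c a.1 ∧ Lft e c a.2} = #{a ∈ M | Lft e c a.1 ∧ ¬ Lft e c a.2} ∧
      #(crossings M e c) = 2 * #{a ∈ M | Lft e c a.1 ∧ ¬ Lft e c a.2} := by
  rw [hM.card_filter_fst, hM.card_filter_snd] at hbal
  have h1 := card_filter_add_card_filter_not (s := {a ∈ M | Lft e c a.1}) fun a => Lft e c a.2
  have h2 := card_filter_add_card_filter_not (s := {a ∈ M | Lft e c a.2}) fun a => Lft e c a.1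
  have h3 := card_filter_add_card_filter_not (s := crossings M e c) fun a => Lft e c a.1
  rw [filter_filter, filter_filter] at h1 h2
  rw [crossings, filter_filter, filter_filter] at h3
  have e1 : ({a ∈ M | Lft e c a.2 ∧ Lft e c a.1}) = {a ∈ M | Lft e c a.1 ∧ Lft e c a.2} :=
    filter_congr fun a _ => and_comm
  have e2 : ({a ∈ M | Lft e c a.2 ∧ ¬ Lft e c a.1}) = {a ∈ M | ¬ Lft e c a.1 ∧ Lft e c a.2} :=
    filter_congr fun a _ => and_comm
  have e3 : ({a ∈ M | ¬ (Lft e c a.1 ↔ Lft e c a.2) ∧ Lft e c a.1}) =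
      {a ∈ M | Lft e c a.1 ∧ ¬ Lft e c a.2} := filter_congr fun a _ => by tauto
  have e4 : ({a ∈ M | ¬ (Lft e c a.1 ↔ Lft e c a.2) ∧ ¬ Lft e c a.1}) =
      {a ∈ M | ¬ Lft e c a.1 ∧ Lft e c a.2} := filter_congr fun a _ => by tauto
  rw [e1, e2] at h2
  rw [e3, e4] at h3
  rw [crossings]
  omega

/-- Some compatible matching has fewer edges crossing a balanced line. -/
lemma IsBRMatching.exists_fewer_crossings (hdisj : B ∩ R = ∅) (hgen : GenPos (B ∪ R)) {e : Pt}
    {c : ℝ} (he : e ≠ 0) (hc : ∀ p ∈ B ∪ R, crs p e ≠ c)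
    (hbal : #{p ∈ B | Lft e c p} = #{p ∈ R | Lft e c p})
    (hpos : 0 < #{a ∈ M | Lft e c a.1 ∧ ¬ Lft e c a.2}) :
    ∃ M', IsBRMatching B R M' ∧ Compatible M M' ∧
      #{a ∈ M' | Lft e c a.1 ∧ ¬ Lft e c a.2} < #{a ∈ M | Lft e c a.1 ∧ ¬ Lft e c a.2} := by
  have hPM := hM.pm hdisj hgen
  obtain ⟨h1, h2⟩ := hM.card_crossings hbal
  obtain ⟨a, ha⟩ := card_pos.1 hpos
  obtain ⟨b, hb⟩ := card_pos.1 (h1 ▸ hpos)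
  obtain ⟨ha0, ha1, ha2⟩ := mem_filter.1 ha
  obtain ⟨hb0, hb1, hb2⟩ := mem_filter.1 hb
  have hside : ∀ p, EndP M p → crs p e ≠ c := by
    rintro p ⟨f, hf, rfl | rfl⟩
    · exact hc _ (mem_union_left _ (hM.1 f hf).1)
    · exact hc _ (mem_union_right _ (hM.1 f hf).2)
  obtain ⟨N, W, hN, hW, hF, f, S, hS, hfS, hfV⟩ := exists_full_cov hPM he hside
    (a := a) (b := b) (mem_filter.2 ⟨ha0, by tauto⟩) (mem_filter.2 ⟨hb0, by tauto⟩) (by tauto)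
  obtain ⟨M', h3, h4, h5⟩ := hW.exists_matching hPM hF hM hN he hside hfS hfV
  refine ⟨M', h3, h4, ?_⟩
  have h6 := (h3.card_crossings hbal).2
  rw [crossings] at h6
  omega

end counting

section paths

variable {B R : Finset Pt} {s t : ℕ} {M₁ M₂ M₃ : Finset (Pt × Pt)}

lemma IsBRMatching.compatible_self {M : Finset (Pt × Pt)} (hM : IsBRMatching B R M) :
    Compatible M M := fun e he e' he' =>
  or_iff_not_imp_left.2 fun h => by rw [hM.2.2.2 e he e' he' h]; exact Set.empty_subset _

lemma TCompatible.exists_path (h : TCompatible B R t M₁ M₂) :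
    ∃ f : ℕ → Finset (Pt × Pt), f 0 = M₁ ∧ (∀ i, t ≤ i → f i = M₂) ∧
      (∀ i, IsBRMatching B R (f i)) ∧ ∀ i, Compatible (f i) (f (i + 1)) := by
  obtain ⟨k, hk, f, h0, h1, h2, h3⟩ := h
  refine ⟨fun i => f (min i k), by simpa using h0,
    fun i hi => by simpa only [min_eq_right (hk.trans hi)] using h1,
    fun i => h2 _ (min_le_right _ _), fun i => ?_⟩
  rcases lt_or_ge i k with hi | hi
  · have := h3 i hi
    simpa only [min_eq_left hi.le, min_eq_left (Nat.succ_le_of_lt hi)] using this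
  · simpa only [min_eq_right hi, min_eq_right (hi.trans (Nat.le_succ i))] using
      (h2 k le_rfl).compatible_self

lemma IsBRMatching.tcompatible_self {M : Finset (Pt × Pt)} (hM : IsBRMatching B R M) :
    TCompatible B R 0 M M :=
  ⟨0, le_rfl, fun _ => M, rfl, rfl, fun _ _ => hM, fun _ hi => absurd hi (Nat.not_lt_zero _)⟩

lemma Compatible.tcompatible (h : Compatible M₁ M₂) (h₁ : IsBRMatching B R M₁)
    (h₂ : IsBRMatching B R M₂) : TCompatible B R 1 M₁ M₂ := by
  refine ⟨1, le_rfl, fun i => if i = 0 then M₁ else M₂, rfl, rfl, fun i _ => ?_, fun i hi => ?_⟩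
  · dsimp only
    split_ifs
    · exact h₁
    · exact h₂
  · obtain rfl : i = 0 := by omega
    simpa using h

lemma TCompatible.mono (h : TCompatible B R s M₁ M₂) (hst : s ≤ t) : TCompatible B R t M₁ M₂ := by
  obtain ⟨k, hk, f, hf⟩ := h
  exact ⟨k, hk.trans hst, f, hf⟩

lemma TCompatible.trans (h : TCompatible B R s M₁ M₂) (h' : TCompatible B R t M₂ M₃) :
    TCompatible B R (s + t) M₁ M₃ := by
  obtain ⟨f, f0, f1, f2, f3⟩ := h.exists_path
  obtain ⟨g, g0, g1, g2, g3⟩ := h'.exists_path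
  refine ⟨s + t, le_rfl, fun i => if i ≤ s then f i else g (i - s), by simp [f0], ?_,
    fun i _ => ?_, fun i _ => ?_⟩
  · dsimp only
    split_ifs with hs
    · obtain rfl : t = 0 := by omega
      rw [add_zero, f1 s le_rfl, ← g0, g1 0 le_rfl]
    · rw [Nat.add_sub_cancel_left, g1 t le_rfl]
  · dsimp only
    split_ifs
    · exact f2 i
    · exact g2 _
  · dsimp only
    rcases lt_trichotomy i s with hi | rfl | hi
    · rw [if_pos hi.le, if_pos (by omega)]; exact f3 i
    · rw [if_pos le_rfl, if_neg (by omega), f1 i le_rfl, ← g0, Nat.add_sub_cancel_left]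
      exact g3 0
    · rw [if_neg (by omega), if_neg (by omega), Nat.sub_add_comm hi.le]; exact g3 _

/-- The edges crossing a balanced line can be removed one pair at a time. -/
lemma IsBRMatching.exists_uncrossed (hdisj : B ∩ R = ∅) (hgen : GenPos (B ∪ R)) {e : Pt}
    {c : ℝ} (he : e ≠ 0) (hc : ∀ p ∈ B ∪ R, crs p e ≠ c)
    (hbal : #{p ∈ B | Lft e c p} = #{p ∈ R | Lft e c p}) (t : ℕ) :
    ∀ {M : Finset (Pt × Pt)}, IsBRMatching B R M →
      #{a ∈ M | Lft e c a.1 ∧ ¬ Lft e c a.2} ≤ t →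
      ∃ M₀, TCompatible B R t M M₀ ∧ IsBRMatching B R M₀ ∧ crossings M₀ e c = ∅ := by
  induction t with
  | zero =>
    intro M hM h
    refine ⟨M, hM.tcompatible_self, hM, card_eq_zero.1 ?_⟩
    rw [(hM.card_crossings hbal).2]; omega
  | succ t ih =>
    intro M hM h
    rcases Nat.eq_zero_or_pos #{a ∈ M | Lft e c a.1 ∧ ¬ Lft e c a.2} with h0 | h0
    · obtain ⟨M₀, h1, h2⟩ := ih hM (by omega)
      exact ⟨M₀, h1.mono (Nat.le_succ t), h2⟩
    · obtain ⟨M', h1, h2, h3⟩ := hM.exists_fewer_crossings hdisj hgen he hc hbal h0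
      obtain ⟨M₀, h4, h5⟩ := ih h1 (by omega)
      exact ⟨M₀, ((h2.tcompatible hM h1).trans h4).mono (by omega), h5⟩

end paths

section halves

variable {B R : Finset Pt} {e : Pt} {c : ℝ} (hc : ∀ p ∈ B ∪ R, crs p e ≠ c)

include hc

lemma segment_inter_halves {a b : Pt × Pt} (ha1 : a.1 ∈ ({p ∈ B | Lft e c p} : Finset Pt))
    (ha2 : a.2 ∈ ({p ∈ R | Lft e c p} : Finset Pt))
    (hb1 : b.1 ∈ ({p ∈ B | ¬ Lft e c p} : Finset Pt))
    (hb2 : b.2 ∈ ({p ∈ R | ¬ Lft e c p} : Finset Pt)) :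
    segment ℝ a.1 a.2 ∩ segment ℝ b.1 b.2 = ∅ := by
  refine Set.eq_empty_iff_forall_notMem.2 fun x hx => ?_
  have h1 := lft_of_mem_segment (mem_filter.1 ha1).2 (mem_filter.1 ha2).2 hx.1
  obtain ⟨b1, b2⟩ := mem_filter.1 hb1
  obtain ⟨b3, b4⟩ := mem_filter.1 hb2
  have h2 := rgt_of_mem_segment
    (lt_of_le_of_ne (not_lt.1 b2) (hc _ (mem_union_left _ b1)).symm)
    (lt_of_le_of_ne (not_lt.1 b4) (hc _ (mem_union_right _ b3)).symm) hx.2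
  exact lt_asymm h1 h2

lemma IsBRMatching.union {M₁ M₂ : Finset (Pt × Pt)}
    (h₁ : IsBRMatching {p ∈ B | Lft e c p} {p ∈ R | Lft e c p} M₁)
    (h₂ : IsBRMatching {p ∈ B | ¬ Lft e c p} {p ∈ R | ¬ Lft e c p} M₂) :
    IsBRMatching B R (M₁ ∪ M₂) := by
  refine ⟨fun a ha => ?_, fun b hb => ?_, fun r hr => ?_, fun a ha b hb hab => ?_⟩
  · rcases mem_union.1 ha with ha | ha
    · exact ⟨(mem_filter.1 (h₁.1 a ha).1).1, (mem_filter.1 (h₁.1 a ha).2).1⟩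
    · exact ⟨(mem_filter.1 (h₂.1 a ha).1).1, (mem_filter.1 (h₂.1 a ha).2).1⟩
  · by_cases h : Lft e c b
    · obtain ⟨a, ⟨h3, rfl⟩, h4⟩ := h₁.2.1 b (mem_filter.2 ⟨hb, h⟩)
      refine ⟨a, ⟨mem_union_left _ h3, rfl⟩, fun a' ha' => ?_⟩
      rcases mem_union.1 ha'.1 with h5 | h5
      · exact h4 a' ⟨h5, ha'.2⟩
      · exact absurd (ha'.2 ▸ h) (mem_filter.1 (h₂.1 a' h5).1).2
    · obtain ⟨a, ⟨h3, rfl⟩, h4⟩ := h₂.2.1 b (mem_filter.2 ⟨hb, h⟩)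
      refine ⟨a, ⟨mem_union_right _ h3, rfl⟩, fun a' ha' => ?_⟩
      rcases mem_union.1 ha'.1 with h5 | h5
      · exact absurd (mem_filter.1 (h₁.1 a' h5).1).2 (ha'.2 ▸ h)
      · exact h4 a' ⟨h5, ha'.2⟩
  · by_cases h : Lft e c r
    · obtain ⟨a, ⟨h3, rfl⟩, h4⟩ := h₁.2.2.1 r (mem_filter.2 ⟨hr, h⟩)
      refine ⟨a, ⟨mem_union_left _ h3, rfl⟩, fun a' ha' => ?_⟩
      rcases mem_union.1 ha'.1 with h5 | h5
      · exact h4 a' ⟨h5, ha'.2⟩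
      · exact absurd (ha'.2 ▸ h) (mem_filter.1 (h₂.1 a' h5).2).2
    · obtain ⟨a, ⟨h3, rfl⟩, h4⟩ := h₂.2.2.1 r (mem_filter.2 ⟨hr, h⟩)
      refine ⟨a, ⟨mem_union_right _ h3, rfl⟩, fun a' ha' => ?_⟩
      rcases mem_union.1 ha'.1 with h5 | h5
      · exact absurd (mem_filter.1 (h₁.1 a' h5).2).2 (ha'.2 ▸ h)
      · exact h4 a' ⟨h5, ha'.2⟩
  · rcases mem_union.1 ha with ha | ha <;> rcases mem_union.1 hb with hb | hb
    · exact h₁.2.2.2 a ha b hb hab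
    · exact segment_inter_halves hc (h₁.1 a ha).1 (h₁.1 a ha).2 (h₂.1 b hb).1 (h₂.1 b hb).2
    · rw [Set.inter_comm]
      exact segment_inter_halves hc (h₁.1 b hb).1 (h₁.1 b hb).2 (h₂.1 a ha).1 (h₂.1 a ha).2
    · exact h₂.2.2.2 a ha b hb hab

lemma Compatible.union {M₁ M₂ M₁' M₂' : Finset (Pt × Pt)}
    (h₁ : IsBRMatching {p ∈ B | Lft e c p} {p ∈ R | Lft e c p} M₁)
    (h₂ : IsBRMatching {p ∈ B | ¬ Lft e c p} {p ∈ R | ¬ Lft e c p} M₂)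
    (h₁' : IsBRMatching {p ∈ B | Lft e c p} {p ∈ R | Lft e c p} M₁')
    (h₂' : IsBRMatching {p ∈ B | ¬ Lft e c p} {p ∈ R | ¬ Lft e c p} M₂')
    (k₁ : Compatible M₁ M₁') (k₂ : Compatible M₂ M₂') :
    Compatible (M₁ ∪ M₂) (M₁' ∪ M₂') := by
  intro a ha b hb
  rcases mem_union.1 ha with ha | ha <;> rcases mem_union.1 hb with hb | hb
  · exact k₁ a ha b hb
  · right
    rw [segment_inter_halves hc (h₁.1 a ha).1 (h₁.1 a ha).2 (h₂'.1 b hb).1 (h₂'.1 b hb).2]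
    exact Set.empty_subset _
  · right
    rw [Set.inter_comm,
      segment_inter_halves hc (h₁'.1 b hb).1 (h₁'.1 b hb).2 (h₂.1 a ha).1 (h₂.1 a ha).2]
    exact Set.empty_subset _
  · exact k₂ a ha b hb

lemma TCompatible.union {t : ℕ} {M₁ M₂ M₁' M₂' : Finset (Pt × Pt)}
    (k₁ : TCompatible {p ∈ B | Lft e c p} {p ∈ R | Lft e c p} t M₁ M₁')
    (k₂ : TCompatible {p ∈ B | ¬ Lft e c p} {p ∈ R | ¬ Lft e c p} t M₂ M₂') :
    TCompatible B R t (M₁ ∪ M₂) (M₁' ∪ M₂') := by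
  obtain ⟨f, f0, f1, f2, f3⟩ := k₁.exists_path
  obtain ⟨g, g0, g1, g2, g3⟩ := k₂.exists_path
  exact ⟨t, le_rfl, fun i => f i ∪ g i, by simp only [f0, g0],
    by simp only [f1 t le_rfl, g1 t le_rfl],
    fun i _ => (f2 i).union hc (g2 i),
    fun i _ => (f3 i).union hc (f2 i) (g2 i) (f2 (i + 1)) (g2 (i + 1)) (g3 i)⟩

omit hc

lemma IsBRMatching.filter (hM : IsBRMatching B R M) (q : Pt → Prop) [DecidablePred q]
    (h : ∀ a ∈ M, q a.1 ↔ q a.2) :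
    IsBRMatching {p ∈ B | q p} {p ∈ R | q p} {a ∈ M | q a.1} := by
  refine ⟨fun a ha => ?_, fun b hb => ?_, fun r hr => ?_, fun a ha b hb => ?_⟩
  · obtain ⟨h1, h2⟩ := mem_filter.1 ha
    exact ⟨mem_filter.2 ⟨(hM.1 a h1).1, h2⟩, mem_filter.2 ⟨(hM.1 a h1).2, (h a h1).1 h2⟩⟩
  · obtain ⟨h1, h2⟩ := mem_filter.1 hb
    obtain ⟨a, ⟨h3, rfl⟩, h4⟩ := hM.2.1 b h1
    exact ⟨a, ⟨mem_filter.2 ⟨h3, h2⟩, rfl⟩, fun a' ha' => h4 a' ⟨(mem_filter.1 ha'.1).1, ha'.2⟩⟩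
  · obtain ⟨h1, h2⟩ := mem_filter.1 hr
    obtain ⟨a, ⟨h3, rfl⟩, h4⟩ := hM.2.2.1 r h1
    exact ⟨a, ⟨mem_filter.2 ⟨h3, (h a h3).2 h2⟩, rfl⟩,
      fun a' ha' => h4 a' ⟨(mem_filter.1 ha'.1).1, ha'.2⟩⟩
  · exact hM.2.2.2 a (mem_filter.1 ha).1 b (mem_filter.1 hb).1

end halves

lemma GenPos.mono {S T : Finset Pt} (h : GenPos T) (hST : S ⊆ T) : GenPos S :=
  fun p hp q hq r hr => h p (hST hp) q (hST hq) r (hST hr)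

lemma IsBRMatching.of_singleton {b r : Pt} : IsBRMatching {b} {r} {(b, r)} := by
  refine ⟨by simp, fun x hx => ⟨(b, r), by simp_all⟩, fun x hx => ⟨(b, r), by simp_all⟩, ?_⟩
  intro a ha a' ha' h
  exact absurd ((mem_singleton.1 ha).trans (mem_singleton.1 ha').symm) h

lemma IsBRMatching.eq_singleton {b r : Pt} (hM : IsBRMatching {b} {r} M) : M = {(b, r)} := by
  have h : ∀ a ∈ M, a = (b, r) := fun a ha =>
    Prod.ext (mem_singleton.1 (hM.1 a ha).1) (mem_singleton.1 (hM.1 a ha).2)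
  obtain ⟨a, ⟨ha, -⟩, -⟩ := hM.2.1 b (mem_singleton_self b)
  exact eq_singleton_iff_unique_mem.2 ⟨h a ha ▸ ha, h⟩

end

/-- There exists a BR-matching `H` (a ham-sandwich matching) such that
every BR-matching `M` is `n`-compatible with `H`. -/
theorem exists_hamSandwich_matching_n_compatible (n : ℕ) (B R : Finset Pt)
    (hdisj : B ∩ R = ∅) (hB : B.card = n) (hR : R.card = n)
    (hgen : GenPos (B ∪ R)) :
    ∃ H : Finset (Pt × Pt), IsBRMatching B R H ∧
      ∀ M : Finset (Pt × Pt), IsBRMatching B R M → TCompatible B R n M H := by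
  induction n using Nat.strong_induction_on generalizing B R with
  | _ n ih =>
  rcases lt_trichotomy n 1 with hn | rfl | hn
  · obtain rfl : n = 0 := by omega
    obtain rfl := card_eq_zero.1 hB
    obtain rfl := card_eq_zero.1 hR
    have h0 : IsBRMatching ∅ ∅ ∅ := by simp [IsBRMatching]
    refine ⟨∅, h0, fun M hM => ?_⟩
    obtain rfl : M = ∅ := eq_empty_of_forall_notMem fun a ha => notMem_empty _ (hM.1 a ha).1
    exact h0.tcompatible_self
  · obtain ⟨b, rfl⟩ := card_eq_one.1 hB
    obtain ⟨r, rfl⟩ := card_eq_one.1 hR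
    refine ⟨{(b, r)}, .of_singleton, fun M hM => ?_⟩
    obtain rfl := hM.eq_singleton
    exact hM.tcompatible_self.mono (Nat.zero_le 1)
  · obtain ⟨e, c, he, hc, hbal, hpos, hlt⟩ := exists_balanced_line hdisj hB hR hgen hn
    obtain ⟨k, hk⟩ : ∃ k, #{p ∈ B | Lft e c p} = k := ⟨_, rfl⟩
    have hk' : #{p ∈ R | Lft e c p} = k := hbal.symm.trans hk
    rw [hk] at hpos hlt
    have hd : Disjoint B R := disjoint_iff_inter_eq_empty.2 hdisj
    have hsub : ∀ (q : Pt → Prop) [DecidablePred q], {p ∈ B | q p} ∩ {p ∈ R | q p} = ∅ ∧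
        GenPos ({p ∈ B | q p} ∪ {p ∈ R | q p}) := fun q _ =>
      ⟨disjoint_iff_inter_eq_empty.1 (disjoint_filter_filter hd),
        hgen.mono (union_subset_union (filter_subset _ _) (filter_subset _ _))⟩
    have hB' : #{p ∈ B | ¬ Lft e c p} = n - k := by
      rw [← hB, ← hk, ← card_filter_add_card_filter_not (s := B) fun p => Lft e c p,
        Nat.add_sub_cancel_left]
    have hR' : #{p ∈ R | ¬ Lft e c p} = n - k := by
      rw [← hR, ← hk', ← card_filter_add_card_filter_not (s := R) fun p => Lft e c p,
        Nat.add_sub_cancel_left]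
    obtain ⟨H₁, h1, h2⟩ := ih k hlt _ _ (hsub (Lft e c)).1 hk hk' (hsub _).2
    obtain ⟨H₂, h3, h4⟩ := ih (n - k) (Nat.sub_lt (hpos.trans hlt) hpos) _ _
      (hsub fun p => ¬ Lft e c p).1 hB' hR' (hsub _).2
    refine ⟨H₁ ∪ H₂, h1.union hc h3, fun M hM => ?_⟩
    have hle : #{a ∈ M | Lft e c a.1 ∧ ¬ Lft e c a.2} ≤ min k (n - k) := by
      refine le_min ?_ ?_
      · rw [← hk, hM.card_filter_fst]
        exact card_le_card (monotone_filter_right _ fun a _ h => h.1)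
      · rw [← hR', hM.card_filter_snd]
        exact card_le_card (monotone_filter_right _ fun a _ h => h.2)
    obtain ⟨M₀, h5, h6, h7⟩ := hM.exists_uncrossed hdisj hgen he hc hbal _ hle
    have h8 : ∀ a ∈ M₀, Lft e c a.1 ↔ Lft e c a.2 := fun a ha => by
      by_contra h
      exact notMem_empty a (h7 ▸ mem_filter.2 ⟨ha, h⟩)
    have h9 := h2 _ (h6.filter (Lft e c) h8)
    have h10 := h4 _ (h6.filter (fun p => ¬ Lft e c p) fun a ha => not_congr (h8 a ha))
    have h11 := (h9.mono (le_max_left k (n - k))).union hc (h10.mono (le_max_right k (n - k)))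
    rw [filter_union_filter_not_eq] at h11
    exact (h5.trans h11).mono (by omega)
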